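/- If G is a finite simple planar graph of girth at least 7, then for every signature σ the signed graph (G,σ) admits a homomorphism to (K_6,M). -/

import Mathlib

open SimpleGraph

/-- The sign of a walk in a signed graph `(G, σ)`: the product of the signs of its edges,
counted with multiplicity. -/
def walkSign {V : Type*} {G : SimpleGraph V} (σ : Sym2 V → ℤˣ) {u v : V}
    (w : G.Walk u v) : ℤˣ :=
  (w.edges.map σ).prod

/-- A homomorphism of signed graphs: a graph homomorphism which preserves the signs of
closed walks. -/
def IsSignedHom {U V : Type*} (G : SimpleGraph U) (σ : Sym2 U → ℤˣ)
    (H : SimpleGraph V) (π : Sym2 V → ℤˣ) (f : G →g H) : Prop :=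
  ∀ (u : U) (w : G.Walk u u), walkSign π (w.map f) = walkSign σ w

/-- `(G, σ)` admits a homomorphism to `(H, π)`. -/
def SignedHom {U V : Type*} (G : SimpleGraph U) (σ : Sym2 U → ℤˣ)
    (H : SimpleGraph V) (π : Sym2 V → ℤˣ) : Prop :=
  ∃ f : G →g H, IsSignedHom G σ H π f

/-- The signature on the complete graph `K_n` (with `n` even, vertices `0, …, n-1`) whose
negative edges form the perfect matching `{01, 23, 45, …}`. For `n = 6` this is `(K_6, M)`. -/
def matchSign (n : ℕ) : Sym2 (Fin n) → ℤˣ :=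
  Sym2.lift ⟨fun a b => if (a : ℕ) / 2 = (b : ℕ) / 2 then -1 else 1, by
    intro a b
    simp only [eq_comm]⟩

/-- `H` is a minor of `G`: there are disjoint branch sets in `G` (the fibers of a partial map
`φ : V(G) → V(H)`), each nonempty and connected, one for each vertex of `H`, such that every
edge of `H` is realized by an edge of `G` between the corresponding branch sets. -/
def HasMinor {V W : Type*} (G : SimpleGraph V) (H : SimpleGraph W) : Prop :=
  ∃ φ : V → Option W,
    (∀ w : W, (G.induce {v | φ v = some w}).Connected) ∧
    (∀ w₁ w₂ : W, H.Adj w₁ w₂ →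
      ∃ v₁ v₂ : V, φ v₁ = some w₁ ∧ φ v₂ = some w₂ ∧ G.Adj v₁ v₂)

/-- A graph is planar iff it has no `K₅` minor and no `K_{3,3}` minor
(Wagner's characterization). -/
def IsPlanar {V : Type*} (G : SimpleGraph V) : Prop :=
  ¬ HasMinor G (⊤ : SimpleGraph (Fin 5)) ∧
  ¬ HasMinor G (completeBipartiteGraph (Fin 3) (Fin 3))


open SimpleGraph
namespace P6
set_option linter.unusedSectionVars false

section Basics
variable {V : Type*} [Fintype V]

/-- boundary of an edge function -/
def bd (z : Sym2 V → ZMod 2) (v : V) : ZMod 2 := ∑ u, z s(v, u)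

def Ev (G : SimpleGraph V) (z : Sym2 V → ZMod 2) : Prop :=
  (∀ e, e ∉ G.edgeSet → z e = 0) ∧ ∀ v, bd z v = 0

open Classical in
noncomputable def cut {F : Type} (G : SimpleGraph V) (a b : Sym2 V → F) (s : F → ZMod 2)
    (e : Sym2 V) : ZMod 2 := if e ∈ G.edgeSet then s (a e) + s (b e) else 0

structure IsDual (G : SimpleGraph V) {F : Type} (a b : Sym2 V → F) : Prop where
  ev : ∀ s, Ev G (cut G a b s)
  sur : ∀ z, Ev G z → ∃ s, z = cut G a b s

def HasDual (G : SimpleGraph V) : Prop := ∃ (F : Type) (a b : Sym2 V → F), IsDual G a b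

lemma bd_add (z w : Sym2 V → ZMod 2) (v : V) : bd (z + w) v = bd z v + bd w v := by
  simp [bd, Finset.sum_add_distrib]

lemma bd_zero (v : V) : bd (0 : Sym2 V → ZMod 2) v = 0 := by simp [bd]

lemma z2_self (x : ZMod 2) : x + x = 0 := CharTwo.add_self_eq_zero x

lemma z2_cases (x : ZMod 2) : x = 0 ∨ x = 1 := by revert x; decide

lemma z2_ne (x : ZMod 2) (h : x ≠ 0) : x = 1 := (z2_cases x).resolve_left h

lemma z2_eq (x y : ZMod 2) (h : x + y = 0) : x = y := by revert x y; decide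

lemma Ev.add {G : SimpleGraph V} {z w : Sym2 V → ZMod 2} (hz : Ev G z) (hw : Ev G w) :
    Ev G (z + w) :=
  ⟨fun e he => by simp [hz.1 e he, hw.1 e he], fun v => by simp [bd_add, hz.2, hw.2]⟩

lemma Ev.zero {G : SimpleGraph V} : Ev G 0 := ⟨fun _ _ => rfl, bd_zero⟩

lemma Ev.mono {G H : SimpleGraph V} (h : G ≤ H) {z : Sym2 V → ZMod 2} (hz : Ev G z) : Ev H z :=
  ⟨fun e he => hz.1 e fun h' => he (edgeSet_mono h h'), hz.2⟩

lemma Ev.of_supp {G H : SimpleGraph V} {z : Sym2 V → ZMod 2} (hz : Ev G z)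
    (h : ∀ e, z e ≠ 0 → e ∈ H.edgeSet) : Ev H z :=
  ⟨fun e he => by by_contra h'; exact he (h e h'), hz.2⟩

lemma cut_add {F : Type} (G : SimpleGraph V) (a b : Sym2 V → F) (s t : F → ZMod 2) :
    cut G a b (s + t) = cut G a b s + cut G a b t := by
  ext e; simp only [cut, Pi.add_apply]; split_ifs
  · ring
  · simp

lemma cut_const {F : Type} (G : SimpleGraph V) (a b : Sym2 V → F) (c : ZMod 2) :
    cut G a b (fun _ => c) = 0 := by
  ext e; simp [cut, z2_self]

lemma cut_add_const {F : Type} (G : SimpleGraph V) (a b : Sym2 V → F) (s : F → ZMod 2)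
    (c : ZMod 2) : cut G a b (s + fun _ => c) = cut G a b s := by
  rw [cut_add, cut_const, add_zero]

lemma cut_mem {F : Type} {G : SimpleGraph V} {a b : Sym2 V → F} {s : F → ZMod 2} {e : Sym2 V}
    (h : e ∈ G.edgeSet) : cut G a b s e = s (a e) + s (b e) := if_pos h

lemma cut_nmem {F : Type} {G : SimpleGraph V} {a b : Sym2 V → F} {s : F → ZMod 2} {e : Sym2 V}
    (h : e ∉ G.edgeSet) : cut G a b s e = 0 := if_neg h

/-- sum of the boundary vanishes -/
lemma sum_bd (z : Sym2 V → ZMod 2) (hz : ∀ v, z s(v, v) = 0) : ∑ v, bd z v = 0 := by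
  classical
  unfold bd
  rw [← Finset.sum_product']
  refine Finset.sum_involution (fun p _ => (p.2, p.1)) ?_ ?_ ?_ ?_
  · rintro ⟨a, b⟩ -; simp only [Sym2.eq_swap (a := b) (b := a)]; exact z2_self _
  · rintro ⟨a, b⟩ - h hh
    simp only [Prod.mk.injEq] at hh
    obtain ⟨rfl, -⟩ := hh
    exact h (hz _)
  · simp
  · simp

open Classical in
/-- indicator of an edge -/
noncomputable def ie (e : Sym2 V) : Sym2 V → ZMod 2 := Pi.single e 1

lemma ie_self (e : Sym2 V) : ie e e = 1 := by simp [ie]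
lemma ie_ne {e f : Sym2 V} (h : f ≠ e) : ie e f = 0 := by simp [ie, h]

open Classical in
lemma bd_ie {x y : V} (h : x ≠ y) (v : V) :
    bd (ie s(x, y)) v = (if v = x then 1 else 0) + (if v = y then 1 else 0) := by
  unfold bd
  by_cases hx : v = x
  · subst hx
    rw [Finset.sum_eq_single y]
    · simp [ie_self, h]
    · intro b _ hb; apply ie_ne; simp [hb, h]
    · simp
  · by_cases hy : v = y
    · subst hy
      rw [Finset.sum_eq_single x]
      · rw [Sym2.eq_swap, ie_self]; simp [h.symm]
      · intro b _ hb; apply ie_ne; simp [hb, h.symm]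
      · simp
    · rw [Finset.sum_eq_zero]
      · simp [hx, hy]
      · intro b _; apply ie_ne; simp [hx, hy]

open Classical in
/-- a path gives a 1-chain -/
lemma chain_of_reachable {H : SimpleGraph V} {x y : V} (h : H.Reachable x y) :
    ∃ c : Sym2 V → ZMod 2, (∀ e, e ∉ H.edgeSet → c e = 0) ∧
      ∀ v, bd c v = (if v = x then 1 else 0) + (if v = y then 1 else 0) := by
  obtain ⟨w⟩ := h
  induction w with
  | nil => exact ⟨0, fun _ _ => rfl, fun v => by rw [bd_zero, z2_self]⟩
  | @cons u v w h p ih =>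
    obtain ⟨c, hc, hb⟩ := ih
    refine ⟨c + ie s(u, v), fun e he => ?_, fun t => ?_⟩
    · have : e ≠ s(u, v) := by rintro rfl; exact he h
      simp [hc e he, ie_ne this]
    · rw [bd_add, hb, bd_ie h.ne]
      generalize (if t = u then (1 : ZMod 2) else 0) = A
      generalize (if t = v then (1 : ZMod 2) else 0) = B
      generalize (if t = w then (1 : ZMod 2) else 0) = C
      revert A B C; decide

/-- T-joins -/
lemma tjoin {H : SimpleGraph V} (f : V → ZMod 2) (hf : ∑ v, f v = 0)
    (hr : ∀ x y, f x ≠ 0 → f y ≠ 0 → H.Reachable x y) :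
    ∃ c : Sym2 V → ZMod 2, (∀ e, e ∉ H.edgeSet → c e = 0) ∧ ∀ v, bd c v = f v := by
  classical
  induction hn : (Finset.univ.filter fun v => f v ≠ 0).card using Nat.strong_induction_on
    generalizing f with
  | _ n ih =>
  subst hn
  by_cases h0 : ∀ v, f v = 0
  · exact ⟨0, fun _ _ => rfl, fun v => by rw [bd_zero, h0]⟩
  push Not at h0
  obtain ⟨x, hx⟩ := h0
  have : ∃ y, y ≠ x ∧ f y ≠ 0 := by
    by_contra hcon
    push Not at hcon
    rw [Finset.sum_eq_single x (fun b _ hb => hcon b hb) (by simp)] at hf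
    exact hx hf
  obtain ⟨y, hyx, hy⟩ := this
  obtain ⟨c, hc, hb⟩ := chain_of_reachable (hr x y hx hy)
  have key : ∀ v, (f + bd c) v ≠ 0 → f v ≠ 0 ∧ v ≠ x := by
    intro v hv
    simp only [Pi.add_apply, hb] at hv
    by_cases hvx : v = x
    · subst hvx; simp [hyx.symm, z2_ne _ hx] at hv; exact absurd (z2_self 1) hv
    · by_cases hvy : v = y
      · subst hvy; exact ⟨hy, hvx⟩
      · simpa [hvx, hvy] using hv
  obtain ⟨c', hc', hb'⟩ := ih _ (by
      apply Finset.card_lt_card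
      refine Finset.ssubset_iff_of_subset (fun v hv => ?_) |>.2 ⟨x, by simpa using hx, ?_⟩
      · simp only [Finset.mem_filter, Finset.mem_univ, true_and] at hv ⊢; exact (key v hv).1
      · simp only [Finset.mem_filter, Finset.mem_univ, true_and]
        intro h; exact (key x h).2 rfl)
    (f + bd c) (by
      simp only [Pi.add_apply, Finset.sum_add_distrib, hf, hb]
      simp only [Finset.sum_ite_eq', Finset.mem_univ, if_true, zero_add]; exact z2_self 1)
    (fun a b ha hb => hr a b (key a ha).1 (key b hb).1) rfl
  refine ⟨c' + c, fun e he => by simp [hc e he, hc' e he], fun v => ?_⟩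
  rw [bd_add, hb', Pi.add_apply, add_assoc, z2_self, add_zero]

lemma hasDual_bot : HasDual (⊥ : SimpleGraph V) := by
  refine ⟨Unit, fun _ => (), fun _ => (), fun s => ?_, fun z hz => ⟨0, ?_⟩⟩
  · have : cut (⊥ : SimpleGraph V) (fun _ => ()) (fun _ => ()) s = 0 := by
      ext e; simp [cut]
    rw [this]; exact Ev.zero
  · ext e; rw [hz.1 e (by simp), cut_nmem (by simp)]

lemma HasDual.mono {G H : SimpleGraph V} (hG : HasDual G) (h : H ≤ G) : HasDual H := by
  obtain ⟨F, a, b, hd⟩ := hG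
  let r : F → F → Prop := fun x y => ∃ e ∈ G.edgeSet, e ∉ H.edgeSet ∧ x = a e ∧ y = b e
  have hcut : ∀ s : Quot r → ZMod 2,
      cut H (Quot.mk r ∘ a) (Quot.mk r ∘ b) s = cut G a b (s ∘ Quot.mk r) := by
    intro s; ext e
    by_cases heH : e ∈ H.edgeSet
    · rw [cut_mem heH, cut_mem (edgeSet_mono h heH)]; rfl
    · rw [cut_nmem heH]
      by_cases heG : e ∈ G.edgeSet
      · rw [cut_mem heG]
        have : Quot.mk r (a e) = Quot.mk r (b e) := Quot.sound ⟨e, heG, heH, rfl, rfl⟩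
        simp only [Function.comp, this, z2_self]
      · rw [cut_nmem heG]
  refine ⟨Quot r, Quot.mk r ∘ a, Quot.mk r ∘ b, fun s => ?_, fun z hz => ?_⟩
  · refine Ev.of_supp (G := G) ?_ fun e he => ?_
    · rw [hcut]; exact hd.ev _
    · by_contra h'; exact he (cut_nmem h')
  · obtain ⟨s, hs⟩ := hd.sur z (hz.mono h)
    have hs' : ∀ x y, r x y → s x = s y := by
      rintro x y ⟨e, heG, heH, rfl, rfl⟩
      have := hz.1 e heH
      rw [hs, cut_mem heG] at this
      exact z2_eq _ _ this
    refine ⟨Quot.lift s hs', ?_⟩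
    rw [hcut, hs]; rfl

end Basics
end P6

open SimpleGraph
namespace P6
set_option linter.unusedSectionVars false

section Paste
variable {V : Type*} [Fintype V]

lemma IsDual.congr {G : SimpleGraph V} {F : Type} {a b a' b' : Sym2 V → F} (hd : IsDual G a b)
    (h : ∀ e ∈ G.edgeSet, (a' e = a e ∧ b' e = b e) ∨ (a' e = b e ∧ b' e = a e) ∨
      (a e = b e ∧ a' e = b' e)) : IsDual G a' b' := by
  have : ∀ s, cut G a' b' s = cut G a b s := by
    intro s; ext e
    by_cases he : e ∈ G.edgeSet
    · rw [cut_mem he, cut_mem he]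
      rcases h e he with ⟨h1, h2⟩ | ⟨h1, h2⟩ | ⟨h1, h2⟩
      · rw [h1, h2]
      · rw [h1, h2, add_comm]
      · rw [h1, h2, z2_self, z2_self]
    · rw [cut_nmem he, cut_nmem he]
  exact ⟨fun s => by rw [this]; exact hd.ev s, fun z hz => by
    obtain ⟨s, hs⟩ := hd.sur z hz; exact ⟨s, by rw [this, hs]⟩⟩

lemma paste {G H1 H2 : SimpleGraph V} (hG : G = H1 ⊔ H2) {F1 F2 : Type}
    {a1 b1 : Sym2 V → F1} {a2 b2 : Sym2 V → F2} (d1 : IsDual H1 a1 b1) (d2 : IsDual H2 a2 b2)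
    (hr : ∀ v v', (∃ u, H1.Adj v u ∧ ¬ H2.Adj v u) → (∃ u, H2.Adj v u) →
      (∃ u, H1.Adj v' u ∧ ¬ H2.Adj v' u) → (∃ u, H2.Adj v' u) → (H1 ⊓ H2).Reachable v v')
    (hn : ∀ s1 s2, ∃ s1' s2', cut H1 a1 b1 s1' = cut H1 a1 b1 s1 ∧
      cut H2 a2 b2 s2' = cut H2 a2 b2 s2 ∧
      ∀ e ∈ H1.edgeSet, e ∈ H2.edgeSet → s1' (b1 e) = s2' (b2 e)) : HasDual G := by
  classical
  have hle1 : H1 ≤ G := hG ▸ le_sup_left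
  have hle2 : H2 ≤ G := hG ▸ le_sup_right
  have hmem : ∀ e, e ∈ G.edgeSet ↔ e ∈ H1.edgeSet ∨ e ∈ H2.edgeSet := by
    intro e; rw [hG, edgeSet_sup]; rfl
  let r : F1 ⊕ F2 → F1 ⊕ F2 → Prop := fun x y => ∃ e ∈ H1.edgeSet, e ∈ H2.edgeSet ∧
    x = Sum.inl (b1 e) ∧ y = Sum.inr (b2 e)
  let a : Sym2 V → Quot r := fun e => Quot.mk r
    (if e ∈ H1.edgeSet then Sum.inl (a1 e) else Sum.inr (a2 e))
  let b : Sym2 V → Quot r := fun e => Quot.mk r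
    (if e ∈ H1.edgeSet then (if e ∈ H2.edgeSet then Sum.inr (a2 e) else Sum.inl (b1 e))
      else Sum.inr (b2 e))
  have hcut : ∀ s : Quot r → ZMod 2, cut G a b s =
      cut H1 a1 b1 (fun x => s (Quot.mk r (Sum.inl x))) +
      cut H2 a2 b2 (fun x => s (Quot.mk r (Sum.inr x))) := by
    intro s; ext e
    rw [Pi.add_apply]
    by_cases h1 : e ∈ H1.edgeSet <;> by_cases h2 : e ∈ H2.edgeSet
    · rw [cut_mem ((hmem e).2 (Or.inl h1)), cut_mem h1, cut_mem h2]
      have : Quot.mk r (Sum.inl (b1 e)) = Quot.mk r (Sum.inr (b2 e)) :=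
        Quot.sound ⟨e, h1, h2, rfl, rfl⟩
      simp only [a, b, h1, h2, if_true, this]
      linear_combination -(z2_self (s (Quot.mk r (Sum.inr (b2 e)))))
    · rw [cut_mem ((hmem e).2 (Or.inl h1)), cut_mem h1, cut_nmem h2]
      simp [a, b, h1, h2]
    · rw [cut_mem ((hmem e).2 (Or.inr h2)), cut_nmem h1, cut_mem h2]
      simp [a, b, h1]
    · rw [cut_nmem (fun h => ((hmem e).1 h).elim h1 h2), cut_nmem h1, cut_nmem h2, add_zero]
  refine ⟨Quot r, a, b, fun s => ?_, fun z hz => ?_⟩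
  · rw [hcut]; exact ((d1.ev _).mono hle1).add ((d2.ev _).mono hle2)
  · -- decomposition
    let z1 : Sym2 V → ZMod 2 := fun e => if e ∈ H1.edgeSet ∧ e ∉ H2.edgeSet then z e else 0
    have hf : ∀ v, bd z1 v ≠ 0 → (∃ u, H1.Adj v u ∧ ¬ H2.Adj v u) ∧ (∃ u, H2.Adj v u) := by
      intro v hv
      constructor
      · by_contra hcon
        apply hv
        apply Finset.sum_eq_zero
        intro u _
        exact if_neg fun h => hcon ⟨u, h.1, h.2⟩
      · by_contra hcon
        push Not at hcon
        apply hv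
        rw [← hz.2 v]
        apply Finset.sum_congr rfl
        intro u _
        by_cases h1 : H1.Adj v u
        · exact if_pos ⟨h1, hcon u⟩
        · have : s(v, u) ∉ G.edgeSet := fun h => ((hmem _).1 h).elim h1 (hcon u)
          rw [hz.1 _ this]; simp only [z1]; split_ifs
          · exact hz.1 _ this
          · rfl
    obtain ⟨c, hc, hcb⟩ := tjoin (H := H1 ⊓ H2) (bd z1) (sum_bd z1 fun v => if_neg (by simp))
      (fun x y hx hy => hr x y (hf x hx).1 (hf x hx).2 (hf y hy).1 (hf y hy).2)
    have hc1 : ∀ e, e ∉ H1.edgeSet → c e = 0 := fun e he => hc e fun h => he (by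
      rw [edgeSet_inf] at h; exact h.1)
    have hc2 : ∀ e, e ∉ H2.edgeSet → c e = 0 := fun e he => hc e fun h => he (by
      rw [edgeSet_inf] at h; exact h.2)
    have hy1 : Ev H1 (z1 + c) := ⟨fun e he => by
      rw [Pi.add_apply, hc1 e he, add_zero]; exact if_neg fun h => he h.1, fun v => by
      rw [bd_add, hcb, z2_self]⟩
    have hy2 : Ev H2 (z + (z1 + c)) := by
      refine ⟨fun e he => ?_, fun v => by rw [bd_add, hz.2, hy1.2, add_zero]⟩
      simp only [Pi.add_apply, hc2 e he, add_zero]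
      by_cases h1 : e ∈ H1.edgeSet
      · simp only [z1, h1, he, not_false_eq_true, and_self, if_true]; exact z2_self _
      · simp only [z1, h1, false_and, if_false, add_zero]
        exact hz.1 e fun h => ((hmem e).1 h).elim h1 he
    obtain ⟨s1, hs1⟩ := d1.sur _ hy1
    obtain ⟨s2, hs2⟩ := d2.sur _ hy2
    obtain ⟨t1, t2, e1, e2, h12⟩ := hn s1 s2
    refine ⟨Quot.lift (Sum.elim t1 t2) ?_, ?_⟩
    · rintro x y ⟨e, he1, he2, rfl, rfl⟩
      exact h12 e he1 he2
    · rw [hcut]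
      change z = cut H1 a1 b1 t1 + cut H2 a2 b2 t2
      rw [e1, e2, ← hs1, ← hs2]
      ext e
      simp only [Pi.add_apply]
      linear_combination -(z2_self (z1 e + c e))

/-- 2-sum / 1-sum pasting: at most one common edge. -/
lemma paste_le_one {G H1 H2 : SimpleGraph V} (hG : G = H1 ⊔ H2) (h1 : HasDual H1)
    (h2 : HasDual H2)
    (hr : ∀ v v', (∃ u, H1.Adj v u ∧ ¬ H2.Adj v u) → (∃ u, H2.Adj v u) →
      (∃ u, H1.Adj v' u ∧ ¬ H2.Adj v' u) → (∃ u, H2.Adj v' u) → (H1 ⊓ H2).Reachable v v')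
    (e0 : Sym2 V) (he : ∀ e ∈ H1.edgeSet, e ∈ H2.edgeSet → e = e0) : HasDual G := by
  obtain ⟨F1, a1, b1, d1⟩ := h1
  obtain ⟨F2, a2, b2, d2⟩ := h2
  refine paste hG d1 d2 hr fun s1 s2 => ⟨s1, s2 + fun _ => s1 (b1 e0) + s2 (b2 e0), rfl,
    cut_add_const _ _ _ _ _, fun e h1 h2 => ?_⟩
  rw [he e h1 h2, Pi.add_apply]
  linear_combination -(z2_self (s2 (b2 e0)))

/-- adding a pendant edge -/
lemma hasDual_leaf {G H : SimpleGraph V} {u p : V} (hu : ∀ w, G.Adj u w → w = p)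
    (hH : HasDual H) (hle : H ≤ G) (hHG : ∀ e ∈ G.edgeSet, e ≠ s(u, p) → e ∈ H.edgeSet)
    (hup : ¬ H.Adj u p) : HasDual G := by
  classical
  obtain ⟨F, a, b, d⟩ := hH
  have hcut : ∀ s, cut G a (Function.update b s(u, p) (a s(u, p))) s = cut H a b s := by
    intro s; ext e
    by_cases he : e = s(u, p)
    · subst he
      rw [cut_nmem (G := H) (by simpa using hup)]
      by_cases h : s(u, p) ∈ G.edgeSet
      · rw [cut_mem h, Function.update_self, z2_self]
      · rw [cut_nmem h]
    · by_cases h : e ∈ G.edgeSet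
      · rw [cut_mem h, cut_mem (hHG e h he), Function.update_of_ne he]
      · rw [cut_nmem h, cut_nmem fun h' => h (edgeSet_mono hle h')]
  refine ⟨F, a, Function.update b s(u, p) (a s(u, p)), fun s => ?_, fun z hz => ?_⟩
  · rw [hcut]; exact (d.ev s).mono hle
  · have h0 : z s(u, p) = 0 := by
      rw [← hz.2 u, bd, Finset.sum_eq_single p]
      · intro w _ hw; exact hz.1 _ fun h => hw (hu w h)
      · simp
    obtain ⟨s, hs⟩ := d.sur z (hz.of_supp fun e he => hHG e (by
      by_contra h; exact he (hz.1 e h)) (by rintro rfl; exact he h0))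
    exact ⟨s, by rw [hcut, hs]⟩

end Paste
end P6

open SimpleGraph
namespace P6
set_option linter.unusedSectionVars false
set_option linter.unusedSimpArgs false

section Tri
variable {V : Type*} [Fintype V]

lemma six_slots {F : Type} (α β γ δ ε ζ : F)
    (h : ∀ s : F → ZMod 2, s α + s β + s γ + s δ + (s ε + s ζ) = 0) :
    α = β ∨ γ = δ ∨ α = γ ∨ α = δ ∨ β = γ ∨ β = δ := by
  classical
  by_contra hcon
  push Not at hcon
  obtain ⟨h1, h2, h3, h4, h5, h6⟩ := hcon
  have key : ∀ x, (x = α ∨ x = β ∨ x = γ) → ε = x ∨ ζ = x := by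
    intro x hx
    by_contra hc
    push Not at hc
    have := h (Pi.single x 1)
    rcases hx with rfl | rfl | rfl <;>
      simp [Pi.single_apply, h1, h2, h3, h4, h5, h6, hc.1, hc.2, h1.symm, h2.symm, h3.symm,
        h4.symm, h5.symm, h6.symm] at this
  rcases key α (by simp) with e1 | e1 <;> rcases key β (by simp) with e2 | e2 <;>
    rcases key γ (by simp) with e3 | e3 <;> subst_vars <;> simp_all

lemma bd_three {z : Sym2 V → ZMod 2} {u p q r : V} (hpq : p ≠ q) (hrp : r ≠ p) (hrq : r ≠ q)
    (h : ∀ w, w ≠ p → w ≠ q → w ≠ r → z s(u, w) = 0) :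
    bd z u = z s(u, p) + z s(u, q) + z s(u, r) := by
  classical
  unfold bd
  rw [← Finset.sum_subset (Finset.subset_univ {p, q, r})]
  · rw [Finset.sum_insert (by simp [hpq, hrp.symm]), Finset.sum_insert (by simp [hrq.symm]),
      Finset.sum_singleton, add_assoc]
  · intro w _ hw
    simp only [Finset.mem_insert, Finset.mem_singleton, not_or] at hw
    exact h w hw.1 hw.2.1 hw.2.2

lemma bd_two {z : Sym2 V → ZMod 2} {u p q : V} (hpq : p ≠ q)
    (h : ∀ w, w ≠ p → w ≠ q → z s(u, w) = 0) :
    bd z u = z s(u, p) + z s(u, q) := by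
  classical
  unfold bd
  rw [← Finset.sum_subset (Finset.subset_univ {p, q})]
  · rw [Finset.sum_insert (by simp [hpq]), Finset.sum_singleton]
  · intro w _ hw
    simp only [Finset.mem_insert, Finset.mem_singleton, not_or] at hw
    exact h w hw.1 hw.2

/-- some dual in which `up`, `uq` share a face -/
lemma share_face {H : SimpleGraph V} {u p q r : V} (hup : H.Adj u p) (huq : H.Adj u q)
    (hpq : p ≠ q) (hr : ∀ w, H.Adj u w → w = p ∨ w = q ∨ w = r) (hH : HasDual H) :
    ∃ (F : Type) (a b : Sym2 V → F), IsDual H a b ∧ a s(u, p) = a s(u, q) := by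
  classical
  obtain ⟨F, a, b, d⟩ := hH
  have hne : s(u, p) ≠ s(u, q) := by simp [hpq, hup.ne.symm]
  have h6 : ∃ ε ζ : F, ∀ s : F → ZMod 2, s (a s(u, p)) + s (b s(u, p)) + s (a s(u, q)) +
      s (b s(u, q)) + (s ε + s ζ) = 0 := by
    by_cases hrr : H.Adj u r ∧ r ≠ p ∧ r ≠ q
    · refine ⟨a s(u, r), b s(u, r), fun s => ?_⟩
      have := (d.ev s).2 u
      rw [bd_three hpq hrr.2.1 hrr.2.2 (fun w h1 h2 h3 => cut_nmem fun h => by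
        rcases hr w h with h' | h' | h' <;> contradiction)] at this
      rw [cut_mem (by exact hup), cut_mem (by exact huq), cut_mem (by exact hrr.1)] at this
      linear_combination this
    · refine ⟨a s(u, p), a s(u, p), fun s => ?_⟩
      have := (d.ev s).2 u
      rw [bd_two hpq (fun w h1 h2 => cut_nmem fun h => by
        have h : H.Adj u w := h
        rcases hr w h with h' | h' | h'
        · exact h1 h'
        · exact h2 h'
        · subst h'; exact hrr ⟨h, h1, h2⟩)] at this
      rw [cut_mem (by exact hup), cut_mem (by exact huq)] at this
      rw [z2_self]
      linear_combination this
  obtain ⟨ε, ζ, h6⟩ := h6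
  have fin : ∀ A1 B1 A2 B2 : F,
      ((A1 = a s(u, p) ∧ B1 = b s(u, p)) ∨ (A1 = b s(u, p) ∧ B1 = a s(u, p)) ∨
        (a s(u, p) = b s(u, p) ∧ A1 = B1)) →
      ((A2 = a s(u, q) ∧ B2 = b s(u, q)) ∨ (A2 = b s(u, q) ∧ B2 = a s(u, q)) ∨
        (a s(u, q) = b s(u, q) ∧ A2 = B2)) → A1 = A2 →
      ∃ (F : Type) (a b : Sym2 V → F), IsDual H a b ∧ a s(u, p) = a s(u, q) := by
    intro A1 B1 A2 B2 h1 h2 h12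
    refine ⟨F, Function.update (Function.update a s(u, p) A1) s(u, q) A2,
      Function.update (Function.update b s(u, p) B1) s(u, q) B2, d.congr fun e _ => ?_, ?_⟩
    · by_cases e2 : e = s(u, q)
      · subst e2; simpa using h2
      · by_cases e1 : e = s(u, p)
        · subst e1; simpa [Function.update_of_ne hne] using h1
        · simp [Function.update_of_ne e2, Function.update_of_ne e1]
    · simp [Function.update_of_ne hne, h12]
  rcases six_slots _ _ _ _ _ _ h6 with h | h | h | h | h | h
  · exact fin _ _ _ _ (Or.inr (Or.inr ⟨h, rfl⟩)) (Or.inl ⟨rfl, rfl⟩) rfl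
  · exact fin _ _ _ _ (Or.inl ⟨rfl, rfl⟩) (Or.inr (Or.inr ⟨h, rfl⟩)) rfl
  · exact fin _ _ _ _ (Or.inl ⟨rfl, rfl⟩) (Or.inl ⟨rfl, rfl⟩) h
  · exact fin _ _ _ _ (Or.inl ⟨rfl, rfl⟩) (Or.inr (Or.inl ⟨rfl, rfl⟩)) h
  · exact fin _ _ _ _ (Or.inr (Or.inl ⟨rfl, rfl⟩)) (Or.inl ⟨rfl, rfl⟩) h
  · exact fin _ _ _ _ (Or.inr (Or.inl ⟨rfl, rfl⟩)) (Or.inr (Or.inl ⟨rfl, rfl⟩)) h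

open Classical in
lemma ev_triangle {G : SimpleGraph V} {u p q : V} (h1 : G.Adj u p) (h2 : G.Adj u q)
    (h3 : G.Adj p q) : Ev G (ie s(u, p) + ie s(u, q) + ie s(p, q)) := by
  refine ⟨fun e he => ?_, fun v => ?_⟩
  · have e1 : e ≠ s(u, p) := by rintro rfl; exact he h1
    have e2 : e ≠ s(u, q) := by rintro rfl; exact he h2
    have e3 : e ≠ s(p, q) := by rintro rfl; exact he h3
    simp [ie_ne e1, ie_ne e2, ie_ne e3]
  · rw [bd_add, bd_add, bd_ie h1.ne, bd_ie h2.ne, bd_ie h3.ne]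
    generalize (if v = u then (1 : ZMod 2) else 0) = A
    generalize (if v = p then (1 : ZMod 2) else 0) = B
    generalize (if v = q then (1 : ZMod 2) else 0) = C
    revert A B C; decide

lemma hasDual_triangle {G H : SimpleGraph V} {u p q r : V} (hup : G.Adj u p) (huq : G.Adj u q)
    (hpq : G.Adj p q) (hr : ∀ w, G.Adj u w → w = p ∨ w = q ∨ w = r)
    (hH : HasDual H) (hle : H ≤ G) (hHG : ∀ e ∈ G.edgeSet, e ≠ s(p, q) → e ∈ H.edgeSet)
    (hHpq : ¬ H.Adj p q) : HasDual G := by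
  classical
  have n1 : s(u, p) ≠ s(p, q) := by
    intro h; rw [Sym2.eq_swap] at h; simp at h
    rcases h with h | ⟨h, -⟩
    · exact huq.ne h
    · exact hpq.ne h
  have n2 : s(u, q) ≠ s(p, q) := by simp [hup.ne, huq.ne]
  have n3 : s(u, p) ≠ s(u, q) := by simp [hpq.ne, hup.ne.symm]
  have hup' : H.Adj u p := hHG s(u, p) hup n1
  have huq' : H.Adj u q := hHG s(u, q) huq n2
  obtain ⟨F, a, b, d, hs⟩ := share_face hup' huq' hpq.ne (fun w h => hr w (hle h)) hH
  let T := ie s(u, p) + ie s(u, q) + ie s(p, q)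
  let a' : Sym2 V → Option F := fun e =>
    if e = s(u, p) ∨ e = s(u, q) ∨ e = s(p, q) then none else some (a e)
  let b' : Sym2 V → Option F := fun e =>
    if e = s(p, q) then some (a s(u, p)) else some (b e)
  have hcut : ∀ s : Option F → ZMod 2, cut G a' b' s = cut H a b (fun x => s (some x)) +
      (s none + s (some (a s(u, p)))) • T := by
    intro s; ext e
    simp only [Pi.add_apply, Pi.smul_apply, T, smul_eq_mul]
    by_cases e3 : e = s(p, q)
    · subst e3
      rw [cut_mem (by exact hpq), cut_nmem (by exact hHpq), ie_ne n1.symm, ie_ne n2.symm, ie_self]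
      simp [a', b']
    · by_cases e1 : e = s(u, p)
      · subst e1
        rw [cut_mem (by exact hup), cut_mem (by exact hup'), ie_ne n1, ie_ne n3, ie_self]
        simp [a', b', n1]
        linear_combination -(z2_self (s (some (a s(u, p)))))
      · by_cases e2 : e = s(u, q)
        · subst e2
          rw [cut_mem (by exact huq), cut_mem (by exact huq'), ie_ne n2, ie_ne n3.symm, ie_self]
          simp [a', b', n2, hs]
          linear_combination -(z2_self (s (some (a s(u, q)))))
        · rw [ie_ne e1, ie_ne e2, ie_ne e3]
          by_cases he : e ∈ G.edgeSet
          · rw [cut_mem he, cut_mem (hHG e he e3)]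
            simp [a', b', e1, e2, e3]
          · rw [cut_nmem he, cut_nmem fun h => he (edgeSet_mono hle h)]; simp
  have hT : Ev G T := ev_triangle hup huq hpq
  have hsm : ∀ c : ZMod 2, Ev G (c • T) := by
    intro c
    rcases z2_cases c with rfl | rfl
    · rw [zero_smul]; exact Ev.zero
    · rw [one_smul]; exact hT
  refine ⟨Option F, a', b', fun s => ?_, fun z hz => ?_⟩
  · rw [hcut]; exact ((d.ev _).mono hle).add (hsm _)
  · have hz' : Ev H (z + z s(p, q) • T) := by
      refine (hz.add (hsm _)).of_supp fun e he => ?_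
      refine hHG e ?_ ?_
      · by_contra h
        exact he ((hz.add (hsm _)).1 e h)
      · rintro rfl
        apply he
        simp [T, ie_ne n1.symm, ie_ne n2.symm, ie_self, z2_self]
    obtain ⟨s, hs'⟩ := d.sur _ hz'
    refine ⟨fun o => o.elim (s (a s(u, p)) + z s(p, q)) s, ?_⟩
    rw [hcut]
    simp only [Option.elim]
    rw [← hs']
    ext e
    simp only [Pi.add_apply, Pi.smul_apply, smul_eq_mul]
    linear_combination -(z2_self (z s(p, q) * T e)) - z2_self (s (a s(u, p)) * T e)

end Tri
end P6

open SimpleGraph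
namespace P6
set_option linter.unusedSectionVars false
set_option linter.unusedSimpArgs false

section Minor
variable {V : Type*}

/-- spanning graph keeping only the edges inside `S` -/
def ind (G : SimpleGraph V) (S : Set V) : SimpleGraph V where
  Adj a b := G.Adj a b ∧ a ∈ S ∧ b ∈ S
  symm := ⟨fun _ _ h => ⟨h.1.symm, h.2.2, h.2.1⟩⟩
  loopless := ⟨fun _ h => h.1.ne rfl⟩

lemma ind_le (G : SimpleGraph V) (S : Set V) : ind G S ≤ G := fun _ _ h => h.1

lemma ind_mono (G : SimpleGraph V) {S T : Set V} (h : S ⊆ T) : ind G S ≤ ind G T :=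
  fun _ _ hh => ⟨hh.1, h hh.2.1, h hh.2.2⟩

lemma induce_reach {G : SimpleGraph V} {S : Set V} {a b : V} (ha : a ∈ S) (hb : b ∈ S)
    (h : (ind G S).Reachable a b) : (G.induce S).Reachable ⟨a, ha⟩ ⟨b, hb⟩ := by
  obtain ⟨w⟩ := h
  induction w with
  | nil => exact Reachable.refl _
  | @cons u v w h p ih =>
    exact (Adj.reachable (G := G.induce S) (u := ⟨u, ha⟩) (v := ⟨v, h.2.2⟩) h.1).trans
      (ih h.2.2 hb)

lemma reach_of_induce {G : SimpleGraph V} {S : Set V} {a b : S}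
    (h : (G.induce S).Reachable a b) : (ind G S).Reachable a b := by
  let f : G.induce S →g ind G S := ⟨fun x => x.1, fun {x y} h => ⟨h, x.2, y.2⟩⟩
  exact h.map f

lemma induce_connected {G : SimpleGraph V} {S : Set V} :
    (G.induce S).Connected ↔ S.Nonempty ∧ ∀ a ∈ S, ∀ b ∈ S, (ind G S).Reachable a b := by
  constructor
  · intro h
    obtain ⟨x⟩ := h.nonempty
    exact ⟨⟨x.1, x.2⟩, fun a ha b hb => reach_of_induce (h.preconnected ⟨a, ha⟩ ⟨b, hb⟩)⟩
  · rintro ⟨⟨x, hx⟩, h⟩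
    have : Nonempty S := ⟨⟨x, hx⟩⟩
    exact ⟨fun a b => induce_reach a.2 b.2 (h a a.2 b b.2)⟩

lemma reach_ne_adj {G : SimpleGraph V} {a b : V} (h : G.Reachable a b) (hne : a ≠ b) :
    ∃ c, G.Adj a c := by
  obtain ⟨w⟩ := h
  cases w with
  | nil => exact absurd rfl hne
  | cons h p => exact ⟨_, h⟩

lemma minor_transfer {G G' : SimpleGraph V} {W : Type} {H : SimpleGraph W}
    (hH : ∀ w, ∃ w', H.Adj w w') (c : V → V)
    (hne : ∀ w, (∃ w', G'.Adj w w') → ∃ v, c v = w)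
    (hfib : ∀ w, (∃ w', G'.Adj w w') → ∀ a b, c a = w → c b = w →
      (ind G {v | c v = w}).Reachable a b)
    (hadj : ∀ w w', G'.Adj w w' → ∃ v v', c v = w ∧ c v' = w' ∧ G.Adj v v')
    (h : HasMinor G' H) : HasMinor G H := by
  obtain ⟨φ, h1, h2⟩ := h
  have h1' : ∀ w : W, (∃ v, φ v = some w) ∧ ∀ a, φ a = some w → ∀ b, φ b = some w →
      (ind G' {v | φ v = some w}).Reachable a b := fun w => induce_connected.1 (h1 w)
  have alive : ∀ w a, φ a = some w → ∃ a', G'.Adj a a' := by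
    intro w a ha
    obtain ⟨w', hw⟩ := hH w
    obtain ⟨v1, v2, e1, e2, h12⟩ := h2 w w' hw
    by_cases hav : a = v1
    · exact ⟨v2, hav ▸ h12⟩
    · obtain ⟨x, hx⟩ := reach_ne_adj ((h1' w).2 a ha v1 e1) hav
      exact ⟨x, hx.1⟩
  refine ⟨φ ∘ c, fun w => induce_connected.2 ⟨?_, ?_⟩, fun w1 w2 h12 => ?_⟩
  · obtain ⟨v, hv⟩ := (h1' w).1
    obtain ⟨x, rfl⟩ := hne v (alive w v hv)
    exact ⟨x, hv⟩
  · intro a ha b hb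
    have key : ∀ x y, (ind G' {v | φ v = some w}).Reachable x y → φ x = some w →
        ∀ a b, c a = x → c b = y → (ind G {v | (φ ∘ c) v = some w}).Reachable a b := by
      rintro x y ⟨p⟩
      have sub : ∀ x, φ x = some w → ∀ a b, c a = x → c b = x →
          (ind G {v | (φ ∘ c) v = some w}).Reachable a b := by
        intro x hx a b ha hb
        refine (hfib x (alive w x hx) a b ha hb).mono (ind_mono G ?_)
        intro v hv
        simp only [Set.mem_ofPred_eq, Function.comp] at hv ⊢
        rw [hv, hx]
      induction p with
      | nil => intro hx a b ha hb; exact sub _ hx a b ha hb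
      | @cons x x' y h p ih =>
        intro hx a b ha hb
        obtain ⟨v, v', e1, e2, h12⟩ := hadj x x' h.1
        refine (sub x hx a v ha e1).trans (Reachable.trans (Adj.reachable ?_)
          (ih h.2.2 v' b e2 hb))
        refine ⟨h12, ?_, ?_⟩
        · simp only [Set.mem_ofPred_eq, Function.comp, e1, hx]
        · simp only [Set.mem_ofPred_eq, Function.comp, e2]; exact h.2.2
    exact key _ _ ((h1' w).2 (c a) ha (c b) hb) ha a b rfl rfl
  · obtain ⟨v1, v2, e1, e2, h⟩ := h2 w1 w2 h12
    obtain ⟨x, y, f1, f2, hxy⟩ := hadj v1 v2 h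
    exact ⟨x, y, by simp [f1, e1], by simp [f2, e2], hxy⟩

lemma planar_transfer {G G' : SimpleGraph V} (c : V → V)
    (hne : ∀ w, (∃ w', G'.Adj w w') → ∃ v, c v = w)
    (hfib : ∀ w, (∃ w', G'.Adj w w') → ∀ a b, c a = w → c b = w →
      (ind G {v | c v = w}).Reachable a b)
    (hadj : ∀ w w', G'.Adj w w' → ∃ v v', c v = w ∧ c v' = w' ∧ G.Adj v v')
    (h : IsPlanar G) : IsPlanar G' := by
  refine ⟨fun h' => h.1 (minor_transfer ?_ c hne hfib hadj h'),
    fun h' => h.2 (minor_transfer ?_ c hne hfib hadj h')⟩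
  · intro w
    exact ⟨w + 1, by simp⟩
  · rintro (w | w)
    · exact ⟨Sum.inr 0, by simp⟩
    · exact ⟨Sum.inl 0, by simp⟩

lemma planar_mono {G G' : SimpleGraph V} (h : G' ≤ G) (hG : IsPlanar G) : IsPlanar G' :=
  planar_transfer id (fun w _ => ⟨w, rfl⟩) (fun w _ a b ha hb => by
    rw [show a = w from ha, show b = w from hb]) (fun w w' h' => ⟨w, w', rfl, rfl, h h'⟩) hG

/-- contraction of `y` into `x` -/
def contr (G : SimpleGraph V) (x y : V) : SimpleGraph V where
  Adj a b := a ≠ b ∧ a ≠ y ∧ b ≠ y ∧ (G.Adj a b ∨ (a = x ∧ G.Adj y b) ∨ (b = x ∧ G.Adj y a))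
  symm := ⟨fun a b h => ⟨h.1.symm, h.2.2.1, h.2.1, by
    rcases h.2.2.2 with h | h | h
    · exact Or.inl h.symm
    · exact Or.inr (Or.inr h)
    · exact Or.inr (Or.inl h)⟩⟩
  loopless := ⟨fun _ h => h.1 rfl⟩

lemma planar_contr {G : SimpleGraph V} {x y : V} (hxy : G.Adj x y) (hG : IsPlanar G) :
    IsPlanar (contr G x y) := by
  classical
  let c : V → V := fun v => if v = y then x else v
  have cx : c x = x := by simp [c]
  have cy : c y = x := by simp [c]
  have cn : ∀ v, v ≠ y → c v = v := fun v hv => by simp [c, hv]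
  have edge : ∀ a b, c a = c b → c b = x → (ind G {v | c v = x}).Reachable a b := by
    have : (ind G {v | c v = x}).Adj x y := ⟨hxy, cx, cy⟩
    have hx : ∀ a, c a = x → (ind G {v | c v = x}).Reachable a x := by
      intro a ha
      by_cases hay : a = y
      · subst hay; exact this.symm.reachable
      · rw [cn a hay] at ha; rw [ha]
    intro a b h1 h2
    exact (hx a (h1.trans h2)).trans (hx b h2).symm
  refine planar_transfer c ?_ ?_ ?_ hG
  · rintro w ⟨w', h⟩
    exact ⟨w, cn w h.2.1⟩
  · intro w _ a b ha hb
    by_cases hw : w = x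
    · subst hw; exact edge a b (ha.trans hb.symm) hb
    · have : ∀ v, c v = w → v = w := by
        intro v hv
        by_cases hvy : v = y
        · subst hvy; exact absurd (hv.symm.trans cy) hw
        · rw [← hv, cn v hvy]
      rw [this a ha, this b hb]
  · rintro w w' ⟨_, h1, h2, h | ⟨rfl, h⟩ | ⟨rfl, h⟩⟩
    · exact ⟨w, w', cn w h1, cn w' h2, h⟩
    · exact ⟨y, w', cy, cn w' h2, h⟩
    · exact ⟨w, y, cn w h1, cy, h.symm⟩

/-- contract a connected set `Q` into `p`, producing the edge `pq` -/
lemma planar_lobe {G J : SimpleGraph V} {Q : Set V} {p q : V} (hp : p ∉ Q)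
    (hQ : ∀ a ∈ Q, (ind G (insert p Q)).Reachable a p) (hqQ : ∃ a ∈ Q, G.Adj a q) (hq : q ∉ Q)
    (hpq : p ≠ q)
    (hJ : ∀ a b, J.Adj a b → (G.Adj a b ∧ a ∉ Q ∧ b ∉ Q) ∨ (a = p ∧ b = q) ∨ (a = q ∧ b = p))
    (hG : IsPlanar G) : IsPlanar J := by
  classical
  let c : V → V := fun v => if v ∈ Q then p else v
  have cQ : ∀ v ∈ Q, c v = p := fun v hv => by simp [c, hv]
  have cn : ∀ v, v ∉ Q → c v = v := fun v hv => by simp [c, hv]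
  have hset : {v | c v = p} = insert p Q := by
    ext v
    by_cases hv : v ∈ Q
    · simp [hv, cQ]
    · simp [hv, cn]
  have hJn : ∀ a b, J.Adj a b → a ∉ Q := by
    intro a b h
    rcases hJ a b h with h | ⟨rfl, -⟩ | ⟨rfl, -⟩
    · exact h.2.1
    · exact hp
    · exact hq
  obtain ⟨a0, ha0, haq⟩ := hqQ
  refine planar_transfer c ?_ ?_ ?_ hG
  · rintro w ⟨w', h⟩
    exact ⟨w, cn w (hJn _ _ h)⟩
  · intro w _ a b ha hb
    by_cases hw : w = p
    · subst hw
      rw [hset]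
      have : ∀ a, c a = w → (ind G (insert w Q)).Reachable a w := by
        intro a ha
        by_cases haQ : a ∈ Q
        · exact hQ a haQ
        · rw [cn a haQ] at ha; rw [ha]
      exact (this a ha).trans (this b hb).symm
    · have : ∀ v, c v = w → v = w := by
        intro v hv
        by_cases hvQ : v ∈ Q
        · exact absurd (hv.symm.trans (cQ v hvQ)) hw
        · rw [← hv, cn v hvQ]
      rw [this a ha, this b hb]
  · intro w w' h
    rcases hJ w w' h with h | ⟨rfl, rfl⟩ | ⟨rfl, rfl⟩
    · exact ⟨w, w', cn w h.2.1, cn w' h.2.2, h.1⟩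
    · exact ⟨a0, w', cQ _ ha0, cn _ hq, haq⟩
    · exact ⟨w, a0, cn _ hq, cQ _ ha0, haq.symm⟩

end Minor
end P6

open SimpleGraph
namespace P6
set_option linter.unusedSectionVars false
set_option linter.unusedSimpArgs false

section MinCE
variable {V : Type*} [Fintype V]

structure MinCE (G : SimpleGraph V) : Prop where
  pl : IsPlanar G
  nd : ¬ HasDual G
  mi : ∀ H : SimpleGraph V, IsPlanar H → H.edgeSet.ncard < G.edgeSet.ncard → HasDual H

def al (G : SimpleGraph V) (v : V) : Prop := ∃ w, G.Adj v w

lemma reach_closed {G : SimpleGraph V} {S : Set V} (hS : ∀ a b, a ∈ S → G.Adj a b → b ∈ S)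
    {a b : V} (h : G.Reachable a b) (ha : a ∈ S) : b ∈ S := by
  obtain ⟨w⟩ := h
  induction w with
  | nil => exact ha
  | cons h p ih => exact ih (hS _ _ ha h)

lemma ncard_lt_of_le {G H : SimpleGraph V} (h : H ≤ G) {e : Sym2 V} (he : e ∈ G.edgeSet)
    (he' : e ∉ H.edgeSet) : H.edgeSet.ncard < G.edgeSet.ncard := by
  apply Set.ncard_lt_ncard _ (Set.toFinite _)
  exact ⟨edgeSet_mono h, fun hh => he' (hh he)⟩

lemma MinCE.sub {G H : SimpleGraph V} (m : MinCE G) (h : H ≤ G) {e : Sym2 V}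
    (he : e ∈ G.edgeSet) (he' : e ∉ H.edgeSet) : HasDual H :=
  m.mi H (planar_mono h m.pl) (ncard_lt_of_le h he he')

lemma ncard_edge_lt {G H : SimpleGraph V} (h : H ≤ G) {e1 e2 : Sym2 V} (h12 : e1 ≠ e2)
    (h1 : e1 ∈ G.edgeSet) (h1' : e1 ∉ H.edgeSet) (h2 : e2 ∈ G.edgeSet) (h2' : e2 ∉ H.edgeSet)
    (p q : V) : (H ⊔ edge p q).edgeSet.ncard < G.edgeSet.ncard := by
  have a1 : (H ⊔ edge p q).edgeSet.ncard ≤ H.edgeSet.ncard + 1 := by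
    have : (H ⊔ edge p q).edgeSet ⊆ insert s(p, q) H.edgeSet := by
      intro e he
      rw [edgeSet_sup] at he
      rcases he with he | he
      · exact Or.inr he
      · left
        have := edgeSet_fromEdgeSet ({s(p, q)} : Set (Sym2 V))
        rw [edge, this] at he
        exact he.1
    exact (Set.ncard_le_ncard this (Set.toFinite _)).trans (Set.ncard_insert_le _ _)
  have a2 : H.edgeSet.ncard + 1 < G.edgeSet.ncard := by
    have : insert e1 H.edgeSet ⊂ G.edgeSet := by
      refine ⟨Set.insert_subset h1 (edgeSet_mono h), fun hh => ?_⟩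
      rcases hh h2 with hh | hh
      · exact h12 hh.symm
      · exact h2' hh
    have := Set.ncard_lt_ncard this (Set.toFinite _)
    rwa [Set.ncard_insert_of_notMem h1' (Set.toFinite _)] at this
  omega

/-- edges with an end in `P` -/
def touch (G : SimpleGraph V) (P : Set V) : SimpleGraph V where
  Adj a b := G.Adj a b ∧ (a ∈ P ∨ b ∈ P)
  symm := ⟨fun _ _ h => ⟨h.1.symm, h.2.symm⟩⟩
  loopless := ⟨fun _ h => h.1.ne rfl⟩

lemma touch_sup (G : SimpleGraph V) (P : Set V) : G = touch G P ⊔ ind G Pᶜ := by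
  ext a b
  simp only [sup_adj, touch, ind, Set.mem_compl_iff]
  tauto

/-- reach set in `G - X` -/
def rs (G : SimpleGraph V) (X : Set V) (u : V) : Set V := {v | (ind G Xᶜ).Reachable u v}

lemma rs_step {G : SimpleGraph V} {X : Set V} {u a b : V} (ha : a ∈ rs G X u) (haX : a ∉ X)
    (hab : G.Adj a b) (hb : b ∉ X) : b ∈ rs G X u :=
  Reachable.trans ha (Adj.reachable ⟨hab, haX, hb⟩)

lemma rs_notMem {G : SimpleGraph V} {X : Set V} {u a : V} (hu : u ∉ X) (ha : a ∈ rs G X u) :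
    a ∉ X :=
  reach_closed (G := ind G Xᶜ) (S := Xᶜ) (fun _ _ _ h => h.2.2) ha hu

lemma MinCE.conn1 {G : SimpleGraph V} (m : MinCE G) {p u u' : V} (hu : al G u) (hu' : al G u')
    (hup : u ≠ p) (hup' : u' ≠ p) : (ind G {p}ᶜ).Reachable u u' := by
  by_contra hcon
  set P := rs G {p} u with hP
  have huP : u ∈ P := Reachable.refl _
  have hu'P : u' ∉ P := hcon
  have hPp : ∀ a ∈ P, a ≠ p := fun a ha => rs_notMem (X := {p}) (by simpa using hup) ha
  have out : ∀ a b, a ∈ P → G.Adj a b → b ∉ P → b = p := by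
    intro a b ha hab hb
    by_contra hbp
    exact hb (rs_step ha (by simpa using hPp a ha) hab (by simpa using hbp))
  apply m.nd
  obtain ⟨w, hw⟩ := hu
  obtain ⟨w', hw'⟩ := hu'
  have hw'P : w' ∉ P := fun h => hup' (out w' u' h hw'.symm hu'P)
  have d1 : HasDual (touch G P) := m.sub (fun _ _ h => h.1) (e := s(u', w')) hw'
    (fun h => (h : (touch G P).Adj u' w').2.elim hu'P hw'P)
  have d2 : HasDual (ind G Pᶜ) := m.sub (fun _ _ h => h.1) (e := s(u, w)) hw
    (fun h => (h : (ind G Pᶜ).Adj u w).2.1 huP)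
  have key : ∀ v, (∃ x, (touch G P).Adj v x ∧ ¬ (ind G Pᶜ).Adj v x) →
      (∃ x, (ind G Pᶜ).Adj v x) → v = p := by
    rintro v ⟨x, hx, -⟩ ⟨y, hy⟩
    exact out x v (hx.2.resolve_left hy.2.1) hx.1.symm hy.2.1
  refine paste_le_one (touch_sup G P) d1 d2 (fun v v' h1 h2 h3 h4 => ?_) s(u, u) ?_
  · rw [key v h1 h2, key v' h3 h4]
  · intro e
    induction e using Sym2.ind with
    | _ a b =>
      intro h1 h2
      have h1 : (touch G P).Adj a b := h1
      have h2 : (ind G Pᶜ).Adj a b := h2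
      exact absurd h1.2 (not_or.2 h2.2)

lemma MinCE.sep_nbr {G : SimpleGraph V} (m : MinCE G) {p q u u' : V} (hu : al G u)
    (hu' : al G u') (h1 : u ≠ p) (h2 : u ≠ q) (h1' : u' ≠ p) (h2' : u' ≠ q)
    (hcon : u' ∉ rs G {p, q} u) : ∃ a ∈ rs G {p, q} u, G.Adj a p := by
  by_contra hc
  push Not at hc
  refine hcon (reach_closed (G := ind G {q}ᶜ) (fun a b ha hab => ?_)
    (m.conn1 hu hu' h2 h2') (Reachable.refl _))
  have haX := rs_notMem (X := {p, q}) (by simp [h1, h2]) ha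
  refine rs_step ha haX hab.1 ?_
  have : b ≠ p := by rintro rfl; exact hc a ha hab.1
  have : b ≠ q := by simpa using hab.2.2
  simp [*]

lemma MinCE.conn2 {G : SimpleGraph V} (m : MinCE G) {p q u u' : V} (hu : al G u) (hu' : al G u')
    (h1 : u ≠ p) (h2 : u ≠ q) (h1' : u' ≠ p) (h2' : u' ≠ q) :
    (ind G {p, q}ᶜ).Reachable u u' := by
  by_cases hpq : p = q
  · subst hpq; simpa using m.conn1 hu hu' h1 h1'
  by_contra hcon
  set P := rs G {p, q} u with hP
  set Q := rs G {p, q} u' with hQ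
  have hu'P : u' ∉ P := hcon
  have huQ : u ∉ Q := fun h => hcon (Reachable.symm h)
  have hPX : ∀ a ∈ P, a ∉ ({p, q} : Set V) := fun a ha => rs_notMem (by simp [h1, h2]) ha
  have hQX : ∀ a ∈ Q, a ∉ ({p, q} : Set V) := fun a ha => rs_notMem (by simp [h1', h2']) ha
  have hPQ : ∀ a ∈ P, a ∉ Q := fun a ha hb => hcon (Reachable.trans ha (Reachable.symm hb))
  have sw : ∀ x, rs G {q, p} x = rs G {p, q} x := fun x => by rw [Set.pair_comm]
  obtain ⟨a1, ha1, ha1p⟩ := m.sep_nbr hu hu' h1 h2 h1' h2' hu'P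
  obtain ⟨a2, ha2, ha2q⟩ := m.sep_nbr hu hu' h2 h1 h2' h1' (by rw [sw]; exact hu'P)
  obtain ⟨b1, hb1, hb1p⟩ := m.sep_nbr hu' hu h1' h2' h1 h2 huQ
  obtain ⟨b2, hb2, hb2q⟩ := m.sep_nbr hu' hu h2' h1' h2 h1 (by rw [sw]; exact huQ)
  rw [sw] at ha2 hb2
  have pP : p ∉ P := fun h => hPX p h (by simp)
  have qP : q ∉ P := fun h => hPX q h (by simp)
  have pQ : p ∉ Q := fun h => hQX p h (by simp)
  have qQ : q ∉ Q := fun h => hQX q h (by simp)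
  have reachp : ∀ x a1, a1 ∈ rs G {p, q} x → G.Adj a1 p → x ∉ ({p, q} : Set V) →
      ∀ a ∈ rs G {p, q} x, (ind G (insert p (rs G {p, q} x))).Reachable a p := by
    intro x a1 ha1 ha1p hx a ha
    have all : ∀ a ∈ rs G {p, q} x, (ind G (insert p (rs G {p, q} x))).Reachable x a := by
      intro a ha
      have := reach_closed (G := ind G ({p, q} : Set V)ᶜ)
        (S := {b | b ∈ rs G {p, q} x ∧ (ind G (insert p (rs G {p, q} x))).Reachable x b})
        (fun c d hc hcd => by
          have hd := rs_step hc.1 hcd.2.1 hcd.1 hcd.2.2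
          exact ⟨hd, hc.2.trans (Adj.reachable ⟨hcd.1, Or.inr hc.1, Or.inr hd⟩)⟩) ha
        ⟨Reachable.refl _, Reachable.refl _⟩
      exact this.2
    exact ((all a ha).symm.trans (all a1 ha1)).trans
      (Adj.reachable ⟨ha1p, Or.inr ha1, Or.inl rfl⟩)
  -- the two pieces
  have outP : ∀ a b, a ∈ P → G.Adj a b → b ∉ P → b = p ∨ b = q := by
    intro a b ha hab hb
    by_contra hbp
    exact hb (rs_step ha (hPX a ha) hab (by simpa using hbp))
  have edge_cases : ∀ a b, (edge p q).Adj a b → (a = p ∧ b = q) ∨ (a = q ∧ b = p) := by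
    intro a b h
    rw [edge_adj] at h
    exact h.1
  have pl1 : IsPlanar (touch G P ⊔ edge p q) := by
    refine planar_lobe pQ (reachp u' b1 hb1 hb1p (by simp [h1', h2'])) ⟨b2, hb2, hb2q⟩ qQ hpq
      (fun a b h => ?_) m.pl
    rcases h with h | h
    · left
      have main : ∀ a b, a ∈ P → G.Adj a b → a ∉ Q ∧ b ∉ Q := by
        intro a b ha hab
        refine ⟨hPQ a ha, fun hbQ => ?_⟩
        by_cases hb : b ∈ P
        · exact hPQ b hb hbQ
        · rcases outP a b ha hab hb with rfl | rfl
          · exact pQ hbQ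
          · exact qQ hbQ
      rcases h.2 with h' | h'
      · exact ⟨h.1, main a b h' h.1⟩
      · exact ⟨h.1, (main b a h' h.1.symm).symm⟩
    · right; exact edge_cases a b h
  have pl2 : IsPlanar (ind G Pᶜ ⊔ edge p q) := by
    refine planar_lobe pP (reachp u a1 ha1 ha1p (by simp [h1, h2])) ⟨a2, ha2, ha2q⟩ qP hpq
      (fun a b h => ?_) m.pl
    rcases h with h | h
    · exact Or.inl h
    · right; exact edge_cases a b h
  have bP : ∀ b ∈ Q, b ∉ P := fun b hb hb' => hPQ b hb' hb
  have d1 : HasDual (touch G P ⊔ edge p q) := by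
    refine m.mi _ pl1 (ncard_edge_lt (H := touch G P) (fun _ _ h => h.1) (e1 := s(b1, p)) (e2 := s(b2, q)) ?_
      hb1p ?_ hb2q ?_ p q)
    · intro h
      rw [Sym2.eq_iff] at h
      rcases h with h | h
      · exact hpq h.2
      · exact pQ (h.2 ▸ hb2)
    · exact fun h => (h : (touch G P).Adj b1 p).2.elim (bP b1 hb1) pP
    · exact fun h => (h : (touch G P).Adj b2 q).2.elim (bP b2 hb2) qP
  have d2 : HasDual (ind G Pᶜ ⊔ edge p q) := by
    refine m.mi _ pl2 (ncard_edge_lt (H := ind G Pᶜ) (fun _ _ h => h.1) (e1 := s(a1, p)) (e2 := s(a2, q)) ?_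
      ha1p ?_ ha2q ?_ p q)
    · intro h
      rw [Sym2.eq_iff] at h
      rcases h with h | h
      · exact hpq h.2
      · exact pP (h.2 ▸ ha2)
    · exact fun h => (h : (ind G Pᶜ).Adj a1 p).2.1 ha1
    · exact fun h => (h : (ind G Pᶜ).Adj a2 q).2.1 ha2
  apply m.nd
  have hpqe : (edge p q).Adj p q := by rw [edge_adj]; exact ⟨Or.inl ⟨rfl, rfl⟩, hpq⟩
  have key : ∀ v, (∃ x, (touch G P ⊔ edge p q).Adj v x ∧ ¬ (ind G Pᶜ ⊔ edge p q).Adj v x) →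
      (∃ x, (ind G Pᶜ ⊔ edge p q).Adj v x) → v = p ∨ v = q := by
    rintro v ⟨x, hx, hx'⟩ ⟨y, hy⟩
    have hx : (touch G P).Adj v x := hx.resolve_right fun h => hx' (Or.inr h)
    rcases hy with hy | hy
    · exact outP x v (hx.2.resolve_left hy.2.1) hx.1.symm hy.2.1
    · rcases edge_cases _ _ hy with h | h
      · exact Or.inl h.1
      · exact Or.inr h.1
  have hr : ((touch G P ⊔ edge p q) ⊓ (ind G Pᶜ ⊔ edge p q)).Reachable p q :=
    Adj.reachable ⟨Or.inr hpqe, Or.inr hpqe⟩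
  have dd : HasDual (G ⊔ edge p q) := by
    refine paste_le_one ?_ d1 d2 (fun v v' g1 g2 g3 g4 => ?_) s(p, q) ?_
    · conv_lhs => rw [touch_sup G P]
      ext a b; simp only [sup_adj]; tauto
    · rcases key v g1 g2 with rfl | rfl <;> rcases key v' g3 g4 with rfl | rfl
      · exact Reachable.refl _
      · exact hr
      · exact hr.symm
      · exact Reachable.refl _
    · intro e
      induction e using Sym2.ind with
      | _ a b =>
        intro g1 g2
        have main : (edge p q).Adj a b := by
          by_contra hne
          have g1 : (touch G P).Adj a b := (g1 : _ ∨ _).resolve_right hne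
          have g2 : (ind G Pᶜ).Adj a b := (g2 : _ ∨ _).resolve_right hne
          exact absurd g1.2 (not_or.2 g2.2)
        rcases edge_cases _ _ main with ⟨rfl, rfl⟩ | ⟨rfl, rfl⟩
        · rfl
        · exact Sym2.eq_swap
  exact dd.mono le_sup_left

end MinCE
end P6

open SimpleGraph
namespace P6
set_option linter.unusedSectionVars false
set_option linter.unusedSimpArgs false

section M2
variable {V : Type*} [Fintype V]

lemma MinCE.sub_edge {G : SimpleGraph V} (m : MinCE G) {p q : V} (h : G.Adj p q) :
    HasDual (G.deleteEdges {s(p, q)}) :=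
  m.sub (deleteEdges_le _) (e := s(p, q)) h (by simp)

/-- no triangle contains a vertex of degree at most three -/
lemma MinCE.no_tri {G : SimpleGraph V} (m : MinCE G) {u p q r : V} (hup : G.Adj u p)
    (huq : G.Adj u q) (hpq : G.Adj p q) (hr : ∀ w, G.Adj u w → w = p ∨ w = q ∨ w = r) : False := by
  refine m.nd (hasDual_triangle hup huq hpq hr (m.sub_edge hpq) (deleteEdges_le _) ?_ ?_)
  · intro e he hne
    rw [edgeSet_deleteEdges]; exact ⟨he, hne⟩
  · simp

lemma MinCE.no_leaf {G : SimpleGraph V} (m : MinCE G) {u p : V} (hup : G.Adj u p)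
    (hr : ∀ w, G.Adj u w → w = p) : False := by
  refine m.nd (hasDual_leaf hr (m.sub_edge hup) (deleteEdges_le _) ?_ ?_)
  · intro e he hne
    rw [edgeSet_deleteEdges]; exact ⟨he, hne⟩
  · simp

lemma MinCE.deg3 {G : SimpleGraph V} (m : MinCE G) {u p : V} (hup : G.Adj u p) (q : V) :
    ∃ w, G.Adj u w ∧ w ≠ p ∧ w ≠ q := by
  by_contra hcon
  push Not at hcon
  have two : ∀ w, G.Adj u w → w = p ∨ w = q := fun w hw => by
    by_cases h : w = p
    · exact Or.inl h
    · exact Or.inr (hcon w hw h)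
  by_cases huq : G.Adj u q ∧ q ≠ p
  · by_cases hpq : G.Adj p q
    · exact m.no_tri (r := q) hup huq.1 hpq fun w hw => (two w hw).imp id Or.inl
    · have : ∃ x, G.Adj p x ∧ x ≠ u := by
        by_contra hc
        push Not at hc
        exact m.no_leaf hup.symm hc
      obtain ⟨x, hpx, hxu⟩ := this
      have hxq : x ≠ q := by rintro rfl; exact hpq hpx
      have := m.conn2 (p := p) (q := q) (u := u) (u' := x) ⟨p, hup⟩ ⟨p, hpx.symm⟩ hup.ne
        huq.1.ne hpx.ne.symm hxq
      obtain ⟨c, hc⟩ := reach_ne_adj this hxu.symm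
      have h2 := hc.2.2
      simp only [Set.mem_compl_iff, Set.mem_insert_iff, Set.mem_singleton_iff, not_or] at h2
      exact (two c hc.1).elim h2.1 h2.2
  · refine m.no_leaf hup fun w hw => (two w hw).elim id fun h => ?_
    subst h
    by_contra h
    exact huq ⟨hw, h⟩

/-- existence of a contractible edge -/
lemma MinCE.contractible {G : SimpleGraph V} (m : MinCE G) : ∃ x y, G.Adj x y ∧ ∀ z u u',
    al G u → al G u' → u ∉ ({x, y, z} : Set V) → u' ∉ ({x, y, z} : Set V) →
    (ind G {x, y, z}ᶜ).Reachable u u' := by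
  classical
  by_contra hcon
  push Not at hcon
  -- bad quadruples
  have hex : ∃ n, ∃ x y z u u', G.Adj x y ∧ al G u ∧ al G u' ∧ u ∉ ({x, y, z} : Set V) ∧
      u' ∉ ({x, y, z} : Set V) ∧ u' ∉ rs G {x, y, z} u ∧ (rs G {x, y, z} u).ncard = n := by
    have : ∃ x y, G.Adj x y := by
      by_contra hc
      push Not at hc
      apply m.nd
      have : G = ⊥ := by ext a b; simp [hc a b]
      rw [this]; exact hasDual_bot
    obtain ⟨x, y, hxy⟩ := this
    obtain ⟨z, u, u', h1, h2, h3, h4, h5⟩ := hcon x y hxy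
    exact ⟨_, x, y, z, u, u', hxy, h1, h2, h3, h4, h5, rfl⟩
  obtain ⟨x, y, z, u, u', hxy, hu, hu', huX, huX', hur, hn⟩ := Nat.find_spec hex
  have hmin := fun k hk => Nat.find_min hex (m := k) hk
  rw [← hn] at hmin
  set C := rs G {x, y, z} u with hC
  have hCX : ∀ a ∈ C, a ∉ ({x, y, z} : Set V) := fun a ha => rs_notMem huX ha
  simp only [Set.mem_insert_iff, Set.mem_singleton_iff, not_or] at huX huX'
  -- z has a neighbour in C
  have hz : ∃ v ∈ C, G.Adj v z := by
    by_contra hc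
    push Not at hc
    refine hur (reach_closed (G := ind G {x, y}ᶜ) (fun a b ha hab => ?_)
      (m.conn2 hu hu' huX.1 huX.2.1 huX'.1 huX'.2.1) (Reachable.refl _))
    refine rs_step ha (hCX a ha) hab.1 ?_
    have h1 : b ≠ z := by rintro rfl; exact hc a ha hab.1
    have h2 := hab.2.2
    simp only [Set.mem_compl_iff, Set.mem_insert_iff, Set.mem_singleton_iff, not_or] at h2 ⊢
    exact ⟨h2.1, h2.2, h1⟩
  obtain ⟨v, hvC, hvz⟩ := hz
  have hvX := hCX v hvC
  simp only [Set.mem_insert_iff, Set.mem_singleton_iff, not_or] at hvX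
  obtain ⟨w, t, t', ht, ht', htX, htX', htr⟩ := hcon z v hvz.symm
  -- a component avoiding x and y
  have : ∃ t t', al G t ∧ al G t' ∧ t ∉ ({z, v, w} : Set V) ∧ t' ∉ ({z, v, w} : Set V) ∧
      t' ∉ rs G {z, v, w} t ∧ x ∉ rs G {z, v, w} t ∧ y ∉ rs G {z, v, w} t := by
    have one : ∀ t, t ∉ ({z, v, w} : Set V) → x ∈ rs G {z, v, w} t → y ∈ rs G {z, v, w} t →
        False ∨ True := fun _ _ _ _ => Or.inr trivial
    -- if both components contain x or y, they are equal
    by_cases c1 : x ∈ rs G {z, v, w} t ∨ y ∈ rs G {z, v, w} t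
    · by_cases c2 : x ∈ rs G {z, v, w} t' ∨ y ∈ rs G {z, v, w} t'
      · exfalso
        apply htr
        have nX : ∀ s, s ∉ ({z, v, w} : Set V) → ∀ a ∈ rs G {z, v, w} s, a ∉ ({z, v, w} : Set V) :=
          fun s hs a ha => rs_notMem hs ha
        have hxyr : x ∉ ({z, v, w} : Set V) → y ∉ ({z, v, w} : Set V) →
            (ind G {z, v, w}ᶜ).Reachable x y := fun h1 h2 => Adj.reachable ⟨hxy, h1, h2⟩
        rcases c1 with c1 | c1 <;> rcases c2 with c2 | c2
        · exact Reachable.trans c1 (Reachable.symm c2)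
        · exact (Reachable.trans c1 (hxyr (nX t htX _ c1) (nX t' htX' _ c2))).trans
            (Reachable.symm c2)
        · exact (Reachable.trans c1 (hxyr (nX t' htX' _ c2) (nX t htX _ c1)).symm).trans
            (Reachable.symm c2)
        · exact Reachable.trans c1 (Reachable.symm c2)
      · push Not at c2
        exact ⟨t', t, ht', ht, htX', htX, fun h => htr (Reachable.symm h), c2.1, c2.2⟩
    · push Not at c1
      exact ⟨t, t', ht, ht', htX, htX', htr, c1.1, c1.2⟩
  obtain ⟨t, t', ht, ht', htX, htX', htr, hx, hy⟩ := this
  set D := rs G {z, v, w} t with hD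
  have hDX : ∀ a ∈ D, a ∉ ({z, v, w} : Set V) := fun a ha => rs_notMem htX ha
  -- v has a neighbour in D
  simp only [Set.mem_insert_iff, Set.mem_singleton_iff, not_or] at htX htX'
  have hv : ∃ d ∈ D, G.Adj d v := by
    by_contra hc
    push Not at hc
    refine htr (reach_closed (G := ind G {z, w}ᶜ) (fun a b ha hab => ?_)
      (m.conn2 ht ht' htX.1 htX.2.2 htX'.1 htX'.2.2) (Reachable.refl _))
    refine rs_step ha (hDX a ha) hab.1 ?_
    have h1 : b ≠ v := by rintro rfl; exact hc a ha hab.1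
    have h2 := hab.2.2
    simp only [Set.mem_compl_iff, Set.mem_insert_iff, Set.mem_singleton_iff, not_or] at h2 ⊢
    exact ⟨h2.1, h1, h2.2⟩
  obtain ⟨d, hdD, hdv⟩ := hv
  have nD : ∀ a ∈ D, a ∉ ({x, y, z} : Set V) := by
    intro a ha
    have h1 := hDX a ha
    simp only [Set.mem_insert_iff, Set.mem_singleton_iff, not_or] at h1 ⊢
    exact ⟨fun h => hx (h ▸ ha), fun h => hy (h ▸ ha), h1.1⟩
  have hdC : d ∈ C := rs_step hvC (hCX v hvC) hdv.symm (nD d hdD)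
  have hDC : D ⊆ C := by
    intro a ha
    have hda : (ind G {z, v, w}ᶜ).Reachable d a := (Reachable.symm hdD).trans ha
    have := reach_closed (G := ind G ({z, v, w} : Set V)ᶜ) (S := {b | b ∈ D ∧ b ∈ C})
      (fun b c hb hbc => by
        have hc : c ∈ D := rs_step hb.1 hbc.2.1 hbc.1 hbc.2.2
        exact ⟨hc, rs_step hb.2 (nD b hb.1) hbc.1 (nD c hc)⟩) hda ⟨hdD, hdC⟩
    exact this.2
  have hvD : v ∉ D := fun h => hDX v h (by simp)
  refine hmin D.ncard (Set.ncard_lt_ncard ⟨hDC, fun h => hvD (h hvC)⟩ (Set.toFinite _)) ?_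
  refine ⟨z, v, w, t, t', hvz.symm, ht, ht', ?_, ?_, htr, rfl⟩ <;>
    simp only [Set.mem_insert_iff, Set.mem_singleton_iff, not_or]
  · exact htX
  · exact htX'

end M2
end P6

open SimpleGraph
namespace P6
set_option linter.unusedSectionVars false
set_option linter.unusedSimpArgs false
section Orth
variable {V : Type*} [Fintype V]

/-- even set through exactly two given edges at `u` -/
lemma even_pair {K : SimpleGraph V} {u c c' : V} (h : K.Adj u c) (h' : K.Adj u c') (hne : c ≠ c')
    (hr : (ind K {u}ᶜ).Reachable c c') :
    ∃ z, Ev K z ∧ z s(u, c) = 1 ∧ z s(u, c') = 1 ∧ ∀ w, w ≠ c → w ≠ c' → z s(u, w) = 0 := by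
  classical
  obtain ⟨ch, hch, hb⟩ := chain_of_reachable hr
  have hu : ∀ w, ch s(u, w) = 0 := fun w => hch _ fun hh => by
    have : (ind K {u}ᶜ).Adj u w := hh
    exact this.2.1 rfl
  refine ⟨ch + ie s(u, c) + ie s(u, c'), ⟨fun e he => ?_, fun v => ?_⟩, ?_, ?_, ?_⟩
  · have h1 : e ≠ s(u, c) := by rintro rfl; exact he h
    have h2 : e ≠ s(u, c') := by rintro rfl; exact he h'
    have h3 : ch e = 0 := hch _ fun hh => he (edgeSet_mono (ind_le _ _) hh)
    simp [ie_ne h1, ie_ne h2, h3]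
  · rw [bd_add, bd_add, hb, bd_ie h.ne, bd_ie h'.ne]
    generalize (if v = u then (1 : ZMod 2) else 0) = A
    generalize (if v = c then (1 : ZMod 2) else 0) = B
    generalize (if v = c' then (1 : ZMod 2) else 0) = C
    revert A B C; decide
  · have h1 : s(u, c) ≠ s(u, c') := by simp [hne, h.ne.symm]
    simp [hu, ie_self, ie_ne h1]
  · have h1 : s(u, c') ≠ s(u, c) := by simp [hne.symm, h'.ne.symm]
    simp [hu, ie_self, ie_ne h1]
  · intro w h1 h2
    have e1 : s(u, w) ≠ s(u, c) := by simp [h1, h.ne]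
    have e2 : s(u, w) ≠ s(u, c') := by simp [h2, h'.ne]
    simp [hu, ie_ne e1, ie_ne e2]

lemma orth {K : SimpleGraph V} {u : V} (t : Sym2 V → ZMod 2)
    (ht : ∀ z, Ev K z → bd (t * z) u = 0)
    (hc : ∀ c c', K.Adj u c → K.Adj u c' → (ind K {u}ᶜ).Reachable c c') {c c' : V}
    (h : K.Adj u c) (h' : K.Adj u c') : t s(u, c) = t s(u, c') := by
  by_cases hne : c = c'
  · rw [hne]
  obtain ⟨z, hz, h1, h2, h3⟩ := even_pair h h' hne (hc _ _ h h')
  have := ht z hz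
  rw [bd_two (p := c) (q := c') hne (fun w hw hw' => by simp [h3 w hw hw'])] at this
  simp only [Pi.mul_apply, h1, h2, mul_one] at this
  exact z2_eq _ _ this

lemma bd_congr {z w : Sym2 V → ZMod 2} {u : V} (h : ∀ c, z s(u, c) = w s(u, c)) :
    bd z u = bd w u := by
  unfold bd; exact Finset.sum_congr rfl fun c _ => h c

/-- if a cut vanishes on the star of `u`, the potential is constant on faces around `u` -/
lemma const_at {K : SimpleGraph V} {F : Type} {a b : Sym2 V → F} (d : IsDual K a b) {u : V}
    (s : F → ZMod 2) (hs : ∀ c, K.Adj u c → s (a s(u, c)) = s (b s(u, c)))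
    (hc : ∀ c c', K.Adj u c → K.Adj u c' → (ind K {u}ᶜ).Reachable c c') {c c' : V}
    (h : K.Adj u c) (h' : K.Adj u c') : s (a s(u, c)) = s (a s(u, c')) := by
  refine orth (fun e => s (a e)) (fun z hz => ?_) hc h h'
  obtain ⟨t, rfl⟩ := d.sur z hz
  rw [← (d.ev (s * t)).2 u]
  refine bd_congr fun w => ?_
  by_cases hw : K.Adj u w
  · rw [Pi.mul_apply, cut_mem (by exact hw), cut_mem (by exact hw), Pi.mul_apply, Pi.mul_apply,
      ← hs w hw]; ring
  · rw [Pi.mul_apply, cut_nmem (by exact hw), cut_nmem (by exact hw), mul_zero]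

/-- minimality of facial sets -/
lemma face_min {L : SimpleGraph V} {F : Type} {a b : Sym2 V → F} (d : IsDual L a b) (φ : F)
    (hL : ∀ u u', al L u → al L u' → L.Reachable u u')
    (hL1 : ∀ p u u', al L u → al L u' → u ≠ p → u' ≠ p → (ind L {p}ᶜ).Reachable u u')
    {C : Sym2 V → ZMod 2} (hC : ∀ e ∈ L.edgeSet, C e = 1 →
      (a e = φ ∧ b e ≠ φ) ∨ (b e = φ ∧ a e ≠ φ))
    {z : Sym2 V → ZMod 2} (hz : Ev L z) (hzC : ∀ e, z e = 1 → C e = 1)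
    (hz0 : ∃ e, z e = 1) : ∀ e ∈ L.edgeSet, z e = C e := by
  obtain ⟨s, hs, hsφ⟩ : ∃ s, z = cut L a b s ∧ s φ = 0 := by
    obtain ⟨s, rfl⟩ := d.sur z hz
    exact ⟨s + fun _ => s φ, (cut_add_const _ _ _ _ _).symm, z2_self _⟩
  let m : Sym2 V → ZMod 2 := fun e => s (a e) + s (b e) + s (a e) * s (b e)
  have hkey : ∀ e ∈ L.edgeSet, s (a e) + s (b e) = 1 → a e = φ ∨ b e = φ := by
    intro e he h1
    rcases hC e he (hzC e (by rw [hs, cut_mem he, h1])) with h | h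
    · exact Or.inl h.1
    · exact Or.inr h.1
  have hm : ∀ u, ∀ z', Ev L z' → bd (m * z') u = 0 := by
    intro u z' hz'
    obtain ⟨t, rfl, htφ⟩ : ∃ t, z' = cut L a b t ∧ t φ = 0 := by
      obtain ⟨s, rfl⟩ := d.sur z' hz'
      exact ⟨s + fun _ => s φ, (cut_add_const _ _ _ _ _).symm, z2_self _⟩
    rw [← (d.ev (s * t)).2 u]
    refine bd_congr fun w => ?_
    by_cases hw : s(u, w) ∈ L.edgeSet
    · have hk := hkey _ hw
      rw [Pi.mul_apply, cut_mem hw, cut_mem hw, Pi.mul_apply, Pi.mul_apply]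
      have h1 : s (a s(u,w)) + s (b s(u,w)) = 1 → (s (a s(u,w)) = 0 ∧ t (a s(u,w)) = 0) ∨ (s (b s(u,w)) = 0 ∧ t (b s(u,w)) = 0) := by
        intro h
        rcases hk h with h' | h' <;> rw [h', hsφ, htφ] <;> simp
      simp only [m]
      generalize s (a s(u,w)) = A at *
      generalize s (b s(u,w)) = B at *
      generalize t (a s(u,w)) = C at *
      generalize t (b s(u,w)) = D at *
      clear hk
      revert A B C D; decide
    · rw [Pi.mul_apply, cut_nmem hw, cut_nmem hw, mul_zero]
  have hstar : ∀ u c c', L.Adj u c → L.Adj u c' → m s(u, c) = m s(u, c') := fun u c c' h h' =>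
    orth m (hm u) (fun p q hp hq => hL1 u p q ⟨u, hp.symm⟩ ⟨u, hq.symm⟩ hp.ne.symm hq.ne.symm) h h'
  obtain ⟨e0, he0⟩ := hz0
  have he0L : e0 ∈ L.edgeSet := by by_contra h; rw [hz.1 _ h] at he0; exact zero_ne_one he0
  induction e0 using Sym2.ind with
  | _ p q =>
  have hm0 : m s(p, q) = 1 := by
    have : s (a s(p,q)) + s (b s(p,q)) = 1 := by rw [← he0, hs, cut_mem he0L]
    simp only [m]
    generalize s (a s(p,q)) = A at *
    generalize s (b s(p,q)) = B at *
    revert A B; decide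
  have hall : ∀ u, L.Reachable p u → ∀ c, L.Adj u c → m s(u, c) = 1 := by
    intro u hu
    refine reach_closed (S := {u | ∀ c, L.Adj u c → m s(u, c) = 1}) ?_ hu ?_
    · intro x y hx hxy c hc
      rw [hstar y c x hc hxy.symm, Sym2.eq_swap]; exact hx y hxy
    · intro c hc; rw [hstar p c q hc he0L]; exact hm0
  intro e he
  by_cases hCe : C e = 1
  · rw [hCe]
    induction e using Sym2.ind with
    | _ u w =>
    have h1 := hall u (hL p u ⟨q, he0L⟩ ⟨w, he⟩) w he
    rw [hs, cut_mem he]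
    simp only [m] at h1
    rcases hC _ he hCe with h | h <;> rw [h.1, hsφ] at h1 ⊢ <;> simpa using h1
  · have : C e = 0 := by by_contra h; exact hCe (z2_ne _ h)
    rw [this]
    by_contra h; exact hCe (hzC e (z2_ne _ h))

/-- the support of a minimal even set is connected -/
lemma min_conn {L : SimpleGraph V} {C : Sym2 V → ZMod 2} (hC : Ev L C)
    (hmin : ∀ z, Ev L z → (∀ e, z e = 1 → C e = 1) → (∃ e, z e = 1) → ∀ e ∈ L.edgeSet, z e = C e)
    {J : SimpleGraph V} (hJ : ∀ u w, J.Adj u w ↔ C s(u, w) = 1) {v v' : V} (hv : al J v) (hv' : al J v') :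
    J.Reachable v v' := by
  classical
  let z : Sym2 V → ZMod 2 := fun e => if (∃ u ∈ e, J.Reachable v u) then C e else 0
  have hz1 : ∀ u w, C s(u, w) = 1 → ((∃ x ∈ s(u, w), J.Reachable v x) ↔ J.Reachable v u) := by
    intro u w h
    constructor
    · rintro ⟨x, hx, hr⟩
      rcases Sym2.mem_iff.1 hx with rfl | rfl
      · exact hr
      · exact hr.trans (((hJ _ _).2 h).symm.reachable)
    · intro hr; exact ⟨u, by simp, hr⟩
  have hz : ∀ u w, z s(u, w) = if J.Reachable v u then C s(u, w) else 0 := by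
    intro u w
    by_cases h : C s(u, w) = 1
    · simp only [z, hz1 u w h]
    · have : C s(u, w) = 0 := by by_contra h'; exact h (z2_ne _ h')
      simp [z, this]
  have hze : Ev L z := by
    refine ⟨fun e he => by simp [z, hC.1 e he], fun u => ?_⟩
    by_cases h : J.Reachable v u
    · rw [← hC.2 u]; exact bd_congr fun w => by rw [hz, if_pos h]
    · rw [← bd_zero u]; exact bd_congr fun w => by rw [hz, if_neg h]; rfl
  obtain ⟨w, hw⟩ := hv
  obtain ⟨w', hw'⟩ := hv'
  have := hmin z hze (fun e he => by
    by_contra h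
    simp only [z] at he; split_ifs at he
    · exact h he
    · simp at he) ⟨s(v, w), by rw [hz, if_pos (Reachable.refl _)]; exact (hJ _ _).1 hw⟩
    s(v', w') (by by_contra h; have := hC.1 _ h; rw [(hJ _ _).1 hw'] at this; simp at this)
  rw [hz, (hJ _ _).1 hw'] at this
  by_contra h
  simp [h] at this
end Orth
end P6

open SimpleGraph
namespace P6
set_option linter.unusedSectionVars false
set_option linter.unusedSimpArgs false
section Disk
variable {V : Type*} [Fintype V]

open Classical in
/-- deleting a vertex merges the surrounding faces -/
lemma vertex_dual {K : SimpleGraph V} {F : Type} {a b : Sym2 V → F} (d : IsDual K a b) {x p : V}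
    (hp : K.Adj x p)
    (hc : ∀ c c', K.Adj x c → K.Adj x c' → (ind K {x}ᶜ).Reachable c c') :
    ∃ (m : F → F) (φ : F), IsDual (ind K {x}ᶜ) (m ∘ a) (m ∘ b) ∧
      (∀ c, K.Adj x c → m (a s(x, c)) = φ ∧ m (b s(x, c)) = φ) ∧
      (∀ f, m f = φ ∨ m f = f) := by
  let Φ : Set F := {f | ∃ c, K.Adj x c ∧ (f = a s(x, c) ∨ f = b s(x, c))}
  let φ := a s(x, p)
  have hφ : φ ∈ Φ := ⟨p, hp, Or.inl rfl⟩
  let m : F → F := fun f => if f ∈ Φ then φ else f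
  have hma : ∀ c, K.Adj x c → m (a s(x, c)) = φ := fun c h => if_pos ⟨c, h, Or.inl rfl⟩
  have hmb : ∀ c, K.Adj x c → m (b s(x, c)) = φ := fun c h => if_pos ⟨c, h, Or.inr rfl⟩
  have hle := ind_le K {x}ᶜ
  have hout : ∀ e, e ∈ K.edgeSet → e ∉ (ind K {x}ᶜ).edgeSet → ∃ c, K.Adj x c ∧ e = s(x, c) := by
    intro e
    induction e using Sym2.ind with
    | _ u w =>
    intro h h'
    have h : K.Adj u w := h
    by_cases hu : u = x
    · subst hu; exact ⟨w, h, rfl⟩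
    · by_cases hw : w = x
      · subst hw; exact ⟨u, h.symm, Sym2.eq_swap⟩
      · exact absurd (show (ind K {x}ᶜ).Adj u w from ⟨h, hu, hw⟩) h'
  have hcut : ∀ s, cut (ind K {x}ᶜ) (m ∘ a) (m ∘ b) s = cut K a b (s ∘ m) := by
    intro s; ext e
    by_cases heL : e ∈ (ind K {x}ᶜ).edgeSet
    · rw [cut_mem heL, cut_mem (edgeSet_mono hle heL)]; rfl
    · rw [cut_nmem heL]
      by_cases heK : e ∈ K.edgeSet
      · obtain ⟨c, hc, rfl⟩ := hout e heK heL
        rw [cut_mem heK]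
        simp only [Function.comp, hma c hc, hmb c hc, z2_self]
      · rw [cut_nmem heK]
  refine ⟨m, φ, ⟨fun s => ?_, fun z hz => ?_⟩, fun c h => ⟨hma c h, hmb c h⟩, fun f => ?_⟩
  · refine Ev.of_supp (G := K) (by rw [hcut]; exact d.ev _) fun e he => ?_
    by_contra h; exact he (cut_nmem h)
  · obtain ⟨s, hs⟩ := d.sur z (hz.mono hle)
    have h0 : ∀ c, K.Adj x c → s (a s(x, c)) = s (b s(x, c)) := by
      intro c hc'
      have : z s(x, c) = 0 := hz.1 _ fun h => by
        have h : (ind K {x}ᶜ).Adj x c := h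
        exact h.2.1 rfl
      rw [hs, cut_mem (by exact hc')] at this
      exact z2_eq _ _ this
    refine ⟨s, ?_⟩
    rw [hcut, hs]
    congr 1
    ext f
    simp only [Function.comp, m]
    split_ifs with hf
    · obtain ⟨c, hc', rfl | rfl⟩ := hf
      · exact const_at d s h0 hc hc' hp
      · rw [← h0 c hc']; exact const_at d s h0 hc hc' hp
    · rfl
  · simp only [m]; split_ifs <;> simp

lemma contr_ind {G : SimpleGraph V} {x y : V} : ind (contr G x y) {x}ᶜ = ind G {x, y}ᶜ := by
  ext p q
  simp only [ind, contr, Set.mem_compl_iff, Set.mem_singleton_iff, Set.mem_insert_iff, not_or]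
  constructor
  · rintro ⟨⟨h1, h2, h3, h4⟩, h5, h6⟩
    refine ⟨?_, ⟨h5, h2⟩, h6, h3⟩
    rcases h4 with h | h | h
    · exact h
    · exact absurd h.1 h5
    · exact absurd h.1 h6
  · rintro ⟨h, ⟨h1, h2⟩, h3, h4⟩
    exact ⟨⟨h.ne, h2, h4, Or.inl h⟩, h1, h3⟩

lemma contr_ncard {G : SimpleGraph V} {x y : V} (h : G.Adj x y) :
    (contr G x y).edgeSet.ncard < G.edgeSet.ncard := by
  classical
  let c : V → V := fun v => if v = y then x else v
  have hsub : (contr G x y).edgeSet ⊆ (Sym2.map c) '' (G.edgeSet \ {s(x, y)}) := by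
    intro e
    induction e using Sym2.ind with
    | _ p q =>
    intro hpq
    have hpq : (contr G x y).Adj p q := hpq
    obtain ⟨h1, h2, h3, h4⟩ := hpq
    rcases h4 with h | ⟨rfl, h7⟩ | ⟨rfl, h7⟩
    · refine ⟨s(p, q), ⟨h, ?_⟩, by simp [c, h2, h3]⟩
      simp [h2, h3]
    · refine ⟨s(y, q), ⟨h7, ?_⟩, by simp [c, h3]⟩
      simp [h1.symm, h3]
    · refine ⟨s(p, y), ⟨h7.symm, ?_⟩, by simp [c, h2]⟩
      simp [h2, h1]
  calc _ ≤ _ := Set.ncard_le_ncard hsub (Set.toFinite _)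
    _ ≤ (G.edgeSet \ {s(x, y)}).ncard := Set.ncard_image_le (Set.toFinite _)
    _ < _ := by
      apply Set.ncard_lt_ncard _ (Set.toFinite _)
      refine ⟨Set.sdiff_subset, fun hh => ?_⟩
      exact (hh (show s(x, y) ∈ G.edgeSet from h)).2 rfl

/-- two neighbours avoiding `x, y` -/
lemma MinCE.two {G : SimpleGraph V} (m : MinCE G) {x y c : V} (hxy : G.Adj x y) (hc : al G c)
    : ∃ w w', w ≠ w' ∧ G.Adj c w ∧ G.Adj c w' ∧ w ≠ x ∧ w ≠ y ∧ w' ≠ x ∧ w' ≠ y := by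
  by_contra hcon
  push Not at hcon
  obtain ⟨w, hw, hwx, hwy⟩ : ∃ w, G.Adj c w ∧ w ≠ x ∧ w ≠ y := by
    obtain ⟨p, hp⟩ := hc
    by_cases hcx : G.Adj c x
    · exact m.deg3 hcx y
    · by_cases hcy : G.Adj c y
      · obtain ⟨w, h1, h2, h3⟩ := m.deg3 hcy x; exact ⟨w, h1, h3, h2⟩
      · exact ⟨p, hp, fun h => hcx (h ▸ hp), fun h => hcy (h ▸ hp)⟩
  have hall : ∀ w', G.Adj c w' → w' = x ∨ w' = y ∨ w' = w := by
    intro w' hw'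
    by_contra hh
    push Not at hh
    exact hh.2.1 (hcon w w' hh.2.2.symm hw hw' hwx hwy hh.1)
  by_cases hcx : G.Adj c x
  · by_cases hcy : G.Adj c y
    · exact m.no_tri hcx hcy hxy hall
    · obtain ⟨w', h1, h2, h3⟩ := m.deg3 hcx w
      rcases hall w' h1 with h | h | h
      · exact h2 h
      · exact hcy (h ▸ h1)
      · exact h3 h
  · obtain ⟨w', h1, h2, h3⟩ := m.deg3 hw y
    rcases hall w' h1 with h | h | h
    · exact hcx (h ▸ h1)
    · exact h3 h
    · exact h2 h

/-- the cycle around a contracted edge -/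
lemma MinCE.disk {G : SimpleGraph V} (m : MinCE G) {x y : V} (hxy : G.Adj x y)
    (hcon : ∀ z u u', al G u → al G u' → u ∉ ({x, y, z} : Set V) → u' ∉ ({x, y, z} : Set V) →
      (ind G {x, y, z}ᶜ).Reachable u u') :
    ∃ (F : Type) (a b : Sym2 V → F) (φ : F) (C : Sym2 V → ZMod 2), IsDual (ind G {x, y}ᶜ) a b ∧
      Ev (ind G {x, y}ᶜ) C ∧
      (∀ e, C e = 1 → (a e = φ ∧ b e ≠ φ) ∨ (b e = φ ∧ a e ≠ φ)) ∧
      (∀ c, c ≠ x → c ≠ y → (G.Adj x c ∨ G.Adj y c) → ∃ w, C s(c, w) = 1) := by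
  classical
  obtain ⟨F, a, b, d⟩ := m.mi _ (planar_contr hxy m.pl) (contr_ncard hxy)
  set K := contr G x y with hK
  have hKx : ∀ c, K.Adj x c ↔ c ≠ x ∧ c ≠ y ∧ (G.Adj x c ∨ G.Adj y c) := by
    intro c
    simp only [hK, contr]
    constructor
    · rintro ⟨h1, h2, h3, h | h | h⟩
      · exact ⟨h1.symm, h3, Or.inl h⟩
      · exact ⟨h1.symm, h3, Or.inr h.2⟩
      · exact absurd h.1.symm h1
    · rintro ⟨h1, h2, h | h⟩
      · exact ⟨h1.symm, hxy.ne, h2, Or.inl h⟩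
      · exact ⟨h1.symm, hxy.ne, h2, Or.inr (Or.inl ⟨trivial, h⟩)⟩
  have hKal : ∀ c, c ≠ x → al K c → al G c ∧ c ≠ y := by
    rintro c hc ⟨w, h1, h2, h3, h | h | h⟩
    · exact ⟨⟨w, h⟩, h2⟩
    · exact absurd h.1 hc
    · exact ⟨⟨y, h.2.symm⟩, h2⟩
  have hconn : ∀ c c', K.Adj x c → K.Adj x c' → (ind K {x}ᶜ).Reachable c c' := by
    intro c c' h h'
    rw [hK, contr_ind]
    rw [hKx] at h h'
    exact m.conn2 (hKal c h.1 ⟨x, ((hKx c).2 h).symm⟩).1 (hKal c' h'.1 ⟨x, ((hKx c').2 h').symm⟩).1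
      h.1 h.2.1 h'.1 h'.2.1
  obtain ⟨p, hp1, hp2, hp3⟩ := m.deg3 hxy x
  have hp : K.Adj x p := (hKx p).2 ⟨hp3, hp2, Or.inl hp1⟩
  obtain ⟨mm, φ, dL, hmx, hmm⟩ := vertex_dual d hp hconn
  rw [hK, contr_ind] at dL
  set L := ind G {x, y}ᶜ with hL
  let i : F → ZMod 2 := fun f => if f = φ then 1 else 0
  refine ⟨F, mm ∘ a, mm ∘ b, φ, cut L (mm ∘ a) (mm ∘ b) i, dL, dL.ev _, ?_, ?_⟩
  · intro e he
    by_cases hLe : e ∈ L.edgeSet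
    · rw [cut_mem hLe] at he
      simp only [i] at he
      split_ifs at he with h1 h2 h2
      · exact absurd he (by decide)
      · exact Or.inl ⟨h1, h2⟩
      · exact Or.inr ⟨h2, h1⟩
      · exact absurd he (by decide)
    · rw [cut_nmem hLe] at he; exact absurd he (by decide)
  · intro c hcx hcy hc
    by_contra hno
    push Not at hno
    have hxc : K.Adj x c := (hKx c).2 ⟨hcx, hcy, hc⟩
    have hcG : al G c := (hKal c hcx ⟨x, hxc.symm⟩).1
    have hLK : ∀ u w, L.Adj u w → K.Adj u w := by
      rintro u w ⟨h, h1, h2⟩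
      simp only [Set.mem_compl_iff, Set.mem_insert_iff, Set.mem_singleton_iff, not_or] at h1 h2
      exact ⟨h.ne, h1.2, h2.2, Or.inl h⟩
    have hKL : ∀ u w, u ≠ x → w ≠ x → K.Adj u w → L.Adj u w := by
      rintro u w hu hw ⟨h1, h2, h3, h | h | h⟩
      · exact ⟨h, by simp [hu, h2], by simp [hw, h3]⟩
      · exact absurd h.1 hu
      · exact absurd h.1 hw
    have hs : ∀ w, K.Adj c w → (i ∘ mm) (a s(c, w)) = (i ∘ mm) (b s(c, w)) := by
      intro w hw
      by_cases hwx : w = x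
      · subst hwx
        have := hmx c hxc
        rw [Sym2.eq_swap]
        simp only [Function.comp, this]
      · have hLw := hKL c w hcx hwx hw
        have := hno w
        rw [cut_mem (by exact hLw)] at this
        have h0 : ∀ A B : ZMod 2, A + B ≠ 1 → A = B := by decide
        exact h0 _ _ this
    have hcK : ∀ w w', K.Adj c w → K.Adj c w' → (ind K {c}ᶜ).Reachable w w' := by
      have hx : ∀ w, K.Adj c w → (ind K {c}ᶜ).Reachable x w := by
        intro w hw
        by_cases hwx : w = x
        · rw [hwx]
        obtain ⟨p', h1, h2, h3⟩ := m.deg3 hxy c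
        have hw' := hKal w hwx ⟨c, hw.symm⟩
        have hxp : K.Adj x p' := (hKx p').2 ⟨h1.ne.symm, h2, Or.inl h1⟩
        have hr := hcon c p' w ⟨x, h1.symm⟩ hw'.1 (by simp [h1.ne.symm, h2, h3])
          (by simp [hwx, hw'.2, hw.ne.symm])
        refine Reachable.trans (Adj.reachable (v := p') ⟨hxp, ?_, ?_⟩) (hr.mono ?_)
        · simp [hcx.symm]
        · simp [h3]
        · rintro u w ⟨h, h1, h2⟩
          simp only [Set.mem_compl_iff, Set.mem_insert_iff, Set.mem_singleton_iff, not_or] at h1 h2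
          exact ⟨⟨h.ne, h1.2.1, h2.2.1, Or.inl h⟩, by simp [h1.2.2], by simp [h2.2.2]⟩
      intro w w' h h'; exact (hx w h).symm.trans (hx w' h')
    have hφ : ∀ w, L.Adj c w → mm (a s(c, w)) = φ ∧ mm (b s(c, w)) = φ := by
      intro w hw
      have h1 := const_at d (i ∘ mm) hs hcK (hLK _ _ hw) hxc.symm
      have h2 := hs w (hLK _ _ hw)
      rw [Sym2.eq_swap (a := c) (b := x)] at h1
      have h3 : (i ∘ mm) (a s(x, c)) = 1 := by simp [i, hmx c hxc]
      rw [h3] at h1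
      rw [h1] at h2
      simp only [Function.comp, i] at h1 h2
      constructor
      · by_contra h; simp [h] at h1
      · by_contra h; simp [h] at h2
    obtain ⟨w, w', hne, hw, hw', h1, h2, h3, h4⟩ := m.two hxy hcG
    have hLw : L.Adj c w := ⟨hw, by simp [hcx, hcy], by simp [h1, h2]⟩
    have hLw' : L.Adj c w' := ⟨hw', by simp [hcx, hcy], by simp [h3, h4]⟩
    obtain ⟨z, hz, hz1, -⟩ := even_pair hLw hLw' hne (by
      refine (hcon c w w' ⟨c, hw.symm⟩ ⟨c, hw'.symm⟩ (by simp [h1, h2, hw.ne.symm])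
        (by simp [h3, h4, hw'.ne.symm])).mono ?_
      rintro u w ⟨h, h1, h2⟩
      simp only [Set.mem_compl_iff, Set.mem_insert_iff, Set.mem_singleton_iff, not_or] at h1 h2
      exact ⟨⟨h, by simp [h1], by simp [h2]⟩, by simp [h1], by simp [h2]⟩)
    obtain ⟨s, rfl⟩ := dL.sur z hz
    rw [cut_mem (by exact hLw)] at hz1
    simp only [Function.comp, hφ w hLw, z2_self] at hz1
    exact absurd hz1 (by decide)
end Disk
end P6

open SimpleGraph
namespace P6
set_option linter.unusedSectionVars false
set_option linter.unusedSimpArgs false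
section Wheel
variable {V : Type*} [Fintype V]

/-- support graph of an edge function inside `L` -/
def supG (L : SimpleGraph V) (C : Sym2 V → ZMod 2) : SimpleGraph V where
  Adj u w := L.Adj u w ∧ C s(u, w) = 1
  symm := ⟨fun u w h => ⟨h.1.symm, by rw [Sym2.eq_swap]; exact h.2⟩⟩
  loopless := ⟨fun _ h => h.1.ne rfl⟩

lemma MinCE.full {G : SimpleGraph V} (m : MinCE G) {x y : V} (hxy : G.Adj x y)
    (hcon : ∀ z u u', al G u → al G u' → u ∉ ({x, y, z} : Set V) → u' ∉ ({x, y, z} : Set V) →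
      (ind G {x, y, z}ᶜ).Reachable u u') :
    ∃ C : Sym2 V → ZMod 2, Ev (ind G {x, y}ᶜ) C ∧ (∀ e ∈ (ind G {x, y}ᶜ).edgeSet, C e = 1) ∧
    (∀ z, Ev (ind G {x, y}ᶜ) z → (∃ e, z e = 1) → ∀ e ∈ (ind G {x, y}ᶜ).edgeSet, z e = 1) := by
  classical
  obtain ⟨F1, a1, b1, φ, C, d1, hCe, hCφ, hCn⟩ := m.disk hxy hcon
  set L := ind G {x, y}ᶜ with hL
  have hLx : ∀ u w, L.Adj u w ↔ G.Adj u w ∧ u ≠ x ∧ u ≠ y ∧ w ≠ x ∧ w ≠ y := by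
    intro u w
    simp only [hL, ind, Set.mem_compl_iff, Set.mem_insert_iff, Set.mem_singleton_iff, not_or]
    tauto
  have hLal : ∀ u, al L u → al G u ∧ u ≠ x ∧ u ≠ y := by
    rintro u ⟨w, h⟩; rw [hLx] at h; exact ⟨⟨w, h.1⟩, h.2.1, h.2.2.1⟩
  have hLc : ∀ u u', al L u → al L u' → L.Reachable u u' := by
    intro u u' h h'
    obtain ⟨h1, h2, h3⟩ := hLal u h
    obtain ⟨h1', h2', h3'⟩ := hLal u' h'
    exact m.conn2 h1 h1' h2 h3 h2' h3'
  have hLc1 : ∀ p u u', al L u → al L u' → u ≠ p → u' ≠ p → (ind L {p}ᶜ).Reachable u u' := by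
    intro p u u' h h' hp hp'
    obtain ⟨h1, h2, h3⟩ := hLal u h
    obtain ⟨h1', h2', h3'⟩ := hLal u' h'
    refine (hcon p u u' h1 h1' (by simp [h2, h3, hp]) (by simp [h2', h3', hp'])).mono ?_
    rintro u w ⟨h, h1, h2⟩
    simp only [Set.mem_compl_iff, Set.mem_insert_iff, Set.mem_singleton_iff, not_or] at h1 h2
    exact ⟨(hLx _ _).2 ⟨h, by simp [h1, h2]⟩, by simp [h1], by simp [h2]⟩
  have hmin : ∀ z, Ev L z → (∀ e, z e = 1 → C e = 1) → (∃ e, z e = 1) →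
      ∀ e ∈ L.edgeSet, z e = C e := fun z hz h1 h2 =>
    face_min d1 φ hLc hLc1 (fun e _ he => hCφ e he) hz h1 h2
  have hCL : ∀ e, C e = 1 → e ∈ L.edgeSet := by
    intro e he; by_contra h; rw [hCe.1 e h] at he; exact absurd he (by decide)
  by_cases hall : ∀ e ∈ L.edgeSet, C e = 1
  · exact ⟨C, hCe, hall, fun z hz h0 e he => by
      rw [hmin z hz (fun e h => hall e (by
        by_contra h'; rw [hz.1 e h'] at h; exact absurd h (by decide))) h0 e he, hall e he]⟩
  exfalso
  push Not at hall
  obtain ⟨e0, he0, he0C⟩ := hall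
  let J := supG L C
  have hJ : ∀ u w, J.Adj u w ↔ C s(u, w) = 1 := fun u w => ⟨fun h => h.2, fun h => ⟨hCL _ h, h⟩⟩
  have hJc : ∀ v v', al J v → al J v' → J.Reachable v v' := fun v v' h h' =>
    min_conn hCe hmin hJ h h'
  let H : SimpleGraph V := J ⊔ touch G {x, y}
  have hJL : J ≤ L := fun u w h => h.1
  have hLG : L ≤ G := ind_le _ _
  have hHG : H ≤ G := sup_le (hJL.trans hLG) fun u w h => h.1
  have hHe : ∀ u w, H.Adj u w ↔ J.Adj u w ∨ (G.Adj u w ∧ (u = x ∨ u = y ∨ w = x ∨ w = y)) := by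
    intro u w
    simp only [H, touch, sup_adj, Set.mem_insert_iff, Set.mem_singleton_iff]
    tauto
  have hJx : ∀ u w, J.Adj u w → u ≠ x ∧ u ≠ y ∧ w ≠ x ∧ w ≠ y := fun u w h =>
    ((hLx u w).1 h.1).2
  have he0H : e0 ∉ H.edgeSet := by
    induction e0 using Sym2.ind with
    | _ u w =>
    intro h
    have h := (hHe u w).1 h
    have h1 := (hLx u w).1 he0
    rcases h with h | h
    · exact he0C h.2
    · tauto
  obtain ⟨F2, a2, b2, d2⟩ := m.sub hHG (edgeSet_mono hLG he0) he0H
  have hCH : Ev H C := hCe.of_supp fun e he => by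
    induction e using Sym2.ind with
    | _ u w => exact (hHe u w).2 (Or.inl ((hJ u w).2 (z2_ne _ he)))
  obtain ⟨s0, hs0⟩ := d2.sur C hCH
  -- neighbours of x, y lie on C
  have hnb : ∀ c, c ≠ x → c ≠ y → (G.Adj x c ∨ G.Adj y c) → al J c := by
    intro c h1 h2 h3
    obtain ⟨w, hw⟩ := hCn c h1 h2 h3
    exact ⟨w, (hJ _ _).2 hw⟩
  have hstar : ∀ p q, (p = x ∧ q = y ∨ p = y ∧ q = x) → ∀ c c', H.Adj p c → H.Adj p c' →
      s0 (a2 s(p, c)) = s0 (b2 s(p, c)) ∧ s0 (a2 s(p, c)) = s0 (a2 s(p, c')) := by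
    intro p q hpq
    have hpqA : G.Adj p q := by
      rcases hpq with ⟨rfl, rfl⟩ | ⟨rfl, rfl⟩
      · exact hxy
      · exact hxy.symm
    have hp : p = x ∨ p = y := by tauto
    have hq : q = x ∨ q = y := by tauto
    have hxyp : ∀ c, c ≠ p → c ≠ q → c ≠ x ∧ c ≠ y := by
      intro c h1 h2
      rcases hpq with ⟨rfl, rfl⟩ | ⟨rfl, rfl⟩ <;> exact ⟨by assumption, by assumption⟩
    have hJp : ∀ w, ¬ J.Adj p w := by
      intro w h
      have := hJx p w h
      tauto
    have hv : ∀ c, H.Adj p c → s0 (a2 s(p, c)) = s0 (b2 s(p, c)) := by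
      intro c hc
      have : C s(p, c) ≠ 1 := fun h => hJp c ((hJ p c).2 h)
      rw [hs0, cut_mem (by exact hc)] at this
      have h0 : ∀ A B : ZMod 2, A + B ≠ 1 → A = B := by decide
      exact h0 _ _ this
    obtain ⟨r, hr1, hr2, hr3⟩ := m.deg3 hpqA.symm p
    -- r is a neighbour of q
    have hrxy := hxyp r hr2 hr1.ne.symm
    have hJr : al J r := hnb r hrxy.1 hrxy.2 (by
      rcases hq with rfl | rfl
      · exact Or.inl hr1
      · exact Or.inr hr1)
    have hle : J ≤ ind H {p}ᶜ := by
      intro u w h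
      refine ⟨(hHe u w).2 (Or.inl h), ?_, ?_⟩
      · rintro rfl; exact hJp _ h
      · rintro rfl; exact hJp _ h.symm
    have hcr : ∀ c, H.Adj p c → (ind H {p}ᶜ).Reachable r c := by
      intro c hc
      have hcG := hHG hc
      by_cases hcq : c = q
      · subst hcq
        refine Adj.reachable ⟨(hHe r c).2 (Or.inr ⟨hr1.symm, by tauto⟩), by simp [hr2], by simp [hcG.ne.symm]⟩
      · have h1 := hxyp c hcG.ne.symm hcq
        refine (hJc r c hJr (hnb c h1.1 h1.2 (by
          rcases hp with rfl | rfl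
          · exact Or.inl hcG
          · exact Or.inr hcG))).mono hle
    intro c c' hc hc'
    exact ⟨hv c hc, const_at d2 s0 hv (fun c c' h h' => (hcr c h).symm.trans (hcr c' h')) hc hc'⟩
  have hHxy : H.Adj x y := (hHe x y).2 (Or.inr ⟨hxy, by simp⟩)
  obtain ⟨s, hs, hs1⟩ : ∃ s, C = cut H a2 b2 s ∧ ∀ e ∈ H.edgeSet, C e ≠ 1 →
      s (a2 e) = 0 ∧ s (b2 e) = 0 := by
    refine ⟨s0 + fun _ => s0 (a2 s(x, y)), by rw [cut_add_const]; exact hs0, ?_⟩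
    have key : ∀ p c, (p = x ∨ p = y) → H.Adj p c → s0 (a2 s(p, c)) = s0 (a2 s(x, y)) ∧
        s0 (b2 s(p, c)) = s0 (a2 s(x, y)) := by
      rintro p c (rfl | rfl) hc
      · have := hstar p y (by simp) c y hc hHxy
        exact ⟨this.2, by rw [← this.1, this.2]⟩
      · have := hstar p x (by simp) c x hc hHxy.symm
        have e : s(p, x) = s(x, p) := Sym2.eq_swap
        rw [e] at this
        exact ⟨this.2, by rw [← this.1, this.2]⟩
    intro e
    induction e using Sym2.ind with
    | _ u w =>
    intro he hC1
    have he' : H.Adj u w := he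
    have h2 : s0 (a2 s(u, w)) = s0 (a2 s(x, y)) ∧ s0 (b2 s(u, w)) = s0 (a2 s(x, y)) := by
      rcases (hHe u w).1 he' with h | h
      · exact absurd ((hJ u w).1 h) hC1
      · have : (u = x ∨ u = y) ∨ (w = x ∨ w = y) := by tauto
        rcases this with h | h
        · exact key u w h he'
        · rw [Sym2.eq_swap]; exact key w u h he'.symm
    simp only [Pi.add_apply, h2, z2_self, and_self]
  -- reorient
  let a2' : Sym2 V → F2 := fun e => if C e = 1 ∧ s (a2 e) = 1 then b2 e else a2 e
  let b2' : Sym2 V → F2 := fun e => if C e = 1 ∧ s (a2 e) = 1 then a2 e else b2 e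
  let a1' : Sym2 V → F1 := fun e => if a1 e = φ then b1 e else a1 e
  let b1' : Sym2 V → F1 := fun e => if a1 e = φ then a1 e else b1 e
  have d2' : IsDual H a2' b2' := d2.congr fun e _ => by
    simp only [a2', b2']; split_ifs <;> simp
  have d1' : IsDual L a1' b1' := d1.congr fun e _ => by
    simp only [a1', b1']; split_ifs <;> simp
  have hb1 : ∀ e, C e = 1 → b1' e = φ := by
    intro e he
    simp only [b1']
    split_ifs with h
    · exact h
    · rcases hCφ e he with h' | h'
      · exact absurd h'.1 h
      · exact h'.1
  have hCHe : ∀ e, C e = 1 → e ∈ H.edgeSet := by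
    intro e he; by_contra h; rw [hCH.1 e h] at he; exact absurd he (by decide)
  have hb2 : ∀ e, C e = 1 → s (b2' e) = 1 ∧ s (a2' e) = 0 := by
    intro e he
    have h1 := he
    rw [hs, cut_mem (hCHe e he)] at h1
    simp only [b2', a2']
    split_ifs with h
    · refine ⟨h.2, ?_⟩
      rw [h.2] at h1; revert h1; generalize s (b2 e) = A; revert A; decide
    · have : s (a2 e) = 0 := by by_contra h'; exact h ⟨he, z2_ne _ h'⟩
      rw [this] at h1 ⊢; simpa using h1
  have hcut2 : ∀ t, cut H a2' b2' t = cut H a2 b2 t := by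
    intro t; ext e
    by_cases he : e ∈ H.edgeSet
    · rw [cut_mem he, cut_mem he]; simp only [a2', b2']; split_ifs
      · ring
      · rfl
    · rw [cut_nmem he, cut_nmem he]
  refine m.nd (paste (H1 := L) (H2 := H) ?_ d1' d2' ?_ ?_)
  · ext u w
    rw [sup_adj, hHe, hLx]
    constructor
    · intro h; simp only [h, true_and]; tauto
    · rintro (h | h | h)
      · exact h.1
      · exact hLG (hJL h)
      · exact h.1
  · have h1 : ∀ v, (∃ u, L.Adj v u ∧ ¬ H.Adj v u) → (∃ u, H.Adj v u) → al J v := by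
      rintro v ⟨u, hu, -⟩ ⟨w, hw⟩
      have hv := hLal v ⟨u, hu⟩
      rcases (hHe v w).1 hw with h | h
      · exact ⟨w, h⟩
      · rcases h.2 with h' | h' | h' | h'
        · exact absurd h' hv.2.1
        · exact absurd h' hv.2.2
        · exact hnb v hv.2.1 hv.2.2 (Or.inl (h' ▸ h.1.symm))
        · exact hnb v hv.2.1 hv.2.2 (Or.inr (h' ▸ h.1.symm))
    intro v v' hv1 hv2 hv1' hv2'
    exact (hJc v v' (h1 v hv1 hv2) (h1 v' hv1' hv2')).mono (le_inf hJL le_sup_left)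
  · intro s1 s2
    -- s2 is constant on the S-side faces of C
    have hconst : ∃ γ, ∀ e, C e = 1 → s2 (b2' e) = γ := by
      let w := cut H a2' b2' (s2 * s)
      have hw1 : ∀ e, C e = 1 → w e = s2 (b2' e) := by
        intro e he
        simp only [w]
        rw [cut_mem (hCHe e he), Pi.mul_apply, Pi.mul_apply, (hb2 e he).1, (hb2 e he).2]; simp
      have hw0 : ∀ e, C e ≠ 1 → w e = 0 := by
        intro e he
        simp only [w]
        rw [hcut2]
        by_cases heH : e ∈ H.edgeSet
        · rw [cut_mem heH, Pi.mul_apply, Pi.mul_apply, (hs1 e heH he).1, (hs1 e heH he).2]; simp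
        · rw [cut_nmem heH]
      have hwL : Ev L w := (d2'.ev _).of_supp fun e he => hCL e (by
        by_contra h; exact he (hw0 e h))
      by_cases hex : ∃ e, w e = 1
      · refine ⟨1, fun e he => ?_⟩
        rw [← hw1 e he, hmin w hwL (fun e he => ?_) hex e (hCL e he), he]
        by_contra h; rw [hw0 e h] at he; exact absurd he (by decide)
      · refine ⟨0, fun e he => ?_⟩
        rw [← hw1 e he]; by_contra h; exact hex ⟨e, z2_ne _ h⟩
    obtain ⟨γ, hγ⟩ := hconst
    refine ⟨s1 + fun _ => s1 φ, s2 + fun _ => γ, cut_add_const _ _ _ _ _, cut_add_const _ _ _ _ _,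
      fun e h1 h2 => ?_⟩
    have hCe1 : C e = 1 := by
      induction e using Sym2.ind with
      | _ u w =>
      rcases (hHe u w).1 h2 with h | h
      · exact h.2
      · have := (hLx u w).1 h1; tauto
    simp only [Pi.add_apply, hb1 e hCe1, hγ e hCe1, z2_self]
end Wheel
end P6

open SimpleGraph
namespace P6
set_option linter.unusedSectionVars false
set_option linter.unusedSimpArgs false
section Minors
variable {V : Type*} [Fintype V]

lemma has_K5 {G : SimpleGraph V} (f : Fin 5 → V) (hinj : ∀ i j, i ≠ j → G.Adj (f i) (f j)) :
    HasMinor G (⊤ : SimpleGraph (Fin 5)) := by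
  classical
  have hf : Function.Injective f := fun i j h => by
    by_contra hne; exact (hinj i j hne).ne h
  let φ : V → Option (Fin 5) := fun v => if h : ∃ i, f i = v then some h.choose else none
  have hφ : ∀ i, φ (f i) = some i := by
    intro i
    have h : ∃ j, f j = f i := ⟨i, rfl⟩
    simp only [φ, dif_pos h]
    rw [hf h.choose_spec]
  have hφ' : ∀ v i, φ v = some i → v = f i := by
    intro v i h
    simp only [φ] at h
    split_ifs at h with h'
    rw [← h'.choose_spec]; simp only [Option.some.injEq] at h; rw [h]
  refine ⟨φ, fun i => ?_, fun i j h => ⟨f i, f j, hφ i, hφ j, hinj i j h⟩⟩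
  rw [induce_connected]
  refine ⟨⟨f i, hφ i⟩, fun a ha b hb => ?_⟩
  rw [hφ' a i ha, hφ' b i hb]

lemma has_K33 {G : SimpleGraph V} {x c2 y c1 c3 c4 : V} {R : Set V}
    (hR : ∀ a ∈ R, ∀ b ∈ R, (ind G R).Reachable a b) (h4 : c4 ∈ R)
    (hxR : x ∉ R) (h2R : c2 ∉ R) (hyR : y ∉ R) (h1R : c1 ∉ R) (h3R : c3 ∉ R)
    (hx2 : x ≠ c2) (h13 : c1 ≠ c3) (hy1 : y ≠ c1) (hy3 : y ≠ c3)
    (hxy : G.Adj x y) (hx1 : G.Adj x c1) (hx3 : G.Adj x c3)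
    (h2y : G.Adj c2 y) (h21 : G.Adj c2 c1) (h23 : G.Adj c2 c3)
    (hRy : ∃ r ∈ R, G.Adj r y) (hR1 : ∃ r ∈ R, G.Adj r c1) (hR3 : ∃ r ∈ R, G.Adj r c3) :
    HasMinor G (completeBipartiteGraph (Fin 3) (Fin 3)) := by
  classical
  let φ : V → Option (Fin 3 ⊕ Fin 3) := fun v =>
    if v ∈ R then some (Sum.inl 2) else if v = x then some (Sum.inl 0) else
    if v = c2 then some (Sum.inl 1) else if v = y then some (Sum.inr 0) else
    if v = c1 then some (Sum.inr 1) else if v = c3 then some (Sum.inr 2) else none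
  have fx : φ x = some (Sum.inl 0) := by simp [φ, hxR]
  have f2 : φ c2 = some (Sum.inl 1) := by simp [φ, h2R, hx2.symm]
  have fR : ∀ r ∈ R, φ r = some (Sum.inl 2) := by intro r hr; simp [φ, hr]
  have fy : φ y = some (Sum.inr 0) := by simp [φ, hyR, hxy.ne.symm, h2y.ne.symm]
  have f1 : φ c1 = some (Sum.inr 1) := by
    simp [φ, h1R, hx1.ne.symm, h21.ne.symm, hy1.symm]
  have f3 : φ c3 = some (Sum.inr 2) := by
    simp [φ, h3R, hx3.ne.symm, h23.ne.symm, hy3.symm, h13.symm]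
  have inv : ∀ v i, φ v = some i → (i = Sum.inl 2 ∧ v ∈ R) ∨ (i = Sum.inl 0 ∧ v = x) ∨
      (i = Sum.inl 1 ∧ v = c2) ∨ (i = Sum.inr 0 ∧ v = y) ∨ (i = Sum.inr 1 ∧ v = c1) ∨
      (i = Sum.inr 2 ∧ v = c3) := by
    intro v i h
    simp only [φ] at h
    split_ifs at h <;> simp only [Option.some.injEq] at h <;> subst h <;> simp_all
  obtain ⟨ry, hry, ay⟩ := hRy
  obtain ⟨r1, hr1, a1⟩ := hR1
  obtain ⟨r3, hr3, a3⟩ := hR3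
  have hone : ∀ (i : Fin 3 ⊕ Fin 3) (v0 : V), φ v0 = some i → (∀ v, φ v = some i → v = v0) →
      (G.induce {v | φ v = some i}).Connected := by
    intro i v0 h0 h
    rw [induce_connected]
    refine ⟨⟨v0, h0⟩, fun a ha b hb => ?_⟩
    rw [h a ha, h b hb]
  refine ⟨φ, fun i => ?_, ?_⟩
  · have h := inv
    rcases i with i | i <;> fin_cases i
    · refine hone _ x fx fun v hv => ?_
      have := inv v _ hv; simp at this; exact this
    · refine hone _ c2 f2 fun v hv => ?_
      have := inv v _ hv; simp at this; exact this
    · rw [induce_connected]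
      have hS : {v | φ v = some (Sum.inl ((fun i => i) ⟨2, by decide⟩))} = R := by
        ext v
        constructor
        · intro hv
          have := inv v _ hv; simp at this; exact this
        · intro hv; exact fR v hv
      rw [hS]
      exact ⟨⟨c4, h4⟩, hR⟩
    · refine hone _ y fy fun v hv => ?_
      have := inv v _ hv; simp at this; exact this
    · refine hone _ c1 f1 fun v hv => ?_
      have := inv v _ hv; simp at this; exact this
    · refine hone _ c3 f3 fun v hv => ?_
      have := inv v _ hv; simp at this; exact this
  · have key : ∀ i j : Fin 3, ∃ v1 v2, φ v1 = some (Sum.inl i) ∧ φ v2 = some (Sum.inr j) ∧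
        G.Adj v1 v2 := by
      intro i j
      fin_cases i <;> fin_cases j
      · exact ⟨x, y, fx, fy, hxy⟩
      · exact ⟨x, c1, fx, f1, hx1⟩
      · exact ⟨x, c3, fx, f3, hx3⟩
      · exact ⟨c2, y, f2, fy, h2y⟩
      · exact ⟨c2, c1, f2, f1, h21⟩
      · exact ⟨c2, c3, f2, f3, h23⟩
      · exact ⟨ry, y, fR ry hry, fy, ay⟩
      · exact ⟨r1, c1, fR r1 hr1, f1, a1⟩
      · exact ⟨r3, c3, fR r3 hr3, f3, a3⟩
    intro w1 w2 h
    rcases w1 with i | i <;> rcases w2 with j | j <;> simp [completeBipartiteGraph] at h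
    · exact key i j
    · obtain ⟨v1, v2, h1, h2, h3⟩ := key j i
      exact ⟨v2, v1, h2, h1, h3.symm⟩

/-- final step: the wheel-like graph contains a Kuratowski minor -/
lemma wheel_minor {G L : SimpleGraph V} (m : MinCE G) {x y : V} (hxy : G.Adj x y)
    (hLx : ∀ u w, L.Adj u w ↔ G.Adj u w ∧ u ≠ x ∧ u ≠ y ∧ w ≠ x ∧ w ≠ y)
    (h2 : ∀ u, al L u → ∃ c c', c ≠ c' ∧ L.Adj u c ∧ L.Adj u c' ∧ ∀ w, L.Adj u w → w = c ∨ w = c')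
    (hLc1 : ∀ p u u', al L u → al L u' → u ≠ p → u' ≠ p → (ind L {p}ᶜ).Reachable u u')
    {c2 : V} (hc2 : al L c2) (hc2y : G.Adj c2 y) : False := by
  have hnb : ∀ c, al L c → G.Adj c x ∨ G.Adj c y := by
    rintro c ⟨w, hw⟩
    by_contra hno
    push Not at hno
    obtain ⟨p, q, hpq, hp, hq, hall⟩ := h2 c ⟨w, hw⟩
    obtain ⟨r, hr, hr1, hr2⟩ := m.deg3 (hLx c p |>.1 hp).1 q
    have hc := (hLx c p).1 hp
    rcases hall r ((hLx c r).2 ⟨hr, hc.2.1, hc.2.2.1, fun h => hno.1 (h ▸ hr),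
      fun h => hno.2 (h ▸ hr)⟩) with h | h
    · exact hr1 h
    · exact hr2 h
  have star : ∀ (p q : V), (p = x ∧ q = y ∨ p = y ∧ q = x) → ∀ c c', L.Adj c c' → G.Adj c p →
      G.Adj c' p → G.Adj c q := by
    intro p q hpq c c' hcc hc hc'
    by_contra hno
    obtain ⟨s, t, hst, hs, ht, hall⟩ := h2 c ⟨c', hcc⟩
    obtain ⟨r, hr⟩ : ∃ r, ∀ w, L.Adj c w → w = c' ∨ w = r := by
      rcases hall c' hcc with h | h
      · exact ⟨t, fun w hw => by rw [h]; exact hall w hw⟩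
      · exact ⟨s, fun w hw => by rw [h]; exact (hall w hw).symm⟩
    have hL := (hLx c c').1 hcc
    refine m.no_tri (u := c) (p := p) (q := c') (r := r) hc hL.1 hc'.symm fun w hw => ?_
    by_cases hwp : w = p
    · exact Or.inl hwp
    · have hwq : w ≠ q := fun h => hno (h ▸ hw)
      have hwx : w ≠ x ∧ w ≠ y := by rcases hpq with ⟨rfl, rfl⟩ | ⟨rfl, rfl⟩ <;> tauto
      exact Or.inr (hr w ((hLx c w).2 ⟨hw, hL.2.1, hL.2.2.1, hwx⟩))
  have flip : ∀ (p q : V), (p = x ∧ q = y ∨ p = y ∧ q = x) → ∀ c c', L.Adj c c' → G.Adj c p →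
      G.Adj c' q := by
    intro p q hpq c c' hcc hc
    by_cases h : G.Adj c' q
    · exact h
    · have := hnb c' ⟨c, hcc.symm⟩
      have hc' : G.Adj c' p := by rcases hpq with ⟨rfl, rfl⟩ | ⟨rfl, rfl⟩ <;> tauto
      exact star p q hpq c' c hcc.symm hc' hc
  obtain ⟨c1, c3, h13, h21, h23, -⟩ := h2 c2 hc2
  have e2 := (hLx c2 c1).1 h21
  have e3 := (hLx c2 c3).1 h23
  have h1x := flip y x (by simp) c2 c1 h21 hc2y
  have h3x := flip y x (by simp) c2 c3 h23 hc2y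
  by_cases hadj : L.Adj c1 c3
  · have h1y := star x y (by simp) c1 c3 hadj h1x h3x
    have h3y := star x y (by simp) c3 c1 hadj.symm h3x h1x
    have h2x := star y x (by simp) c2 c1 h21 hc2y h1y
    have e13 := (hLx c1 c3).1 hadj
    refine m.pl.1 (has_K5 ![x, y, c1, c2, c3] ?_)
    intro i j hij
    fin_cases i <;> fin_cases j <;> simp at hij <;>
      simp [hxy, hxy.symm, h1x, h1x.symm, h1y, h1y.symm, h2x, h2x.symm, hc2y, hc2y.symm, h3x,
        h3x.symm, h3y, h3y.symm, e13.1, e13.1.symm, e2.1, e2.1.symm, e3.1, e3.1.symm]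
  · have other : ∀ c, L.Adj c2 c → ∃ c', L.Adj c c' ∧ c' ≠ c2 ∧ ∀ w, L.Adj c w → w = c2 ∨ w = c' := by
      intro c hc
      obtain ⟨s, t, hst, hs, ht, hall⟩ := h2 c ⟨c2, hc.symm⟩
      rcases hall c2 hc.symm with h | h
      · exact ⟨t, ht, fun hh => hst (by rw [hh, h]), fun w hw => by rw [h]; exact hall w hw⟩
      · exact ⟨s, hs, fun hh => hst (by rw [hh, h]), fun w hw => by rw [h]; exact (hall w hw).symm⟩
    obtain ⟨c4, h34, h42, hall3⟩ := other c3 h23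
    obtain ⟨c0, h10, h02, hall1⟩ := other c1 h21
    have h4y := flip x y (by simp) c3 c4 h34 h3x
    have e34 := (hLx c3 c4).1 h34
    have e10 := (hLx c1 c0).1 h10
    have h41 : c4 ≠ c1 := fun h => hadj (h ▸ h34.symm)
    have h03 : c0 ≠ c3 := fun h => hadj (h ▸ h10)
    have h4X : c4 ∉ ({c1, c2, c3} : Set V) := by simp [h41, h42, h34.ne.symm]
    set R := rs L {c1, c2, c3} c4 with hRdef
    have hRX : ∀ r ∈ R, r ∉ ({c1, c2, c3} : Set V) := fun r hr => rs_notMem h4X hr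
    have h4R : c4 ∈ R := Reachable.refl _
    have hRal : ∀ r ∈ R, r ≠ x ∧ r ≠ y := by
      intro r hr
      refine reach_closed (S := {r | r ≠ x ∧ r ≠ y}) ?_ hr ?_
      · intro a b _ h
        exact ((hLx a b).1 h.1).2.2.2
      · exact e34.2.2.2
    have h0R : c0 ∈ R := by
      by_contra hno
      have := hLc1 c2 c4 c0 ⟨c3, h34.symm⟩ ⟨c1, h10.symm⟩ h42 h02
      have := reach_closed (S := R ∪ {c3}) ?_ this (Or.inl h4R)
      · rcases this with h | h
        · exact hno h
        · exact h03 h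
      · rintro a b (ha | ha) hab
        · by_cases hb3 : b = c3
          · exact Or.inr hb3
          · have hb2 : b ≠ c2 := hab.2.2
            have hb1 : b ≠ c1 := by
              rintro rfl
              rcases hall1 a hab.1.symm with h | h
              · exact hab.2.1 h
              · exact hno (h ▸ ha)
            exact Or.inl (rs_step ha (hRX a ha) hab.1 (by simp [hb1, hb2, hb3]))
        · have ha : a = c3 := ha
          subst ha
          rcases hall3 b hab.1 with h | h
          · exact absurd h hab.2.2
          · exact Or.inl (h ▸ h4R)
    have hRR : ∀ a ∈ R, (ind G R).Reachable c4 a := by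
      intro a ha
      have hgo : ∀ u v : V, (ind L {c1, c2, c3}ᶜ).Walk u v → u ∈ R → (ind G R).Reachable u v := by
        intro u v w
        induction w with
        | nil => intro _; exact Reachable.refl _
        | @cons u v w h p ih =>
          intro hu
          have hv : v ∈ R := rs_step hu h.2.1 h.1 h.2.2
          exact Reachable.trans (Adj.reachable ⟨((hLx u v).1 h.1).1, hu, hv⟩) (ih hv)
      obtain ⟨w⟩ := ha
      exact hgo _ _ w h4R
    refine m.pl.2 (has_K33 (x := x) (c2 := c2) (y := y) (c1 := c1) (c3 := c3) (c4 := c4) (R := R)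
      (fun a ha b hb => (hRR a ha).symm.trans (hRR b hb)) h4R (fun h => (hRal x h).1 rfl)
      (fun h => hRX _ h (by simp)) (fun h => (hRal y h).2 rfl) (fun h => hRX _ h (by simp))
      (fun h => hRX _ h (by simp)) e2.2.1.symm h13 e2.2.2.2.2.symm e3.2.2.2.2.symm hxy h1x.symm h3x.symm hc2y e2.1 e3.1
      ⟨c4, h4R, h4y⟩ ⟨c0, h0R, e10.1.symm⟩ ⟨c4, h4R, e34.1.symm⟩)

theorem hasDual_of_planar (G : SimpleGraph V) (hG : IsPlanar G) : HasDual G := by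
  classical
  induction hn : G.edgeSet.ncard using Nat.strong_induction_on generalizing G with
  | _ n ih =>
  subst hn
  by_contra hnd
  have m : MinCE G := ⟨hG, hnd, fun H hH hlt => ih _ hlt H hH rfl⟩
  obtain ⟨x, y, hxy, hcon⟩ := m.contractible
  obtain ⟨C, hC, hC1, hCm⟩ := m.full hxy hcon
  set L := ind G {x, y}ᶜ with hL
  have hLx : ∀ u w, L.Adj u w ↔ G.Adj u w ∧ u ≠ x ∧ u ≠ y ∧ w ≠ x ∧ w ≠ y := by
    intro u w
    simp only [hL, ind, Set.mem_compl_iff, Set.mem_insert_iff, Set.mem_singleton_iff, not_or]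
    tauto
  have hLc1 : ∀ p u u', al L u → al L u' → u ≠ p → u' ≠ p → (ind L {p}ᶜ).Reachable u u' := by
    rintro p u u' ⟨w, h⟩ ⟨w', h'⟩ hp hp'
    rw [hLx] at h h'
    refine (hcon p u u' ⟨w, h.1⟩ ⟨w', h'.1⟩ (by simp [h, hp]) (by simp [h', hp'])).mono ?_
    rintro u w ⟨h, h1, h2⟩
    simp only [Set.mem_compl_iff, Set.mem_insert_iff, Set.mem_singleton_iff, not_or] at h1 h2
    exact ⟨(hLx _ _).2 ⟨h, by simp [h1, h2]⟩, by simp [h1], by simp [h2]⟩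
  have h2 : ∀ u, al L u → ∃ c c', c ≠ c' ∧ L.Adj u c ∧ L.Adj u c' ∧
      ∀ w, L.Adj u w → w = c ∨ w = c' := by
    rintro u ⟨w, h⟩
    rw [hLx] at h
    obtain ⟨c, c', hne, hc, hc', h1, h2, h3, h4⟩ := m.two hxy (c := u) ⟨w, h.1⟩
    have hLc : L.Adj u c := (hLx u c).2 ⟨hc, h.2.1, h.2.2.1, h1, h2⟩
    have hLc' : L.Adj u c' := (hLx u c').2 ⟨hc', h.2.1, h.2.2.1, h3, h4⟩
    obtain ⟨z, hz, hz1, -, hz3⟩ := even_pair hLc hLc' hne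
      (hLc1 u c c' ⟨u, hLc.symm⟩ ⟨u, hLc'.symm⟩ hLc.ne.symm hLc'.ne.symm)
    refine ⟨c, c', hne, hLc, hLc', fun w hw => ?_⟩
    by_contra hno
    push Not at hno
    have h5 := hCm z hz ⟨_, hz1⟩ s(u, w) hw
    rw [hz3 w hno.1 hno.2] at h5
    exact absurd h5 (by decide)
  obtain ⟨c, hc, hcx, -⟩ := m.deg3 hxy.symm x
  obtain ⟨w, w', -, hw, -, h1, h2', -⟩ := m.two hxy (c := c) ⟨y, hc.symm⟩
  exact wheel_minor m hxy hLx h2 hLc1 (c2 := c)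
    ⟨w, (hLx c w).2 ⟨hw, hcx, hc.ne.symm, h1, h2'⟩⟩ hc.symm
end Minors
end P6

open SimpleGraph
namespace P6
set_option linter.unusedSectionVars false
set_option linter.unusedSimpArgs false
section Count
variable {V : Type*} [Fintype V]

open Classical in
lemma even_big {G H : SimpleGraph V} (hle : H ≤ G) (hg : 7 ≤ G.egirth) {z : Sym2 V → ZMod 2}
    (hz : Ev H z) (h0 : ∃ e, z e ≠ 0) : 7 ≤ (Finset.univ.filter fun e => z e ≠ 0).card := by
  obtain ⟨e, he⟩ := h0
  induction e using Sym2.ind with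
  | _ u v =>
  have hzH : ∀ a b, z s(a, b) ≠ 0 → H.Adj a b := by
    intro a b h; by_contra h'; exact h (hz.1 _ h')
  set J := supG H z with hJdef
  have hJ : ∀ a b, J.Adj a b ↔ z s(a, b) ≠ 0 := fun a b =>
    ⟨fun h => by rw [h.2]; decide, fun h => ⟨hzH a b h, z2_ne _ h⟩⟩
  have huv : J.Adj u v := (hJ u v).2 he
  have hreach : (J \ fromEdgeSet {s(u, v)}).Reachable u v := by
    by_contra hno
    set D := J \ fromEdgeSet {s(u, v)} with hD
    have hDa : ∀ a b, D.Adj a b ↔ J.Adj a b ∧ s(a, b) ≠ s(u, v) := by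
      intro a b
      simp only [hD, sdiff_adj, fromEdgeSet_adj, Set.mem_singleton_iff, not_and, not_not]
      constructor
      · rintro ⟨h1, h2⟩; exact ⟨h1, fun h => h1.ne (h2 h)⟩
      · rintro ⟨h1, h2⟩; exact ⟨h1, fun h => absurd h h2⟩
    let z' : Sym2 V → ZMod 2 := fun e => if ∀ w ∈ e, D.Reachable u w then z e else 0
    have hz' : ∀ a b, z' s(a, b) = if D.Reachable u a ∧ D.Reachable u b then z s(a, b) else 0 := by
      intro a b; simp only [z', Sym2.mem_iff, forall_eq_or_imp, forall_eq]
    have h1 := sum_bd z' (fun w => by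
      rw [hz']; split_ifs
      · by_contra h; exact (hzH w w h).ne rfl
      · rfl)
    have h2 : ∀ w, bd z' w = if w = u then 1 else 0 := by
      intro w
      by_cases hw : D.Reachable u w
      · by_cases hwu : w = u
        · subst hwu
          have : bd z' w = bd (z + ie s(w, v)) w := bd_congr fun c => by
            rw [hz', Pi.add_apply]
            by_cases hcv : c = v
            · subst hcv
              rw [ie_self, if_neg (fun h => hno h.2), z2_ne _ he]; exact (z2_self 1).symm
            · have hne : s(w, c) ≠ s(w, v) := by simp [hcv, huv.ne]
              rw [ie_ne hne, add_zero]
              split_ifs with h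
              · rfl
              · by_contra hh
                exact h ⟨hw, Adj.reachable ((hDa w c).2 ⟨(hJ w c).2 (Ne.symm hh), hne⟩)⟩
          rw [this, bd_add, hz.2, bd_ie huv.ne]; simp [huv.ne]
        · rw [if_neg hwu, ← hz.2 w]
          refine bd_congr fun c => ?_
          rw [hz']
          split_ifs with h
          · rfl
          · by_contra hh
            have hh : z s(w, c) ≠ 0 := Ne.symm hh
            have hwv : w ≠ v := fun h => hno (h ▸ hw)
            exact h ⟨hw, hw.trans (Adj.reachable ((hDa w c).2 ⟨(hJ w c).2 hh, by simp [hwu, hwv]⟩))⟩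
      · have hwu : w ≠ u := by rintro rfl; exact hw (Reachable.refl _)
        rw [if_neg hwu, ← bd_zero w]
        refine bd_congr fun c => ?_
        rw [hz', if_neg (fun h => hw h.1)]; rfl
    simp only [h2, Finset.sum_ite_eq', Finset.mem_univ, if_true] at h1
    exact absurd h1 (by decide)
  obtain ⟨w, p, hp, -⟩ := adj_and_reachable_delete_edges_iff_exists_cycle.1 ⟨huv, hreach⟩
  have hJG : J ≤ G := fun a b h => hle h.1
  have h7 : (7 : ℕ∞) ≤ p.length := by
    have := hp.mapLe hJG
    have h := le_trans hg (le_egirth.1 le_rfl w _ this)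
    simpa using h
  have h7 : 7 ≤ p.length := by exact_mod_cast h7
  rw [← p.length_edges, ← List.toFinset_card_of_nodup hp.isTrail.edges_nodup] at h7
  refine h7.trans (Finset.card_le_card fun e he => ?_)
  rw [List.mem_toFinset] at he
  have := p.edges_subset_edgeSet he
  simp only [Finset.mem_filter, Finset.mem_univ, true_and]
  induction e using Sym2.ind with
  | _ a b => exact (hJ a b).1 this

open Classical in
theorem sparse {G : SimpleGraph V} (hG : IsPlanar G) (hg : 7 ≤ G.egirth) (T : Set V)
    (hT : T.Nonempty) : 5 * (ind G T).edgeSet.ncard < 7 * T.ncard := by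
  set H := ind G T with hH
  obtain ⟨F, a, b, d⟩ := hasDual_of_planar H (planar_mono (ind_le _ _) hG)
  let E := H.edgeSet
  let ex : (E → ZMod 2) → Sym2 V → ZMod 2 := fun z e => if h : e ∈ H.edgeSet then z ⟨e, h⟩ else 0
  have ex_add : ∀ z w, ex (z + w) = ex z + ex w := by
    intro z w; ext e; simp only [ex, Pi.add_apply]; split_ifs <;> simp
  have ex_smul : ∀ (c : ZMod 2) z, ex (c • z) = c • ex z := by
    intro c z; ext e; simp only [ex, Pi.smul_apply]; split_ifs <;> simp
  let B : (E → ZMod 2) →ₗ[ZMod 2] (T → ZMod 2) :=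
    { toFun := fun z v => bd (ex z) v.1
      map_add' := fun z w => by ext v; simp only [ex_add, bd_add, Pi.add_apply]
      map_smul' := fun c z => by
        ext v; simp only [ex_smul, bd, Pi.smul_apply, RingHom.id_apply, Finset.smul_sum] }
  have hHT : ∀ u w, H.Adj u w → u ∈ T := fun u w h => h.2.1
  have ex_off : ∀ z v, v ∉ T → bd (ex z) v = 0 := by
    intro z v hv
    rw [← bd_zero v]
    refine bd_congr fun c => ?_
    simp only [ex]
    rw [dif_neg]; · rfl
    intro h; exact hv (hHT v c h)
  have hrange : Module.finrank (ZMod 2) (LinearMap.range B) < T.ncard := by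
    have hlt : LinearMap.range B < ⊤ := by
      rw [lt_top_iff_ne_top]
      intro htop
      obtain ⟨v0, hv0⟩ := hT
      have : (Pi.single ⟨v0, hv0⟩ 1 : T → ZMod 2) ∈ LinearMap.range B := by rw [htop]; trivial
      obtain ⟨z, hz⟩ := this
      have h1 := sum_bd (ex z) (fun w => by
        simp only [ex]; rw [dif_neg]; intro h; exact H.loopless.irrefl w h)
      have h2 : ∀ v, bd (ex z) v = if v = v0 then 1 else 0 := by
        intro v
        by_cases hv : v ∈ T
        · have : bd (ex z) v = B z ⟨v, hv⟩ := rfl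
          rw [this, hz]; simp [Pi.single_apply]
        · rw [ex_off z v hv, if_neg]; rintro rfl; exact hv hv0
      simp only [h2, Finset.sum_ite_eq', Finset.mem_univ, if_true] at h1
      exact absurd h1 (by decide)
    have := Submodule.finrank_lt hlt.ne
    rw [Module.finrank_fintype_fun_eq_card] at this
    rwa [← Nat.card_eq_fintype_card, Nat.card_coe_set_eq] at this
  have hrn := LinearMap.finrank_range_add_finrank_ker B
  have hm : Module.finrank (ZMod 2) (E → ZMod 2) = H.edgeSet.ncard := by
    rw [Module.finrank_fintype_fun_eq_card, ← Nat.card_eq_fintype_card, Nat.card_coe_set_eq]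
  rw [hm] at hrn
  -- faces
  let k : F → E → ZMod 2 := fun φ e => (if a e.1 = φ then 1 else 0) + (if b e.1 = φ then 1 else 0)
  let F1 : Finset F := (Finset.univ.image fun e : E => a e.1) ∪ (Finset.univ.image fun e : E => b e.1)
  let F0 := F1.filter fun φ => k φ ≠ 0
  have hspan : ∀ z, B z = 0 → ∀ φ0, ∃ s : F → ZMod 2, s φ0 = 0 ∧ z = ∑ φ ∈ F0, s φ • k φ := by
    intro z hz φ0
    have hev : Ev H (ex z) := by
      refine ⟨fun e he => dif_neg he, fun v => ?_⟩
      by_cases hv : v ∈ T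
      · exact congrFun hz ⟨v, hv⟩
      · exact ex_off z v hv
    obtain ⟨s0, hs0⟩ := d.sur _ hev
    refine ⟨s0 + fun _ => s0 φ0, z2_self _, ?_⟩
    rw [← cut_add_const H a b s0 (s0 φ0)] at hs0
    generalize s0 + (fun _ => s0 φ0) = s at hs0
    have h1 : ∑ φ ∈ F0, s φ • k φ = ∑ φ ∈ F1, s φ • k φ := by
      refine Finset.sum_filter_of_ne fun φ _ h h' => h ?_
      rw [h', smul_zero]
    rw [h1]
    ext e
    have h2 : z e = ex z e.1 := by simp only [ex]; rw [dif_pos e.2]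
    rw [h2, hs0, cut_mem e.2, Finset.sum_apply]
    simp only [Pi.smul_apply, smul_eq_mul, k, mul_add, mul_ite, mul_one, mul_zero,
      Finset.sum_add_distrib, Finset.sum_ite_eq]
    rw [if_pos, if_pos]
    · exact Finset.mem_union_right _ (Finset.mem_image_of_mem _ (Finset.mem_univ e))
    · exact Finset.mem_union_left _ (Finset.mem_image_of_mem _ (Finset.mem_univ e))
  have hbig : ∀ φ ∈ F0, 7 ≤ (Finset.univ.filter fun e : E => k φ e ≠ 0).card := by
    intro φ hφ
    have hφ0 : k φ ≠ 0 := (Finset.mem_filter.1 hφ).2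
    have hcut : ∀ e : E, cut H a b (fun f => if f = φ then 1 else 0) e.1 = k φ e := by
      intro e; rw [cut_mem e.2]
    obtain ⟨e, he⟩ := Function.ne_iff.1 hφ0
    have := even_big (ind_le G T) hg (d.ev (fun f => if f = φ then 1 else 0)) ⟨e.1, by rw [hcut]; exact he⟩
    refine this.trans ?_
    rw [← Finset.card_map (Function.Embedding.subtype _)]
    refine Finset.card_le_card fun f hf => ?_
    simp only [Finset.mem_filter, Finset.mem_univ, true_and] at hf
    have hfH : f ∈ H.edgeSet := by by_contra h; exact hf (cut_nmem h)
    rw [Finset.mem_map]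
    refine ⟨⟨f, hfH⟩, ?_, rfl⟩
    simp only [Finset.mem_filter, Finset.mem_univ, true_and]
    rw [← hcut ⟨f, hfH⟩]; exact hf
  have hsum : 7 * F0.card ≤ 2 * H.edgeSet.ncard := by
    calc 7 * F0.card = ∑ φ ∈ F0, 7 := by rw [Finset.sum_const, smul_eq_mul, mul_comm]
      _ ≤ ∑ φ ∈ F0, (Finset.univ.filter fun e : E => k φ e ≠ 0).card := Finset.sum_le_sum hbig
      _ = ∑ e : E, (F0.filter fun φ => k φ e ≠ 0).card := by
        simp only [Finset.card_filter]; rw [Finset.sum_comm]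
      _ ≤ ∑ e : E, 2 := by
        refine Finset.sum_le_sum fun e _ => ?_
        refine (Finset.card_le_card (t := {a e.1, b e.1}) fun φ hφ => ?_).trans Finset.card_le_two
        have := (Finset.mem_filter.1 hφ).2
        simp only [k] at this
        simp only [Finset.mem_insert, Finset.mem_singleton]
        by_contra hno
        push Not at hno
        rw [if_neg hno.1.symm, if_neg hno.2.symm] at this
        exact this (add_zero 0)
      _ = 2 * H.edgeSet.ncard := by
        rw [Finset.sum_const, smul_eq_mul, mul_comm, Finset.card_univ, ← Nat.card_eq_fintype_card,
          Nat.card_coe_set_eq]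
  rcases F0.eq_empty_or_nonempty with hF | ⟨φ0, hφ0⟩
  · have hker : LinearMap.ker B = ⊥ := by
      rw [LinearMap.ker_eq_bot']
      intro z hz
      by_cases hne : Nonempty E
      · obtain ⟨e⟩ := hne
        obtain ⟨s, -, h⟩ := hspan z hz (a e.1)
        rw [h, hF, Finset.sum_empty]
      · ext e; exact absurd ⟨e⟩ hne
    rw [hker, finrank_bot] at hrn
    omega
  · have hker : Module.finrank (ZMod 2) (LinearMap.ker B) ≤ (F0.erase φ0).card := by
      have hle : LinearMap.ker B ≤ Submodule.span (ZMod 2) (((F0.erase φ0).image k : Finset _) : Set (E → ZMod 2)) := by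
        intro z hz
        obtain ⟨s, hs, h⟩ := hspan z hz φ0
        rw [h, ← Finset.add_sum_erase _ _ hφ0, hs, zero_smul, zero_add]
        refine Submodule.sum_mem _ fun φ hφ => Submodule.smul_mem _ _ (Submodule.subset_span ?_)
        exact Finset.mem_coe.2 (Finset.mem_image_of_mem _ hφ)
      exact (Submodule.finrank_mono hle).trans ((finrank_span_finset_le_card _).trans Finset.card_image_le)
    rw [Finset.card_erase_of_mem hφ0] at hker
    have := Finset.card_pos.2 ⟨φ0, hφ0⟩
    omega
end Count
end P6

open SimpleGraph
namespace P6
set_option linter.unusedSectionVars false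
set_option linter.unusedSimpArgs false

/-- colours: (class, switching, side) -/
abbrev Col := Fin 3 × Bool × Bool
abbrev Pr := Fin 3 × Bool

def comp (g : Bool) (c d : Col) : Bool :=
  if c.1 = d.1 then (c.2.2 != d.2.2) && (d.2.1 == !(xor c.2.1 g)) else d.2.1 == xor c.2.1 g

def pr (c : Col) : Pr := (c.1, c.2.1)

lemma comp_symm : ∀ g c d, comp g c d = comp g d c := by decide +kernel

lemma fact1 : ∀ (g1 g2 : Bool) (c : Col), ∃ τ : Pr, ∀ d, pr d ≠ τ →
    ∃ e, comp g1 c e = true ∧ comp g2 e d = true := by decide +kernel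

lemma fact2 : ∀ (τ1 τ2 τ3 : Pr) (g : Bool), ∃ τ : Pr, ∀ d, pr d ≠ τ →
    ∃ c, (pr c ≠ τ1 ∧ pr c ≠ τ2 ∧ pr c ≠ τ3) ∧ comp g c d = true := by decide +kernel

lemma fact3 : ∀ (τ : Pr) (c : Col) (g g' : Bool), ∃ σ1 σ2 : Pr, ∀ d, pr d ≠ σ1 → pr d ≠ σ2 →
    ∃ e, (pr e ≠ τ ∧ comp g c e = true) ∧ comp g' e d = true := by decide +kernel

abbrev Inter2 (g1 g g2 : Bool) (z c : Col) : Prop := ∃ σ1 σ2 : Pr, ∀ d, pr d ≠ σ1 → pr d ≠ σ2 →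
      ∃ e, (comp g1 z e = true ∧ comp g c e = true) ∧ comp g2 e d = true

def inter2 (g1 g g2 : Bool) (z c : Col) : Bool := decide (Inter2 g1 g g2 z c)

lemma fact4a : ∀ (τ1 τ2 : Pr) (c : Col) (g g1 : Bool), ∃ z, (pr z ≠ τ1 ∧ pr z ≠ τ2) ∧
    ∀ g2, inter2 g1 g g2 z c = true := by decide +kernel

lemma fact4 (τ1 τ2 : Pr) (c : Col) (g g1 : Bool) : ∃ z, (pr z ≠ τ1 ∧ pr z ≠ τ2) ∧
    ∀ g2, Inter2 g1 g g2 z c := by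
  obtain ⟨z, hz, h⟩ := fact4a τ1 τ2 c g g1
  exact ⟨z, hz, fun g2 => of_decide_eq_true (h g2)⟩

abbrev Arm1 (g g' : Bool) (τ : Pr) (y : Col) : Prop :=
  ∃ τ' : Pr, ∀ d, pr d ≠ τ' → ∃ e, (comp g y e = true ∧ pr e ≠ τ) ∧ comp g' e d = true

def arm1 (g g' : Bool) (τ : Pr) (y : Col) : Bool := decide (Arm1 g g' τ y)

lemma fact5a : ∀ (c : Col) (g0 g : Bool) (τ : Pr), ∃ y, comp g0 c y = true ∧
    ∀ g', arm1 g g' τ y = true := by decide +kernel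

lemma fact5 (c : Col) (g0 g : Bool) (τ : Pr) : ∃ y, comp g0 c y = true ∧
    ∀ g', Arm1 g g' τ y := by
  obtain ⟨y, hy, h⟩ := fact5a c g0 g τ
  exact ⟨y, hy, fun g2 => of_decide_eq_true (h g2)⟩

lemma fact6a : ∀ (τ0 : Pr) (g : Bool) (τ : Pr), ∃ y, pr y ≠ τ0 ∧
    ∀ g', arm1 g g' τ y = true := by decide +kernel

lemma fact6 (τ0 : Pr) (g : Bool) (τ : Pr) : ∃ y, pr y ≠ τ0 ∧
    ∀ g', Arm1 g g' τ y := by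
  obtain ⟨y, hy, h⟩ := fact6a τ0 g τ
  exact ⟨y, hy, fun g2 => of_decide_eq_true (h g2)⟩

lemma fact7 : ∀ (c : Col) (g g' : Bool) (τ : Pr), ∃ σ1 σ2 : Pr, ∀ d, pr d ≠ σ1 → pr d ≠ σ2 →
    ∃ e, (comp g c e = true ∧ pr e ≠ τ) ∧ comp g' e d = true := by decide +kernel

lemma fact8 : ∀ (c : Col) (g : Bool) (τ τ' : Pr), ∃ d, comp g c d = true ∧ pr d ≠ τ ∧ pr d ≠ τ' := by
  decide +kernel

lemma fact9 (τ1 τ2 τ3 τ4 τ5 : Pr) : ∃ d : Col, pr d ≠ τ1 ∧ pr d ≠ τ2 ∧ pr d ≠ τ3 ∧ pr d ≠ τ4 ∧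
    pr d ≠ τ5 := by
  obtain ⟨τ, hτ⟩ : ∃ τ : Pr, τ ∉ ({τ1, τ2, τ3, τ4, τ5} : Finset Pr) := by
    by_contra h
    push Not at h
    have h1 : (Finset.univ : Finset Pr).card ≤ ({τ1, τ2, τ3, τ4, τ5} : Finset Pr).card :=
      Finset.card_le_card fun τ _ => h τ
    have h2 : ({τ1, τ2, τ3, τ4, τ5} : Finset Pr).card ≤ 5 := Finset.card_le_five
    have h3 : (Finset.univ : Finset Pr).card = 6 := by decide
    omega
  refine ⟨(τ.1, τ.2, false), ?_⟩
  simp only [Finset.mem_insert, Finset.mem_singleton, not_or] at hτ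
  exact hτ
end P6

open SimpleGraph
namespace P6
set_option linter.unusedSectionVars false
set_option linter.unusedSimpArgs false

/-- colours compatible with some colour in `X` along an edge of sign `g` -/
def NN (g : Bool) (X : Set Col) : Set Col := {d | ∃ c ∈ X, comp g c d = true}
/-- colours avoiding the pair `τ` -/
def av (τ : Pr) : Set Col := {d | pr d ≠ τ}
def Miss1 (X : Set Col) : Prop := ∃ τ, ∀ d, pr d ≠ τ → d ∈ X
def Miss2 (X : Set Col) : Prop := ∃ σ1 σ2, ∀ d, pr d ≠ σ1 → pr d ≠ σ2 → d ∈ X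
def CW (X : Set Col) : Prop := ∀ g, Miss1 (NN g X)
def CU (X : Set Col) : Prop := ∀ g, Miss2 (NN g X)
def Q1 (X : Set Col) : Prop := ∀ c g g1, ∃ z ∈ X, ∀ g2, Miss2 (NN g2 (NN g1 {z} ∩ NN g {c}))
def OU (X : Set Col) : Prop :=
  (∀ g τ, ∃ y ∈ X, CW (NN g {y} ∩ av τ)) ∧ ∀ g, Q1 (NN g X)

lemma mem_NN1 {g c d} : d ∈ NN g {c} ↔ comp g c d = true := by simp [NN]

lemma Miss1.m2 {X} (h : Miss1 X) : Miss2 X := by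
  obtain ⟨τ, h⟩ := h
  exact ⟨τ, τ, fun d h1 _ => h d h1⟩

lemma Miss1.cw {X} (h : Miss1 X) : CW X := by
  obtain ⟨τ, h⟩ := h
  intro g
  obtain ⟨τ', h'⟩ := fact2 τ τ τ g
  refine ⟨τ', fun d hd => ?_⟩
  obtain ⟨c, hc, hcd⟩ := h' d hd
  exact ⟨c, h c hc.1, hcd⟩

lemma Miss2.q1 {X} (h : Miss2 X) : Q1 X := by
  obtain ⟨τ1, τ2, h⟩ := h
  intro c g g1
  obtain ⟨z, hz, h'⟩ := fact4 τ1 τ2 c g g1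
  refine ⟨z, h z hz.1 hz.2, fun g2 => ?_⟩
  obtain ⟨σ1, σ2, h2⟩ := h' g2
  refine ⟨σ1, σ2, fun d h3 h4 => ?_⟩
  obtain ⟨e, he, hed⟩ := h2 d h3 h4
  exact ⟨e, ⟨mem_NN1.2 he.1, mem_NN1.2 he.2⟩, hed⟩

lemma CU.q1 {X} (h : CU X) (g) : Q1 (NN g X) := (h g).q1

lemma cw_of_arm {g y τ} (h : ∀ g', Arm1 g g' τ y) : CW (NN g {y} ∩ av τ) := by
  intro g'
  obtain ⟨τ', h'⟩ := h g'
  refine ⟨τ', fun d hd => ?_⟩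
  obtain ⟨e, he, hed⟩ := h' d hd
  exact ⟨e, ⟨mem_NN1.2 he.1, he.2⟩, hed⟩

lemma Miss1.ou {X} (h : Miss1 X) : OU X := by
  refine ⟨fun g τ => ?_, fun g => (h.cw g).m2.q1⟩
  obtain ⟨τ0, h⟩ := h
  obtain ⟨y, hy, h'⟩ := fact6 τ0 g τ
  exact ⟨y, h y hy, cw_of_arm h'⟩

lemma ou_univ : OU Set.univ := Miss1.ou ⟨(0, false), fun _ _ => trivial⟩
lemma ou_av (τ) : OU (av τ) := Miss1.ou ⟨τ, fun _ h => h⟩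

lemma ou_N (g z) : OU (NN g {z}) := by
  refine ⟨fun g' τ => ?_, fun g' => ?_⟩
  · obtain ⟨y, hy, h'⟩ := fact5 z g g' τ
    exact ⟨y, mem_NN1.2 hy, cw_of_arm h'⟩
  · apply Miss2.q1
    apply Miss1.m2
    obtain ⟨τ, h⟩ := fact1 g g' z
    refine ⟨τ, fun d hd => ?_⟩
    obtain ⟨e, he, hed⟩ := h d hd
    exact ⟨e, mem_NN1.2 he, hed⟩

lemma CU.cw {X} (h : CU X) (g τ) : CW (NN g X ∩ av τ) := by
  obtain ⟨σ1, σ2, h⟩ := h g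
  intro g'
  obtain ⟨τ', h'⟩ := fact2 σ1 σ2 τ g'
  refine ⟨τ', fun d hd => ?_⟩
  obtain ⟨c, hc, hcd⟩ := h' d hd
  exact ⟨c, ⟨h c hc.1 hc.2.1, hc.2.2⟩, hcd⟩

lemma Miss1.cu {U} (h : Miss1 U) (g c) : CU (U ∩ NN g {c}) := by
  obtain ⟨τ, h⟩ := h
  intro g'
  obtain ⟨σ1, σ2, h'⟩ := fact3 τ c g g'
  refine ⟨σ1, σ2, fun d h1 h2 => ?_⟩
  obtain ⟨e, he, hed⟩ := h' d h1 h2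
  exact ⟨e, ⟨h e he.1, mem_NN1.2 he.2⟩, hed⟩

lemma cu_N (g c τ) : CU (NN g {c} ∩ av τ) := by
  intro g'
  obtain ⟨σ1, σ2, h'⟩ := fact7 c g g' τ
  refine ⟨σ1, σ2, fun d h1 h2 => ?_⟩
  obtain ⟨e, he, hed⟩ := h' d h1 h2
  exact ⟨e, ⟨mem_NN1.2 he.1, he.2⟩, hed⟩
end P6

open SimpleGraph
namespace P6
set_option linter.unusedSectionVars false
set_option linter.unusedSimpArgs false

/-- The constraint network on the vertices of degree at least three. -/
structure Net (P : Type*) where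
  E : P → P → Prop
  F : P → P → Prop
  Con : P → P → Col → Col → Prop
  Es : ∀ {a b}, E a b → E b a
  Fs : ∀ {a b}, F a b → F b a
  Cs : ∀ {a b c d}, Con a b c d → Con b a d c
  hE : ∀ {a b}, E a b → ∃ g, ∀ c d, Con a b c d ↔ comp g c d = true
  hF : ∀ {a b}, F a b → ∀ c, ∃ τ, ∀ d, pr d ≠ τ → Con a b c d
  hN : ∀ {a b}, ¬ E a b → ¬ F a b → ∀ c d, Con a b c d
  Ei : ∀ a, ¬ E a a
  Fi : ∀ a, ¬ F a a
  dis : ∀ {a b}, E a b → ¬ F a b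
  tri : ∀ {a b c}, E a b → E b c → ¬ E a c
  q1 : ∀ {a b c}, E a b → E b c → ¬ F a c
  nv : ∀ ψ : P → Col, ¬ ∀ a b, Con a b (ψ a) (ψ b)
  base : ∀ (S : Set P) (u w : P), u ∈ S → (E u w ∨ F u w) → ∃ ψ : P → Col, ∀ a ∉ S, ∀ b ∉ S, Con a b (ψ a) (ψ b)

namespace Net
variable {P : Type*} (N : Net P)

def Rel (a b : P) : Prop := N.E a b ∨ N.F a b
lemma Rel.symm {N : Net P} {a b} (h : N.Rel a b) : N.Rel b a := h.imp N.Es N.Fs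
lemma con_of_not_rel {N : Net P} {a b} (h : ¬ N.Rel a b) (c d) : N.Con a b c d :=
  N.hN (fun h' => h (Or.inl h')) (fun h' => h (Or.inr h')) c d
lemma not_rel_self (a) : ¬ N.Rel a a := fun h => h.elim (N.Ei a) (N.Fi a)

def Valid (A : Set P) (ψ : P → Col) : Prop := ∀ a ∈ A, ∀ b ∈ A, N.Con a b (ψ a) (ψ b)

def Fam (A : Set P) (v : P) (X : Set Col) (φ : P → Col) : Prop :=
  ∀ c ∈ X, ∃ ψ, N.Valid A ψ ∧ ψ v = c ∧ ∀ a ∈ A, a ≠ v → (∃ b, b ∉ A ∧ N.Rel a b) → ψ a = φ a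

open Classical in
lemma extend {N : Net P} {A ψ w d} (hv : N.Valid A ψ) (hw : w ∉ A)
    (h : ∀ a ∈ A, N.Rel a w → N.Con a w (ψ a) d) :
    N.Valid (insert w A) (Function.update ψ w d) := by
  have hc : ∀ a ∈ A, N.Con a w (ψ a) d := by
    intro a ha
    by_cases hr : N.Rel a w
    · exact h a ha hr
    · exact con_of_not_rel hr _ _
  have hne : ∀ a ∈ A, a ≠ w := fun a ha h => hw (h ▸ ha)
  rintro a (rfl | ha) b (rfl | hb)
  · exact con_of_not_rel (N.not_rel_self _) _ _
  · rw [Function.update_self, Function.update_of_ne (hne b hb)]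
    exact N.Cs (hc b hb)
  · rw [Function.update_self, Function.update_of_ne (hne a ha)]
    exact hc a ha
  · rw [Function.update_of_ne (hne a ha), Function.update_of_ne (hne b hb)]
    exact hv a ha b hb

open Classical in
lemma fixed {N : Net P} {A ψ w Y} (hv : N.Valid A ψ) (hw : w ∉ A)
    (h : ∀ d ∈ Y, ∀ a ∈ A, N.Rel a w → N.Con a w (ψ a) d) :
    N.Fam (insert w A) w Y ψ := by
  intro d hd
  refine ⟨_, extend hv hw (h d hd), Function.update_self .., ?_⟩
  intro a _ haw _
  exact Function.update_of_ne haw _ _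

open Classical in
lemma closed {N : Net P} {A v X φ w Y} (hf : N.Fam A v X φ) (hvA : v ∈ A) (hw : w ∉ A)
    (hcl : ∀ b, N.Rel v b → b ∈ A ∨ b = w)
    (hY : ∀ d ∈ Y, ∃ c ∈ X, N.Con v w c d)
    (h : ∀ d ∈ Y, ∀ a ∈ A, a ≠ v → N.Rel a w → N.Con a w (φ a) d) :
    N.Fam (insert w A) w Y φ := by
  intro d hd
  obtain ⟨c, hc, hcd⟩ := hY d hd
  obtain ⟨ψ, hv, hψv, hψ⟩ := hf c hc
  refine ⟨_, extend (d := d) hv hw ?_, Function.update_self .., ?_⟩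
  · intro a ha hr
    by_cases hav : a = v
    · subst hav; rw [hψv]; exact hcd
    · rw [hψ a ha hav ⟨w, hw, hr⟩]; exact h d hd a ha hav hr
  · rintro a haA haw ⟨b, hb, hr⟩
    rw [Function.update_of_ne haw]
    have haA : a ∈ A := haA.resolve_left haw
    have hbA : b ∉ A := fun h => hb (Or.inr h)
    refine hψ a haA ?_ ⟨b, hbA, hr⟩
    rintro rfl
    rcases hcl b hr with h | h
    · exact hbA h
    · exact hb (Or.inl h)

def T1 (w : P) : Prop := (∃ x y, ∀ b, N.E w b → b = x ∨ b = y) ∧ ∃ f, ∀ b, N.F w b → b = f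
def T0 (w : P) : Prop := (∃ x y z, ∀ b, N.E w b → b = x ∨ b = y ∨ b = z) ∧ ∀ b, ¬ N.F w b

variable {N}
lemma T1.e2 {w x y b} (h : N.T1 w) (hx : N.E w x) (hy : N.E w y) (hxy : x ≠ y) (hb : N.E w b) :
    b = x ∨ b = y := by
  obtain ⟨⟨p, q, h⟩, -⟩ := h
  have := h x hx; have := h y hy; have := h b hb
  grind

lemma T0.e3 {w x y z b} (h : N.T0 w) (hx : N.E w x) (hy : N.E w y) (hz : N.E w z) (hxy : x ≠ y)
    (hxz : x ≠ z) (hyz : y ≠ z) (hb : N.E w b) : b = x ∨ b = y ∨ b = z := by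
  obtain ⟨⟨p, q, r, h⟩, -⟩ := h
  have := h x hx; have := h y hy; have := h z hz; have := h b hb
  grind

lemma T1.tau {w} (h : N.T1 w) (φ : P → Col) :
    ∃ τ, ∀ d, pr d ≠ τ → ∀ a, N.F a w → N.Con a w (φ a) d := by
  obtain ⟨-, f, hf⟩ := h
  by_cases hfw : N.F f w
  · obtain ⟨τ, hτ⟩ := N.hF hfw (φ f)
    refine ⟨τ, fun d hd a ha => ?_⟩
    obtain rfl := hf a (N.Fs ha)
    exact hτ d hd
  · refine ⟨(0, false), fun d hd a ha => ?_⟩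
    obtain rfl := hf a (N.Fs ha)
    exact absurd ha hfw

lemma wclosed {A u X φ w} (hf : N.Fam A u X φ) (hu : u ∈ A) (hw : w ∉ A) (huw : N.E u w)
    (hEw : ∀ b ∈ A, N.E b w → b = u) (h1 : N.T1 w)
    (st : ((∀ b, N.Rel u b → b ∈ A ∨ b = w) ∧ CU X) ∨ OU X) :
    ∃ φ' X', N.Fam (insert w A) w X' φ' ∧ CW X' := by
  obtain ⟨g, hg⟩ := N.hE huw
  obtain ⟨τ, hτ⟩ := h1.tau φ
  rcases st with ⟨hcl, hX⟩ | hX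
  · refine ⟨φ, _, closed hf hu hw hcl (Y := NN g X ∩ av τ) ?_ ?_, hX.cw g τ⟩
    · rintro d ⟨⟨c, hc, hcd⟩, -⟩
      exact ⟨c, hc, (hg c d).2 hcd⟩
    · rintro d ⟨-, hd⟩ a ha hau (hr | hr)
      · exact absurd (hEw a ha hr) hau
      · exact hτ d hd a hr
  · obtain ⟨y, hy, hcw⟩ := hX.1 g τ
    obtain ⟨ψ, hv, hψu, hψ⟩ := hf y hy
    refine ⟨ψ, _, fixed hv hw (Y := NN g {y} ∩ av τ) ?_, hcw⟩
    rintro d ⟨hd1, hd⟩ a ha (hr | hr)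
    · obtain rfl := hEw a ha hr
      rw [hψu, hg]; exact mem_NN1.1 hd1
    · have hau : a ≠ u := by rintro rfl; exact N.dis huw hr
      rw [hψ a ha hau ⟨w, hw, Or.inr hr⟩]
      exact hτ d hd a hr

lemma uclosed {A w X φ u w'} (hf : N.Fam A w X φ) (hX : CW X) (hw : w ∈ A) (hu : u ∉ A)
    (hwu : N.E w u) (hcl : ∀ b, N.Rel w b → b ∈ A ∨ b = u) (h0 : N.T0 u)
    (hw'A : w' ∉ A) (huw' : N.E u w') :
    ∃ X', N.Fam (insert u A) u X' φ ∧ (((∀ b, N.Rel u b → b ∈ A ∨ b = w') ∧ CU X') ∨ OU X') := by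
  obtain ⟨g, hg⟩ := N.hE hwu
  by_cases hx : ∃ x ∈ A, x ≠ w ∧ N.E u x
  · obtain ⟨x, hxA, hxw, hux⟩ := hx
    have hall : ∀ b, N.E u b → b = w ∨ b = x ∨ b = w' := fun b hb =>
      h0.e3 (N.Es hwu) hux huw' hxw.symm (fun h => hw'A (h ▸ hw)) (fun h => hw'A (h ▸ hxA)) hb
    obtain ⟨g', hg'⟩ := N.hE (N.Es hux)
    refine ⟨NN g X ∩ NN g' {φ x}, closed hf hw hu hcl ?_ ?_, Or.inl ⟨?_, (hX g).cu _ _⟩⟩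
    · rintro d ⟨⟨c, hc, hcd⟩, -⟩
      exact ⟨c, hc, (hg c d).2 hcd⟩
    · rintro d ⟨-, hd⟩ a ha haw (hr | hr)
      · rcases hall a (N.Es hr) with rfl | rfl | rfl
        · exact absurd rfl haw
        · rw [hg']; exact mem_NN1.1 hd
        · exact absurd ha hw'A
      · exact absurd (N.Fs hr) (h0.2 a)
    · rintro b (hb | hb)
      · rcases hall b hb with rfl | rfl | rfl
        · exact Or.inl hw
        · exact Or.inl hxA
        · exact Or.inr rfl
      · exact absurd hb (h0.2 b)
  · push Not at hx
    refine ⟨NN g X, closed hf hw hu hcl ?_ ?_, Or.inr (hX g).ou⟩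
    · rintro d ⟨c, hc, hcd⟩
      exact ⟨c, hc, (hg c d).2 hcd⟩
    · rintro d - a ha haw (hr | hr)
      · exact absurd (N.Es hr) (hx a ha haw)
      · exact absurd (N.Fs hr) (h0.2 a)

open Classical in
lemma wopen {A u X φ w u' w'} (hf : N.Fam A u X φ) (hu : u ∈ A) (hw : w ∉ A) (huw : N.E u w)
    (hu' : u' ∉ A) (hwu' : N.E w u')
    (hEw : ∀ b ∈ A, N.E b w → b = u) (hFw : ∀ b ∈ A, ¬ N.F b w)
    (hX : ∀ g, Q1 (NN g X)) (h0 : N.T0 u') (hw'A : w' ∉ A) (hw'w : w' ≠ w) (huw' : N.E u' w') :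
    ∃ φ' X', N.Fam (insert u' (insert w A)) u' X' φ' ∧
      (((∀ b, N.Rel u' b → b ∈ insert w A ∨ b = w') ∧ CU X') ∨ OU X') := by
  obtain ⟨g, hg⟩ := N.hE huw
  obtain ⟨g1, hg1⟩ := N.hE hwu'
  have hu'w : u' ≠ w := by rintro rfl; exact N.Ei _ hwu'
  have hu'A : u' ∉ insert w A := by rintro (h | h); exacts [hu'w h, hu' h]
  have key : ∀ z ∈ NN g X, ∃ ψ, N.Valid (insert w A) ψ ∧ ψ w = z ∧
      ∀ a ∈ A, a ≠ u → (∃ b, b ∉ A ∧ N.Rel a b) → ψ a = φ a := by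
    rintro z ⟨y, hy, hyz⟩
    obtain ⟨ψ, hv, hψu, hψ⟩ := hf y hy
    refine ⟨_, extend (d := z) hv hw ?_, Function.update_self .., ?_⟩
    · rintro a ha (hr | hr)
      · obtain rfl := hEw a ha hr
        rw [hψu, hg]; exact hyz
      · exact absurd hr (hFw a ha)
    · intro a ha hau hb
      rw [Function.update_of_ne (by rintro rfl; exact hw ha)]
      exact hψ a ha hau hb
  by_cases hx : ∃ x ∈ A, N.E u' x
  · obtain ⟨x, hxA, hux⟩ := hx
    have hxw : x ≠ w := fun h => hw (h ▸ hxA)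
    have hxu : x ≠ u := by rintro rfl; exact N.tri huw hwu' (N.Es hux)
    have hall : ∀ b, N.E u' b → b = w ∨ b = x ∨ b = w' := fun b hb =>
      h0.e3 (N.Es hwu') hux huw' hxw.symm hw'w.symm (fun h => hw'A (h ▸ hxA)) hb
    obtain ⟨g', hg'⟩ := N.hE (N.Es hux)
    obtain ⟨z, hz, hm⟩ := hX g (φ x) g' g1
    obtain ⟨ψ, hv, hψw, hψ⟩ := key z hz
    refine ⟨ψ, _, fixed hv hu'A (Y := NN g1 {z} ∩ NN g' {φ x}) ?_, Or.inl ⟨?_, hm⟩⟩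
    · rintro d ⟨hd1, hd2⟩ a ha (hr | hr)
      · rcases hall a (N.Es hr) with rfl | rfl | rfl
        · rw [hψw, hg1]; exact mem_NN1.1 hd1
        · rw [hψ a hxA hxu ⟨u', hu', Or.inl hr⟩, hg']; exact mem_NN1.1 hd2
        · exact absurd (ha.resolve_left hw'w) hw'A
      · exact absurd (N.Fs hr) (h0.2 a)
    · rintro b (hb | hb)
      · rcases hall b hb with rfl | rfl | rfl
        · exact Or.inl (Or.inl rfl)
        · exact Or.inl (Or.inr hxA)
        · exact Or.inr rfl
      · exact absurd hb (h0.2 b)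
  · push Not at hx
    obtain ⟨z, hz, -⟩ := hX g ((0, false, false) : Col) true g1
    obtain ⟨ψ, hv, hψw, hψ⟩ := key z hz
    refine ⟨ψ, _, fixed hv hu'A (Y := NN g1 {z}) ?_, Or.inr (ou_N g1 z)⟩
    rintro d hd a (rfl | ha) (hr | hr)
    · rw [hψw, hg1]; exact mem_NN1.1 hd
    · exact absurd (N.Fs hr) (h0.2 a)
    · exact absurd (N.Es hr) (hx a ha)
    · exact absurd (N.Fs hr) (h0.2 a)

variable (N) in
def Alt (R : Set P) (wk : P) : P → List P → Prop
  | _, [] => False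
  | u, [w] => w = wk ∧ N.E u w ∧ N.T1 w ∧ (∃ e ∈ R, N.E w e) ∧ ∀ b ∈ R, ¬ N.F w b
  | u, w :: u' :: l => N.E u w ∧ N.E w u' ∧ N.T1 w ∧ N.T0 u' ∧ Alt R wk u' l

def cA (R : Set P) (l : List P) : Set P := {b | b ∉ l ∧ b ∉ R}

lemma Alt.hd {R : Set P} {wk u l} (h : N.Alt R wk u l) : ∃ w l', l = w :: l' ∧ N.E u w := by
  match l, h with
  | [w], h => exact ⟨w, [], rfl, h.2.1⟩
  | w :: u' :: l, h => exact ⟨w, _, rfl, h.1⟩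

theorem scan (R : Set P) (wk : P) : ∀ (n : ℕ) (l : List P) (u φ X), l.length ≤ n →
    N.Alt R wk u l → (u :: l).Nodup → (∀ b ∈ u :: l, b ∉ R) → N.Fam (cA R l) u X φ →
    (((∀ b, N.Rel u b → b ∈ cA R l ∨ some b = l.head?) ∧ CU X) ∨ OU X) →
    ∃ φ' X', N.Fam Rᶜ wk X' φ' ∧ CW X' := by
  intro n
  induction n with
  | zero =>
    intro l u φ X hl ha
    obtain ⟨w, l', rfl, -⟩ := ha.hd
    simp at hl
  | succ n ih =>
    intro l u φ X hl ha hnd hR hf st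
    match l, hl, ha, hnd, hR, hf, st with
    | [w], _, ha, hnd, hR, hf, st =>
      obtain ⟨rfl, huw, h1, ⟨e, heR, hwe⟩, hF⟩ := ha
      have hne : u ≠ w := by rintro rfl; exact N.Ei _ huw
      have hRe : insert w (cA R [w]) = Rᶜ := by
        ext b
        simp only [cA, Set.mem_insert_iff, Set.mem_ofPred_eq, List.mem_singleton, Set.mem_compl_iff]
        have := hR w (by simp)
        grind
      rw [← hRe]
      refine wclosed hf ⟨by simpa using hne, hR u (by simp)⟩ (fun h => h.1 (by simp)) huw ?_ h1 ?_
      · intro b hb hbw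
        refine (h1.e2 (N.Es huw) hwe (fun h => hR u (by simp) (h ▸ heR)) (N.Es hbw)).resolve_right ?_
        rintro rfl
        exact hb.2 heR
      · refine st.imp_left fun h => ⟨fun b hb => (h.1 b hb).imp_right fun h => ?_, h.2⟩
        simpa using h
    | w :: u' :: l, hl, ha, hnd, hR, hf, st =>
      obtain ⟨huw, hwu', h1, h0, hal⟩ := ha
      obtain ⟨w', l', hl', huw'⟩ := hal.hd
      have hnd' := hnd
      simp only [List.nodup_cons, List.mem_cons, not_or] at hnd'
      obtain ⟨⟨hn1, hn2, hn3⟩, ⟨hn4, hn5⟩, hn6, hn7⟩ := hnd'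
      have hRu := hR u (by simp)
      have hRw := hR w (by simp)
      have hRu' := hR u' (by simp)
      have huA : u ∈ cA R (w :: u' :: l) := ⟨by simp [hn1, hn2, hn3], hRu⟩
      have hwA : w ∉ cA R (w :: u' :: l) := fun h => h.1 (by simp)
      have hu'A : u' ∉ cA R (w :: u' :: l) := fun h => h.1 (by simp)
      have hw'l : w' ∈ l := by rw [hl']; simp
      have hw'A : w' ∉ cA R (w :: u' :: l) := fun h => h.1 (by simp [hw'l])
      have hw'w : w' ≠ w := fun h => hn5 (h ▸ hw'l)
      have hA : insert u' (insert w (cA R (w :: u' :: l))) = cA R l := by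
        ext b
        simp only [cA, Set.mem_insert_iff, Set.mem_ofPred_eq, List.mem_cons]
        grind
      have hEw : ∀ b ∈ cA R (w :: u' :: l), N.E b w → b = u := fun b hb hbw =>
        (h1.e2 (N.Es huw) hwu' hn2 (N.Es hbw)).resolve_right fun h => hu'A (h ▸ hb)
      have hnd2 : (u' :: l).Nodup := by simp [hn6, hn7]
      have hR2 : ∀ b ∈ u' :: l, b ∉ R := fun b hb => hR b (by simp at hb ⊢; tauto)
      have hlen : l.length ≤ n := by simp at hl; omega
      have fin : ∀ φ' X', N.Fam (insert u' (insert w (cA R (w :: u' :: l)))) u' X' φ' →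
          (((∀ b, N.Rel u' b → b ∈ insert w (cA R (w :: u' :: l)) ∨ b = w') ∧ CU X') ∨ OU X') →
          ∃ φ' X', N.Fam Rᶜ wk X' φ' ∧ CW X' := by
        intro φ' X' hf' hst
        rw [hA] at hf'
        refine ih l u' φ' X' hlen hal hnd2 hR2 hf' (hst.imp_left fun h => ⟨fun b hb => ?_, h.2⟩)
        rcases h.1 b hb with h | h
        · left; rw [← hA]; exact Or.inr h
        · right; rw [hl', h]; rfl
      by_cases hF : ∀ b, N.F w b → b ∈ cA R (w :: u' :: l)
      · have st' : ((∀ b, N.Rel u b → b ∈ cA R (w :: u' :: l) ∨ b = w) ∧ CU X) ∨ OU X :=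
          st.imp_left fun h => ⟨fun b hb => (h.1 b hb).imp_right fun h => by simpa using h, h.2⟩
        obtain ⟨φ1, X1, hf1, hcw⟩ := wclosed hf huA hwA huw hEw h1 st'
        have hcl : ∀ b, N.Rel w b → b ∈ insert w (cA R (w :: u' :: l)) ∨ b = u' := by
          rintro b (hb | hb)
          · rcases h1.e2 (N.Es huw) hwu' hn2 hb with rfl | rfl
            · exact Or.inl (Or.inr huA)
            · exact Or.inr rfl
          · exact Or.inl (Or.inr (hF b hb))
        obtain ⟨X2, hf2, hst⟩ := uclosed hf1 hcw (Or.inl rfl)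
          (by rintro (h | h); exacts [hn4 h.symm, hu'A h]) hwu' hcl h0
          (by rintro (h | h); exacts [hw'w h, hw'A h]) huw'
        exact fin _ _ hf2 hst
      · push Not at hF
        obtain ⟨f, hf1, hf2⟩ := hF
        have hFw : ∀ b ∈ cA R (w :: u' :: l), ¬ N.F b w := by
          intro b hb hbw
          obtain ⟨-, f', hf'⟩ := h1
          have := hf' b (N.Fs hbw)
          have := hf' f hf1
          grind
        have hq : ∀ g, Q1 (NN g X) := by
          rcases st with h | h
          · exact fun g => h.2.q1 g
          · exact h.2
        obtain ⟨φ1, X1, h3, h4⟩ := wopen hf huA hwA huw hu'A hwu' hEw hFw hq h0 hw'A hw'w huw'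
        exact fin _ _ h3 h4
end Net
end P6

open SimpleGraph
namespace P6
set_option linter.unusedSectionVars false
set_option linter.unusedSimpArgs false
namespace Net
variable {P : Type*} {N : Net P}

theorem start (R : Set P) (wk u : P) (l : List P) (ha : N.Alt R wk u l) (hnd : (u :: l).Nodup)
    (hR : ∀ b ∈ u :: l, b ∉ R)
    (hs : N.T1 u ∨ (N.T0 u ∧ ∃ x, N.E u x ∧ x ∉ cA R l ∧ some x ≠ l.head?)) :
    ∃ φ' X', N.Fam Rᶜ wk X' φ' ∧ CW X' := by
  obtain ⟨w, l', hl', huw⟩ := ha.hd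
  obtain ⟨φ, hφ⟩ := N.base (cA R (u :: l))ᶜ u w (fun h => h.1 (by simp)) (Or.inl huw)
  have hv : N.Valid (cA R (u :: l)) φ := fun a ha b hb => hφ a (not_not.2 ha) b (not_not.2 hb)
  have hul : u ∉ l := (List.nodup_cons.1 hnd).1
  have hA : insert u (cA R (u :: l)) = cA R l := by
    ext b
    simp only [cA, Set.mem_insert_iff, Set.mem_ofPred_eq, List.mem_cons]
    have := hR u (by simp)
    grind
  have huA : u ∉ cA R (u :: l) := fun h => h.1 (by simp)
  have hwl : w ∈ l := by rw [hl']; simp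
  have hwA : w ∉ cA R (u :: l) := fun h => h.1 (by simp [hwl])
  have sub : ∀ b ∈ cA R (u :: l), b ∈ cA R l := fun b hb => by rw [← hA]; exact Or.inr hb
  suffices h : ∃ X, N.Fam (insert u (cA R (u :: l))) u X φ ∧
      (((∀ b, N.Rel u b → b ∈ cA R l ∨ some b = l.head?) ∧ CU X) ∨ OU X) by
    obtain ⟨X, hf, st⟩ := h
    rw [hA] at hf
    exact scan R wk l.length l u φ X le_rfl ha hnd hR hf st
  rcases hs with h1 | ⟨h0, x, hux, hxA, hxw⟩
  · obtain ⟨τ, hτ⟩ := h1.tau φ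
    by_cases ho : ∃ o ∈ cA R (u :: l), N.E u o
    · obtain ⟨o, hoA, huo⟩ := ho
      have hall : ∀ b, N.E u b → b = w ∨ b = o := fun b hb =>
        h1.e2 huw huo (fun h => hwA (h ▸ hoA)) hb
      obtain ⟨g, hg⟩ := N.hE (N.Es huo)
      by_cases hF : ∀ b, N.F u b → b ∈ cA R (u :: l)
      · refine ⟨_, fixed hv huA (Y := NN g {φ o} ∩ av τ) ?_, Or.inl ⟨?_, cu_N _ _ _⟩⟩
        · rintro d ⟨hd1, hd2⟩ a ha (hr | hr)
          · rcases hall a (N.Es hr) with rfl | rfl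
            · exact absurd ha hwA
            · rw [hg]; exact mem_NN1.1 hd1
          · exact hτ d hd2 a hr
        · rintro b (hb | hb)
          · rcases hall b hb with rfl | rfl
            · right; rw [hl']; rfl
            · left; exact sub _ hoA
          · left; exact sub _ (hF b hb)
      · push Not at hF
        obtain ⟨f, hf1, hf2⟩ := hF
        refine ⟨_, fixed hv huA (Y := NN g {φ o}) ?_, Or.inr (ou_N _ _)⟩
        rintro d hd1 a ha (hr | hr)
        · rcases hall a (N.Es hr) with rfl | rfl
          · exact absurd ha hwA
          · rw [hg]; exact mem_NN1.1 hd1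
        · obtain ⟨-, f', hf'⟩ := h1
          have := hf' a (N.Fs hr)
          have := hf' f hf1
          grind
    · push Not at ho
      refine ⟨_, fixed hv huA (Y := av τ) ?_, Or.inr (ou_av _)⟩
      rintro d hd a ha (hr | hr)
      · exact absurd (N.Es hr) (ho a ha)
      · exact hτ d hd a hr
  · by_cases ho : ∃ o ∈ cA R (u :: l), N.E u o
    · obtain ⟨o, hoA, huo⟩ := ho
      have hxw' : x ≠ w := by rintro rfl; exact hxw (by rw [hl']; rfl)
      have hxo : x ≠ o := by rintro rfl; exact hxA (sub _ hoA)
      have hall : ∀ b, N.E u b → b = w ∨ b = x ∨ b = o := fun b hb =>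
        h0.e3 huw hux huo hxw'.symm (fun h => hwA (h ▸ hoA)) hxo hb
      obtain ⟨g, hg⟩ := N.hE (N.Es huo)
      refine ⟨_, fixed hv huA (Y := NN g {φ o}) ?_, Or.inr (ou_N _ _)⟩
      rintro d hd1 a ha (hr | hr)
      · rcases hall a (N.Es hr) with rfl | rfl | rfl
        · exact absurd ha hwA
        · exact absurd (sub _ ha) hxA
        · rw [hg]; exact mem_NN1.1 hd1
      · exact absurd (N.Fs hr) (h0.2 a)
    · push Not at ho
      refine ⟨_, fixed hv huA (Y := Set.univ) ?_, Or.inr ou_univ⟩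
      rintro d - a ha (hr | hr)
      · exact absurd (N.Es hr) (ho a ha)
      · exact absurd (N.Fs hr) (h0.2 a)

lemma not_valid_univ {ψ} : ¬ N.Valid Set.univ ψ :=
  fun h => N.nv ψ fun a b => h a trivial b trivial

lemma endL {e w φ X} (hf : N.Fam {e}ᶜ w X φ) (hX : CW X) (hwe : N.E w e) (h1 : N.T1 e) : False := by
  have hne : w ≠ e := by rintro rfl; exact N.Ei _ hwe
  obtain ⟨g, hg⟩ := N.hE hwe
  obtain ⟨τ, hτ⟩ := h1.tau φ
  obtain ⟨τ', hτ'⟩ := hX g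
  have key : ∃ d, pr d ≠ τ ∧ pr d ≠ τ' ∧ ∀ a, a ≠ w → N.E a e → N.Con a e (φ a) d := by
    by_cases ho : ∃ o, o ≠ w ∧ N.E o e
    · obtain ⟨o, how, hoe⟩ := ho
      obtain ⟨g', hg'⟩ := N.hE hoe
      obtain ⟨d, h2, h3, h4⟩ := fact8 (φ o) g' τ τ'
      refine ⟨d, h3, h4, fun a haw hae => ?_⟩
      rcases h1.e2 (N.Es hwe) (N.Es hoe) how.symm (N.Es hae) with rfl | rfl
      · exact absurd rfl haw
      · exact (hg' _ _).2 h2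
    · push Not at ho
      obtain ⟨d, h2, h3, h4⟩ := fact8 (0, false, false) true τ τ'
      exact ⟨d, h3, h4, fun a haw hae => absurd hae (ho a haw)⟩
  obtain ⟨d, h2, h3, h4⟩ := key
  have := closed hf hne (w := e) (by simp) (Y := {d}) (by simp [em']) ?_ ?_
  · obtain ⟨ψ, hv, -⟩ := this d rfl
    have hu : insert e ({e}ᶜ : Set P) = Set.univ := by ext; simp [em]
    rw [hu] at hv
    exact not_valid_univ hv
  · intro d' hd'
    obtain rfl : d' = d := hd'
    obtain ⟨c, hc, hcd⟩ := hτ' d' h3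
    exact ⟨c, hc, (hg _ _).2 hcd⟩
  · intro d' hd'
    obtain rfl : d' = d := hd'
    rintro a - haw (hr | hr)
    · exact h4 a haw hr
    · exact hτ d' h2 a hr

/-- an arm: `w` of type `T1` hanging on `a`, all other neighbours in `B` coloured by `φ` -/
lemma arm {w a} {φ : P → Col} (haw : N.E a w) (h1 : N.T1 w) : ∃ σ1 σ2 : Pr, ∀ d, pr d ≠ σ1 → pr d ≠ σ2 →
    ∃ e, N.Con a w d e ∧ ∀ b, b ≠ a → N.Rel b w → N.Con b w (φ b) e := by
  obtain ⟨g, hg⟩ := N.hE haw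
  obtain ⟨τ, hτ⟩ := h1.tau φ
  by_cases ho : ∃ o, o ≠ a ∧ N.E o w
  · obtain ⟨o, how, hoe⟩ := ho
    obtain ⟨g', hg'⟩ := N.hE hoe
    obtain ⟨σ1, σ2, h⟩ := fact7 (φ o) g' g τ
    refine ⟨σ1, σ2, fun d h2 h3 => ?_⟩
    obtain ⟨e, ⟨he1, he2⟩, he3⟩ := h d h2 h3
    refine ⟨e, ?_, ?_⟩
    · rw [hg, comp_symm]; exact he3
    · rintro b hb (hr | hr)
      · rcases h1.e2 (N.Es haw) (N.Es hoe) how.symm (N.Es hr) with rfl | rfl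
        · exact absurd rfl hb
        · exact (hg' _ _).2 he1
      · exact hτ e he2 b hr
  · push Not at ho
    obtain ⟨σ1, σ2, h⟩ := fact7 (0, false, false) true g τ
    refine ⟨σ1, σ2, fun d h2 h3 => ?_⟩
    obtain ⟨e, ⟨he1, he2⟩, he3⟩ := h d h2 h3
    refine ⟨e, ?_, ?_⟩
    · rw [hg, comp_symm]; exact he3
    · rintro b hb (hr | hr)
      · exact absurd hr (ho b hb)
      · exact hτ e he2 b hr

lemma endD {a w0 w3 w φ X} (hf : N.Fam {a, w0, w3}ᶜ w X φ) (hX : CW X) (hw0 : w ≠ w0) (hw3 : w ≠ w3)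
    (h03 : w0 ≠ w3)
    (hwa : N.E w a) (ha0 : N.E a w0) (ha3 : N.E a w3) (h0 : N.T0 a) (h1 : N.T1 w0)
    (h3 : N.T1 w3) (hcl : ∀ b, N.Rel w b → b ∈ ({a, w0, w3}ᶜ : Set P) ∨ b = a) : False := by
  have hne : w ≠ a := by rintro rfl; exact N.Ei _ hwa
  have hne0 : a ≠ w0 := by rintro rfl; exact N.Ei _ ha0
  have hne3 : a ≠ w3 := by rintro rfl; exact N.Ei _ ha3
  have hall : ∀ b, N.E a b → b = w ∨ b = w0 ∨ b = w3 := fun b hb =>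
    h0.e3 (N.Es hwa) ha0 ha3 hw0 hw3 h03 hb
  obtain ⟨g, hg⟩ := N.hE hwa
  obtain ⟨τ, hτ⟩ := hX g
  obtain ⟨σ1, σ2, hσ⟩ := arm (φ := φ) ha0 h1
  obtain ⟨σ3, σ4, hσ'⟩ := arm (φ := φ) ha3 h3
  obtain ⟨d, d1, d2, d3, d4, d5⟩ := fact9 τ σ1 σ2 σ3 σ4
  obtain ⟨e0, he0, he0'⟩ := hσ d d2 d3
  obtain ⟨e3, he3, he3'⟩ := hσ' d d4 d5
  have hr03 : ¬ N.Rel w0 w3 := fun h => h.elim (N.tri (N.Es ha0) ha3) (N.q1 (N.Es ha0) ha3)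
  have hrw0 : ¬ N.Rel w w0 := fun h => h.elim (N.tri hwa ha0) (N.q1 hwa ha0)
  have hrw3 : ¬ N.Rel w w3 := fun h => h.elim (N.tri hwa ha3) (N.q1 hwa ha3)
  obtain ⟨c, hc, hcd⟩ := hτ d d1
  obtain ⟨ψ, hv, hψw, hψ⟩ := hf c hc
  classical
  have e1 := extend (w := a) (d := d) hv (by simp) (by
    rintro b hb (hr | hr)
    · rcases hall b (N.Es hr) with rfl | rfl | rfl
      · rw [hψw, hg]; exact hcd
      · exact absurd hb (by simp)
      · exact absurd hb (by simp)
    · exact absurd (N.Fs hr) (h0.2 b))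
  have e2 := extend (w := w0) (d := e0) e1 (by simp [hne0.symm]) (by
    rintro b (rfl | hb) hr
    · rw [Function.update_self]; exact he0
    · have hba : b ≠ a := by rintro rfl; exact absurd hb (by simp)
      rw [Function.update_of_ne hba, hψ b hb (by rintro rfl; exact hrw0 hr) ⟨w0, by simp, hr⟩]
      exact he0' b hba hr)
  have e3 := extend (w := w3) (d := e3) e2 (by simp [hne3.symm, h03.symm]) (by
    rintro b (rfl | rfl | hb) hr
    · exact absurd hr hr03
    · rw [Function.update_of_ne hne0, Function.update_self]; exact he3
    · have hba : b ≠ a := by rintro rfl; exact absurd hb (by simp)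
      have hbw : b ≠ w0 := by rintro rfl; exact absurd hb (by simp)
      rw [Function.update_of_ne hbw, Function.update_of_ne hba,
        hψ b hb (by rintro rfl; exact hrw3 hr) ⟨w3, by simp, hr⟩]
      exact he3' b hba hr)
  have hu : insert w3 (insert w0 (insert a ({a, w0, w3}ᶜ : Set P))) = Set.univ := by
    ext b; simp; tauto
  rw [hu] at e3
  exact not_valid_univ e3
end Net
end P6

open SimpleGraph
namespace P6
set_option linter.unusedSectionVars false
set_option linter.unusedSimpArgs false
namespace Net
variable {P : Type*} {N : Net P}

/-- degree-three vertices: `D1` with one, `D0` with no neighbour of degree two -/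
structure Typ (N : Net P) (D0 D1 : P → Prop) : Prop where
  t1 : ∀ a, D1 a → N.T1 a
  t0 : ∀ a, D0 a → N.T0 a
  dj : ∀ a, D0 a → D1 a → False

variable {D0 D1 : P → Prop}

def Opp (D0 D1 : P → Prop) (a b : P) : Prop := (D1 a ∧ D0 b) ∨ (D0 a ∧ D1 b)

variable (N D0 D1) in
def Chn (a b : P) : Prop := N.E a b ∧ Opp D0 D1 a b

lemma altOf (hT : Typ N D0 D1) {R : Set P} {wk e : P} (hwk : D1 wk) (heR : e ∈ R) (he : N.E wk e)
    (hF : ∀ b ∈ R, ¬ N.F wk b) : ∀ (q : List P) (h : P), List.IsChain (Chn N D0 D1) (h :: q) →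
    (h :: q).getLast? = some wk →
    (D0 h → N.Alt R wk h q) ∧ (D1 h → ∀ u, N.E u h → N.Alt R wk u (h :: q)) := by
  intro q
  induction q with
  | nil =>
    intro h _ hl
    obtain rfl : h = wk := by simpa using hl
    exact ⟨fun h0 => (hT.dj _ h0 hwk).elim, fun h1 u hu => ⟨rfl, hu, hT.t1 _ h1, ⟨e, heR, he⟩, hF⟩⟩
  | cons h' q ih =>
    intro h hc hl
    rw [List.isChain_cons_cons] at hc
    obtain ⟨ih0, ih1⟩ := ih h' hc.2 (by simpa using hl)
    refine ⟨fun h0 => ?_, fun h1 u hu => ?_⟩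
    · rcases hc.1.2 with ⟨h1, -⟩ | ⟨-, h1⟩
      · exact (hT.dj _ h0 h1).elim
      · exact ih1 h1 h hc.1.1
    · rcases hc.1.2 with ⟨-, h0⟩ | ⟨h0, -⟩
      · exact ⟨hu, hc.1.1, hT.t1 _ h1, hT.t0 _ h0, ih0 h0⟩
      · exact (hT.dj _ h0 h1).elim

lemma noLLL (hT : Typ N D0 D1) {y x z} (hy : D1 y) (hx : D1 x) (hz : D1 z) (hyx : N.E y x)
    (hxz : N.E x z) (hyz : y ≠ z) : False := by
  have ha : N.Alt {z} x y [x] :=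
    ⟨rfl, hyx, hT.t1 _ hx, ⟨z, rfl, hxz⟩, fun b hb => by obtain rfl := hb; exact N.dis hxz⟩
  have hne : y ≠ x := by rintro rfl; exact N.Ei _ hyx
  have hne' : x ≠ z := by rintro rfl; exact N.Ei _ hxz
  obtain ⟨φ, X, hf, hX⟩ := start {z} x y [x] ha (by simpa using hne) (by simp [hyz, hne'])
    (Or.inl (hT.t1 _ hy))
  exact endL hf hX hxz (hT.t1 _ hz)

lemma noLL (hT : Typ N D0 D1) {u h q x1 x0} (hc : List.IsChain (Chn N D0 D1) (h :: q))
    (hl : (h :: q).getLast? = some x1) (h1 : D1 x1) (h0 : D1 x0) (h10 : N.E x1 x0)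
    (hnd : (h :: q).Nodup) (hx0 : x0 ∉ h :: q) (hh : D1 h) (hu : D1 u) (huh : N.E u h)
    (hux : u ≠ x0) (huq : u ∉ h :: q) : False := by
  have ha := (altOf hT (R := {x0}) h1 rfl h10
    (fun b hb => by obtain rfl := hb; exact N.dis h10) q h hc hl).2 hh u huh
  obtain ⟨φ, X, hf, hX⟩ := start {x0} x1 u (h :: q) ha (List.nodup_cons.2 ⟨huq, hnd⟩)
    (by
      intro b hb
      rintro rfl
      rcases List.mem_cons.1 hb with rfl | hb
      · exact hux rfl
      · exact hx0 hb)
    (Or.inl (hT.t1 _ hu))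
  exact endL hf hX h10 (hT.t1 _ h0)

lemma noLC (hT : Typ N D0 D1) {h q x1 x0} (hc : List.IsChain (Chn N D0 D1) (h :: q))
    (hl : (h :: q).getLast? = some x1) (h1 : D1 x1) (h0 : D1 x0) (h10 : N.E x1 x0)
    (hnd : (h :: q).Nodup) (hx0 : x0 ∉ h :: q) (hh : D0 h) (hhx : N.E h x0) : False := by
  have ha := (altOf hT (R := {x0}) h1 rfl h10
    (fun b hb => by obtain rfl := hb; exact N.dis h10) q h hc hl).1 hh
  obtain ⟨φ, X, hf, hX⟩ := start {x0} x1 h q ha hnd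
    (by
      intro b hb
      rintro rfl
      exact hx0 hb)
    (Or.inr ⟨hT.t0 _ hh, x0, hhx, fun h => h.2 rfl, fun h => hx0 (List.mem_cons_of_mem _
      (List.mem_of_mem_head? h.symm))⟩)
  exact endL hf hX h10 (hT.t1 _ h0)

lemma noDC (hT : Typ N D0 D1) {h q x w3 wk} (hc : List.IsChain (Chn N D0 D1) (h :: q))
    (hq : q ≠ []) (hl : q.getLast? = some wk) (hwk : D1 wk) (hwx : N.E wk x)
    (hnd : (h :: q).Nodup) (hxq : x ∉ h :: q) (h3q : w3 ∉ h :: q) (hh : D1 h) (hx : D0 x)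
    (h3 : D1 w3) (hhx : N.E h x) (hx3 : N.E x w3) : False := by
  obtain ⟨u, l, rfl⟩ := List.exists_cons_of_ne_nil hq
  rw [List.isChain_cons_cons] at hc
  have hu : D0 u := by
    rcases hc.1.2 with ⟨-, h0⟩ | ⟨h0, -⟩
    · exact h0
    · exact (hT.dj _ h0 hh).elim
  have hwkm : wk ∈ u :: l := List.mem_of_mem_getLast? hl
  have hwh : wk ≠ h := by rintro rfl; exact (List.nodup_cons.1 hnd).1 hwkm
  have hw3 : wk ≠ w3 := by rintro rfl; exact h3q (List.mem_cons_of_mem _ hwkm)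
  have hh3 : h ≠ w3 := by rintro rfl; exact h3q (by simp)
  have hrh : ¬ N.Rel wk h := fun h' => h'.elim (N.tri hwx (N.Es hhx)) (N.q1 hwx (N.Es hhx))
  have hr3 : ¬ N.Rel wk w3 := fun h' => h'.elim (N.tri hwx hx3) (N.q1 hwx hx3)
  have ha := (altOf hT (R := {x, h, w3}) hwk (Or.inl rfl) hwx
    (by
      rintro b (rfl | rfl | rfl)
      · exact N.dis hwx
      · exact fun h => hrh (Or.inr h)
      · exact fun h => hr3 (Or.inr h)) l u hc.2 hl).1 hu
  have hhl := (List.nodup_cons.1 hnd).1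
  obtain ⟨φ, X, hf, hX⟩ := start {x, h, w3} wk u l ha (List.nodup_cons.1 hnd).2
    (by
      intro b hb
      rintro (rfl | rfl | rfl)
      · exact hxq (List.mem_cons_of_mem _ hb)
      · exact hhl hb
      · exact h3q (List.mem_cons_of_mem _ hb))
    (Or.inr ⟨hT.t0 _ hu, h, N.Es hc.1.1, fun h => h.2 (by simp), fun h' => hhl
      (List.mem_cons_of_mem _ (List.mem_of_mem_head? h'.symm))⟩)
  refine endD hf hX hwh hw3 hh3 hwx (N.Es hhx) hx3 (hT.t0 _ hx) (hT.t1 _ hh) (hT.t1 _ h3) ?_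
  intro b hb
  by_cases hbx : b = x
  · exact Or.inr hbx
  · left
    rintro (rfl | rfl | rfl)
    · exact hbx rfl
    · exact hrh hb
    · exact hr3 hb

variable (N D0 D1) in
structure Good (S : Set P) (x0 x1 : P) (q : List P) : Prop where
  nd : (q ++ [x0]).Nodup
  mem : ∀ b ∈ q, b ∈ S
  ch : List.IsChain (Chn N D0 D1) q
  last : q.getLast? = some x1

lemma Good.nd' {S : Set P} {x0 x1 q} (hg : Good N D0 D1 S x0 x1 q) : q.Nodup ∧ x0 ∉ q := by
  have := hg.nd
  rw [List.nodup_append] at this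
  refine ⟨this.1, fun h => this.2.2 _ h x0 (by simp) rfl⟩

lemma Good.core {S : Set P} {x0 x1 h q x} (hT : Typ N D0 D1) (hx1 : D1 x1) (h10 : N.E x1 x0)
    (hg : Good N D0 D1 S x0 x1 (h :: q)) (hxS : x ∈ S) (hhx : N.E h x) (ho : Opp D0 D1 h x)
    (hx0 : x ≠ x0) (hp : (q ++ [x0]).head? ≠ some x) : Good N D0 D1 S x0 x1 (x :: h :: q) := by
  obtain ⟨hnd, hx0q⟩ := hg.nd'
  have hxh : x ≠ h := by rintro rfl; exact N.Ei _ hhx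
  have hxq : x ∉ q := by
    intro hxq
    obtain ⟨s, t, rfl⟩ := List.append_of_mem hxq
    rcases ho with ⟨hh, hx⟩ | ⟨hh, hx⟩
    · -- `h` in `D1`, `x` in `D0`
      have hch := hg.ch
      rw [← List.cons_append, List.isChain_append] at hch
      obtain ⟨hc1, hc2, hc3⟩ := hch
      have hs : s ≠ [] := by
        rintro rfl
        simp at hp
      have ht : t ≠ [] := by
        rintro rfl
        have := hg.last
        simp [List.getLast?_cons, List.getLast?_append] at this
        subst this
        exact hT.dj _ hx hx1
      obtain ⟨w3, t, rfl⟩ := List.exists_cons_of_ne_nil ht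
      have hx3 : Chn N D0 D1 x w3 := by
        rw [List.isChain_cons_cons] at hc2
        exact hc2.1
      obtain ⟨wk, hwk⟩ : ∃ wk, s.getLast? = some wk := ⟨s.getLast hs, List.getLast?_eq_some_getLast hs⟩
      have hwx : Chn N D0 D1 wk x := hc3 wk (by
        obtain ⟨b, s, rfl⟩ := List.exists_cons_of_ne_nil hs
        rw [List.getLast?_cons_cons]; exact hwk) x rfl
      have hwk1 : D1 wk := by
        rcases hwx.2 with h | h
        · exact h.1
        · exact (hT.dj _ hx h.2).elim
      have h31 : D1 w3 := by
        rcases hx3.2 with h | h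
        · exact (hT.dj _ hx h.1).elim
        · exact h.2
      rw [← List.cons_append, List.nodup_append] at hnd
      refine noDC hT hc1 hs hwk hwk1 hwx.1 hnd.1 ?_ ?_ hh hx h31 hhx hx3.1
      · exact fun hm => hnd.2.2 _ hm x (by simp) rfl
      · exact fun hm => hnd.2.2 _ hm w3 (by simp) rfl
    · -- `h` in `D0`, `x` in `D1`
      obtain ⟨b, t', ht'⟩ : ∃ b t', t ++ [x0] = b :: t' := by
        rcases t with _ | ⟨b, t⟩
        · exact ⟨_, _, rfl⟩
        · exact ⟨_, _, rfl⟩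
      have hQ : (h :: (s ++ x :: t)) ++ [x0] = h :: (s ++ x :: b :: t') := by
        simp [ht']
      have hndQ := hg.nd
      rw [hQ] at hndQ
      have hcQ : List.IsChain N.E (h :: (s ++ x :: b :: t')) := by
        rw [← hQ, List.isChain_append]
        refine ⟨hg.ch.imp fun a b h => h.1, by simp, ?_⟩
        intro y hy z hz
        rw [hg.last] at hy
        obtain rfl : x1 = y := by simpa using hy
        obtain rfl : x0 = z := by simpa using hz
        exact h10
      rcases List.eq_nil_or_concat s with rfl | ⟨s', a, rfl⟩
      · simp at hp
      · simp only [List.concat_eq_append, List.append_assoc, List.cons_append, List.nil_append]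
          at hcQ hndQ
        have hcc : List.IsChain N.E (a :: x :: b :: t') := by
          have h1 : List.IsChain N.E ((h :: s') ++ (a :: x :: b :: t')) := by simpa using hcQ
          exact (List.isChain_append.1 h1).2.1
        rw [List.isChain_cons_cons, List.isChain_cons_cons] at hcc
        have hn1 := (List.nodup_cons.1 hndQ).1
        have hab : a ≠ b := by
          rintro rfl
          have := (List.nodup_append.1 (List.nodup_cons.1 hndQ).2).2.1
          simp at this
        rcases (hT.t1 _ hx).e2 (N.Es hcc.1) hcc.2.1 hab (N.Es hhx) with rfl | rfl
        · exact hn1 (by simp)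
        · exact hn1 (by simp)
  refine ⟨?_, ?_, ?_, ?_⟩
  · rw [List.cons_append, List.nodup_cons]
    refine ⟨?_, hg.nd⟩
    simp [hxh, hxq, hx0]
  · intro b hb
    rcases List.mem_cons.1 hb with rfl | hb
    · exact hxS
    · exact hg.mem b hb
  · rw [List.isChain_cons_cons]
    exact ⟨⟨N.Es hhx, ho.symm.imp (fun h => ⟨h.2, h.1⟩) (fun h => ⟨h.2, h.1⟩)⟩, hg.ch⟩
  · rw [List.getLast?_cons_cons]; exact hg.last

lemma no_grow [Fintype P] {S : Set P} {x0 x1 : P} (h0 : x1 ∈ S) (hne : x1 ≠ x0)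
    (hgrow : ∀ h q, Good N D0 D1 S x0 x1 (h :: q) → ∃ x, Good N D0 D1 S x0 x1 (x :: h :: q)) :
    False := by
  have : ∀ n : ℕ, ∃ h q, Good N D0 D1 S x0 x1 (h :: q) ∧ n ≤ (h :: q).length := by
    intro n
    induction n with
    | zero => exact ⟨x1, [], ⟨by simpa using hne, by simpa using h0, by simp, rfl⟩, by simp⟩
    | succ n ih =>
      obtain ⟨h, q, hg, hn⟩ := ih
      obtain ⟨x, hx⟩ := hgrow h q hg
      exact ⟨x, _, hx, by simp at hn ⊢; omega⟩
  obtain ⟨h, q, hg, hn⟩ := this (Fintype.card P + 1)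
  have := hg.nd'.1.length_le_card
  omega
end Net
end P6

open SimpleGraph
namespace P6
set_option linter.unusedSectionVars false
set_option linter.unusedSimpArgs false
namespace Net
variable {P : Type*} {N : Net P} {D0 D1 : P → Prop}

open Classical in
noncomputable def mm (N : Net P) (D1 : P → Prop) (a b : P) : ℕ :=
  if N.E a b then (if D1 a then 1 else 0) + (if D1 b then 1 else 0) else 0

lemma mm_symm (a b : P) : mm N D1 a b = mm N D1 b a := by
  unfold mm
  by_cases h : N.E a b
  · rw [if_pos h, if_pos (N.Es h), add_comm]
  · rw [if_neg h, if_neg (fun h' => h (N.Es h'))]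

lemma mm_self (a : P) : mm N D1 a a = 0 := if_neg (N.Ei a)

lemma mm_pos {a b : P} (h : mm N D1 a b ≠ 0) : N.E a b ∧ (D1 a ∨ D1 b) := by
  unfold mm at h
  by_cases h1 : N.E a b
  · refine ⟨h1, ?_⟩
    by_contra h2
    push Not at h2
    simp [h2.1, h2.2] at h
  · simp [h1] at h

lemma mm_le_one {a b : P} (h : ¬ (D1 a ∧ D1 b)) : mm N D1 a b ≤ 1 := by
  unfold mm
  split_ifs <;> simp_all

lemma mm_le_two (a b : P) : mm N D1 a b ≤ 2 := by
  unfold mm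
  split_ifs <;> simp_all

open Classical in
lemma another {S : Finset P} {h p : P} (h2 : 2 ≤ ∑ b ∈ S, mm N D1 h b) (hp : mm N D1 h p ≤ 1) :
    ∃ x ∈ S, x ≠ p ∧ N.E h x ∧ (D1 h ∨ D1 x) := by
  by_contra hcon
  push Not at hcon
  have h0 : ∀ b ∈ S, b ≠ p → mm N D1 h b = 0 := by
    intro b hb hbp
    by_contra h0
    obtain ⟨h3, h4⟩ := mm_pos h0
    have := hcon b hb hbp h3
    tauto
  have : ∑ b ∈ S, mm N D1 h b ≤ 1 := by
    by_cases hpS : p ∈ S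
    · rw [Finset.sum_eq_single_of_mem p hpS h0]; exact hp
    · rw [Finset.sum_eq_zero (fun b hb => h0 b hb (by rintro rfl; exact hpS hb))]; simp
  omega

lemma Good.prev {S : Set P} {x0 x1 h q} (hT : Typ N D0 D1) (hg : Good N D0 D1 S x0 x1 (h :: q)) :
    (q = [] ∧ h = x1) ∨ ∃ p q', q = p :: q' ∧ Chn N D0 D1 h p := by
  rcases q with _ | ⟨p, q⟩
  · left; exact ⟨rfl, by simpa using hg.last⟩
  · right
    have := hg.ch
    rw [List.isChain_cons_cons] at this
    exact ⟨p, q, rfl, this.1⟩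

/-- generic growth: find a further neighbour of the head of the path -/
lemma Good.next {S : Finset P} {x0 x1 h q} (hT : Typ N D0 D1) (hg : Good N D0 D1 S x0 x1 (h :: q))
    (hS : ∀ a ∈ S, 2 ≤ ∑ b ∈ S, mm N D1 a b)
    (h1 : ∃ x ∈ S, x ≠ x0 ∧ N.E x1 x ∧ (D1 x1 ∨ D1 x)) :
    ∃ x ∈ S, (q ++ [x0]).head? ≠ some x ∧ N.E h x ∧ (D1 h ∨ D1 x) := by
  rcases hg.prev hT with ⟨rfl, rfl⟩ | ⟨p, q', rfl, hc⟩
  · obtain ⟨x, hx, h2, h3⟩ := h1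
    exact ⟨x, hx, by simpa using h2.symm, h3⟩
  · have hp : mm N D1 h p ≤ 1 := by
      apply mm_le_one
      rintro ⟨h1, h2⟩
      rcases hc.2 with h3 | h3
      · exact hT.dj _ h3.2 h2
      · exact hT.dj _ h3.1 h1
    obtain ⟨x, hx, h2, h3⟩ := another (hS h (hg.mem h (by simp))) hp
    exact ⟨x, hx, by simpa using h2.symm, h3⟩

lemma Good.head_eq {S : Set P} {x0 x1 h q x} (hT : Typ N D0 D1)
    (hg : Good N D0 D1 S x0 x1 (h :: q)) (hp : (q ++ [x0]).head? ≠ some x) (h0 : x = x0) :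
    ∃ p q', q = p :: q' ∧ Chn N D0 D1 h p := by
  rcases hg.prev hT with ⟨rfl, rfl⟩ | h
  · simp [h0] at hp
  · exact h

theorem no_dense [Fintype P] (hT : Typ N D0 D1) : ∀ S : Finset P, (∀ a ∈ S, D0 a ∨ D1 a) →
    ¬ (2 * S.card < ∑ a ∈ S, ∑ b ∈ S, mm N D1 a b) := by
  classical
  intro S
  induction S using Finset.strongInductionOn with
  | _ S ih =>
  intro hD hlt
  -- minimality: every weighted degree is at least two
  have hS : ∀ a ∈ S, 2 ≤ ∑ b ∈ S, mm N D1 a b := by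
    intro a ha
    by_contra hcon
    have h1 : ∑ b ∈ S, mm N D1 a b = ∑ b ∈ S.erase a, mm N D1 a b := by
      rw [← Finset.add_sum_erase S _ ha, mm_self, zero_add]
    have h2 : ∑ x ∈ S, ∑ b ∈ S, mm N D1 x b = ∑ b ∈ S, mm N D1 a b +
        ∑ x ∈ S.erase a, ∑ b ∈ S, mm N D1 x b := (Finset.add_sum_erase S _ ha).symm
    have h3 : ∑ x ∈ S.erase a, ∑ b ∈ S, mm N D1 x b = ∑ x ∈ S.erase a, mm N D1 a x +
        ∑ x ∈ S.erase a, ∑ b ∈ S.erase a, mm N D1 x b := by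
      rw [← Finset.sum_add_distrib]
      refine Finset.sum_congr rfl fun x _ => ?_
      rw [mm_symm a x]
      exact (Finset.add_sum_erase S _ ha).symm
    have h4 := Finset.card_erase_add_one ha
    exact ih _ (Finset.erase_ssubset ha) (fun b hb => hD b (Finset.mem_of_mem_erase hb)) (by omega)
  by_cases hi : ∃ x0 ∈ S, ∃ x1 ∈ S, D1 x0 ∧ D1 x1 ∧ N.E x1 x0 ∧ ∃ x ∈ S, x ≠ x0 ∧ N.E x1 x
  · obtain ⟨x0, hx0, x1, hx1, h0, h1, h10, x, hx, hxx0, h1x⟩ := hi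
    refine no_grow (N := N) (D0 := D0) (D1 := D1) (S := (S : Set P)) (x0 := x0) hx1
      (by rintro rfl; exact N.Ei _ h10) fun h q hg => ?_
    obtain ⟨y, hy, hp, hhy, ht⟩ := hg.next hT hS ⟨x, hx, hxx0, h1x, Or.inl h1⟩
    obtain ⟨hnd, hx0q⟩ := hg.nd'
    by_cases hL : D1 h ∧ D1 y
    · exfalso
      by_cases hy0 : y = x0
      · obtain ⟨p, q', rfl, hc⟩ := hg.head_eq hT hp hy0
        have hne : h ≠ x1 := by
          rintro rfl
          have := hg.last
          rw [List.getLast?_cons_cons] at this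
          exact (List.nodup_cons.1 hnd).1 (List.mem_of_mem_getLast? this)
        subst hy0
        exact noLLL hT hL.1 hL.2 h1 hhy (N.Es h10) hne
      · by_cases hyq : y ∈ h :: q
        · -- `y` is an interior `D1` vertex of the path
          have hyh : y ≠ h := by rintro rfl; exact N.Ei _ hhy
          obtain ⟨p, q', rfl, hc⟩ : ∃ p q', q = p :: q' ∧ Chn N D0 D1 h p := by
            rcases hg.prev hT with ⟨rfl, rfl⟩ | h
            · simp [hyh] at hyq
            · exact h
          -- the predecessor of `y` in the list
          obtain ⟨s, t, hst⟩ := List.append_of_mem hyq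
          rcases List.eq_nil_or_concat s with rfl | ⟨s', a, rfl⟩
          · simp at hst; exact hyh hst.1.symm
          have hch := hg.ch
          rw [hst, List.concat_eq_append, List.append_assoc, List.isChain_append] at hch
          have hay : Chn N D0 D1 a y := by
            have := hch.2.1
            rw [List.singleton_append, List.isChain_cons_cons] at this
            exact this.1
          have ha0 : D0 a := by
            rcases hay.2 with h | h
            · exact (hT.dj _ h.2 hL.2).elim
            · exact h.1
          rcases t with _ | ⟨b, t⟩
          · -- `y = x1`
            have := hg.last
            rw [hst] at this
            simp at this
            subst this
            have hax : a ≠ x0 := by rintro rfl; exact hT.dj _ ha0 h0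
            rcases (hT.t1 _ hL.2).e2 (N.Es hay.1) h10 hax (N.Es hhy) with rfl | rfl
            · exact hT.dj _ ha0 hL.1
            · exact hx0q (by simp)
          · have hyb : Chn N D0 D1 y b := by
              have := hch.2.1
              rw [List.singleton_append, List.isChain_cons_cons, List.isChain_cons_cons] at this
              exact this.2.1
            have hb0 : D0 b := by
              rcases hyb.2 with h | h
              · exact h.2
              · exact (hT.dj _ h.1 hL.2).elim
            have hab : a ≠ b := by
              rintro rfl
              rw [hst, List.concat_eq_append, List.append_assoc, List.nodup_append] at hnd
              have := hnd.2.1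
              simp at this
            rcases (hT.t1 _ hL.2).e2 (N.Es hay.1) hyb.1 hab (N.Es hhy) with rfl | rfl
            · exact hT.dj _ ha0 hL.1
            · exact hT.dj _ hb0 hL.1
        · exact noLL hT hg.ch hg.last h1 h0 h10 hnd hx0q hL.1 hL.2 (N.Es hhy) hy0 hyq
    · have ho : Opp D0 D1 h y := by
        rcases hD h (hg.mem h (by simp)) with h2 | h2
        · exact Or.inr ⟨h2, ht.resolve_left (hT.dj _ h2)⟩
        · exact Or.inl ⟨h2, (hD y hy).resolve_right fun h3 => hL ⟨h2, h3⟩⟩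
      by_cases hy0 : y = x0
      · exfalso
        subst hy0
        rcases ho with ho | ho
        · exact hT.dj _ ho.2 h0
        · exact noLC hT hg.ch hg.last h1 h0 h10 hnd hx0q ho.1 hhy
      · exact ⟨y, hg.core hT h1 h10 hy hhy ho hy0 hp⟩
  · push Not at hi
    obtain ⟨a, ha, ha3⟩ : ∃ a ∈ S, 3 ≤ ∑ b ∈ S, mm N D1 a b := by
      by_contra hcon
      push Not at hcon
      have : ∑ a ∈ S, ∑ b ∈ S, mm N D1 a b ≤ S.card • 2 :=
        Finset.sum_le_card_nsmul _ _ _ fun a ha => by have := hcon a ha; omega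
      simp at this
      omega
    have haD : D0 a := by
      refine (hD a ha).resolve_right fun h1 => ?_
      by_cases hb : ∃ b ∈ S, D1 b ∧ N.E a b
      · obtain ⟨b, hb, hb1, hab⟩ := hb
        have : ∑ x ∈ S, mm N D1 a x = mm N D1 a b := by
          refine Finset.sum_eq_single_of_mem b hb fun x hx hxb => ?_
          by_contra h0
          exact hi b hb a ha hb1 h1 hab x hx hxb (mm_pos h0).1
        have := mm_le_two (N := N) (D1 := D1) a b
        omega
      · push Not at hb
        obtain ⟨⟨x, y, hxy⟩, -⟩ := hT.t1 a h1
        have h2 : ∑ b ∈ S, mm N D1 a b ≤ ∑ b ∈ S, if b ∈ ({x, y} : Finset P) then 1 else 0 := by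
          refine Finset.sum_le_sum fun b hbS => ?_
          by_cases he : N.E a b
          · have hb1 : ¬ D1 b := fun h => hb b hbS h he
            have := hxy b he
            rw [if_pos (by simpa using this)]
            exact mm_le_one fun h => hb1 h.2
          · have : mm N D1 a b = 0 := if_neg he
            omega
        rw [← Finset.sum_filter, Finset.sum_const, smul_eq_mul, mul_one] at h2
        have h3 : (S.filter (· ∈ ({x, y} : Finset P))).card ≤ ({x, y} : Finset P).card :=
          Finset.card_le_card fun z hz => (Finset.mem_filter.1 hz).2
        have h4 : ({x, y} : Finset P).card ≤ 2 := Finset.card_le_two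
        omega
    have hnb : 2 < (S.filter fun b => N.E a b ∧ D1 b).card := by
      have : ∑ b ∈ S, mm N D1 a b = (S.filter fun b => N.E a b ∧ D1 b).card := by
        rw [Finset.card_filter]
        refine Finset.sum_congr rfl fun b _ => ?_
        have : ¬ D1 a := hT.dj _ haD
        unfold mm
        by_cases h1 : N.E a b <;> by_cases h2 : D1 b <;> simp [h1, h2, this]
      omega
    have hnl : ∀ x ∈ S, D1 x → N.E a x → ∀ y ∈ S, N.E x y → ¬ D1 y := by
      intro x hx h1 hax y hy hxy hy1
      exact hi y hy x hx hy1 h1 hxy a ha (by rintro rfl; exact hT.dj _ haD hy1) (N.Es hax)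
    obtain ⟨x1, hx1⟩ := Finset.card_pos.1 (lt_of_le_of_lt (Nat.zero_le _) hnb)
    obtain ⟨hx1S, hax1, h1⟩ := Finset.mem_filter.1 hx1
    have hne : x1 ≠ a := by rintro rfl; exact N.Ei _ hax1
    refine no_grow (N := N) (D0 := D0) (D1 := D1) (S := (S : Set P)) (x0 := a) hx1S hne
      fun h q hg => ?_
    have hst : ∃ x ∈ S, x ≠ a ∧ N.E x1 x ∧ (D1 x1 ∨ D1 x) := by
      apply another (hS x1 hx1S)
      exact mm_le_one fun h => hT.dj _ haD h.2
    obtain ⟨y, hy, hp, hhy, ht⟩ := hg.next hT hS hst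
    obtain ⟨hnd, hx0q⟩ := hg.nd'
    have hhS : h ∈ S := hg.mem h (by simp)
    have hL : ¬ (D1 h ∧ D1 y) := by
      rintro ⟨hh1, hy1⟩
      rcases hg.prev hT with ⟨rfl, rfl⟩ | ⟨p, q', rfl, hc⟩
      · exact hnl h hhS h1 hax1 y hy hhy hy1
      · have hpy : p ≠ y := fun h => hp (by simp [h])
        exact hi y hy h hhS hy1 hh1 hhy p (hg.mem p (by simp)) hpy hc.1
    have ho : Opp D0 D1 h y := by
      rcases hD h hhS with h2 | h2
      · exact Or.inr ⟨h2, ht.resolve_left (hT.dj _ h2)⟩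
      · exact Or.inl ⟨h2, (hD y hy).resolve_right fun h3 => hL ⟨h2, h3⟩⟩
    by_cases hy0 : y = a
    · exfalso
      obtain ⟨p, q', rfl, hc⟩ := hg.head_eq hT hp hy0
      subst hy0
      have hh1 : D1 h := by
        rcases ho with ho | ho
        · exact ho.1
        · exact (hT.dj _ haD ho.2).elim
      -- third neighbour
      have hhx1 : h ≠ x1 := by
        rintro rfl
        have := hg.last
        rw [List.getLast?_cons_cons] at this
        exact (List.nodup_cons.1 hnd).1 (List.mem_of_mem_getLast? this)
      obtain ⟨w3, hw3, hw3n⟩ : ∃ w3 ∈ S.filter (fun b => N.E y b ∧ D1 b), w3 ∉ ({h, x1} : Finset P) := by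
        by_contra hcon
        push Not at hcon
        have h3 := Finset.card_le_card hcon
        have h4 : ({h, x1} : Finset P).card ≤ 2 := Finset.card_le_two
        omega
      obtain ⟨hw3S, hyw3, hw31⟩ := Finset.mem_filter.1 hw3
      simp only [Finset.mem_insert, Finset.mem_singleton, not_or] at hw3n
      have hl : (p :: q').getLast? = some x1 := by
        have := hg.last
        rwa [List.getLast?_cons_cons] at this
      have hw3q : w3 ∉ h :: p :: q' := by
        intro hm
        -- both neighbours of `w3` lie on the path
        obtain ⟨s, t, hst'⟩ := List.append_of_mem hm
        rcases List.eq_nil_or_concat s with rfl | ⟨s', c, rfl⟩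
        · simp at hst'; exact hw3n.1 hst'.1.symm
        have hch := hg.ch
        rw [hst', List.concat_eq_append, List.append_assoc, List.isChain_append] at hch
        rcases t with _ | ⟨b, t⟩
        · have := hg.last
          rw [hst'] at this
          simp at this
          exact hw3n.2 this
        · have h5 := hch.2.1
          rw [List.singleton_append, List.isChain_cons_cons, List.isChain_cons_cons] at h5
          have hcb : c ≠ b := by
            rintro rfl
            rw [hst', List.concat_eq_append, List.append_assoc, List.nodup_append] at hnd
            have := hnd.2.1
            simp at this
          rcases (hT.t1 _ hw31).e2 (N.Es h5.1.1) h5.2.1.1 hcb (N.Es hyw3) with h6 | h6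
          · exact hx0q (by rw [hst', h6]; simp)
          · exact hx0q (by rw [hst', h6]; simp)
      exact noDC hT hg.ch (by simp) hl h1 (N.Es hax1) hnd hx0q hw3q hh1 haD hw31 hhy hyw3
    · exact ⟨y, hg.core hT h1 (N.Es hax1) hy hhy ho hy0 hp⟩
end Net
end P6

open SimpleGraph
namespace P6
set_option linter.unusedSectionVars false
set_option linter.unusedSimpArgs false

variable {V : Type*} [Fintype V]

open Classical in
/-- degree -/
noncomputable def dg (H : SimpleGraph V) (v : V) : ℕ := (Finset.univ.filter fun u => H.Adj v u).card

structure Crit (H : SimpleGraph V) (g : V → V → Bool) (T : Set V) : Prop where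
  gs : ∀ a b, g a b = g b a
  out : ∀ a b, H.Adj a b → a ∈ T
  nc : ∀ ψ : V → Col, ¬ ∀ a b, H.Adj a b → comp (g a b) (ψ a) (ψ b) = true
  cr : ∀ v ∈ T, ∃ ψ : V → Col, ∀ a b, a ≠ v → b ≠ v → H.Adj a b →
    comp (g a b) (ψ a) (ψ b) = true
  tri : ∀ {a b c}, H.Adj a b → H.Adj b c → ¬ H.Adj a c
  sq : ∀ {a b c d}, H.Adj a b → H.Adj b c → H.Adj c d → H.Adj d a → a ≠ c → b = d

namespace Crit
variable {H : SimpleGraph V} {g : V → V → Bool} {T : Set V}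

lemma comp_sw (h : Crit H g T) {a b c d} (h1 : comp (g a b) c d = true) :
    comp (g b a) d c = true := by
  rw [comp_symm, h.gs]; exact h1

lemma two_le (h : Crit H g T) {v} (hv : v ∈ T) : 2 ≤ dg H v := by
  classical
  by_contra hlt
  have h1 : (Finset.univ.filter fun u => H.Adj v u).card ≤ 1 := by
    unfold dg at hlt
    convert (by omega : (Finset.univ.filter fun u => H.Adj v u).card ≤ 1)
  rw [Finset.card_le_one] at h1
  obtain ⟨ψ, hψ⟩ := h.cr v hv
  have key : ∃ d, ∀ x, H.Adj v x → comp (g v x) d (ψ x) = true := by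
    by_cases hx : ∃ x, H.Adj v x
    · obtain ⟨x, hx⟩ := hx
      obtain ⟨d, hd, -⟩ := fact8 (ψ x) (g v x) (0, false) (0, false)
      refine ⟨d, fun y hy => ?_⟩
      obtain rfl := h1 x (by simpa using hx) y (by simpa using hy)
      rw [comp_symm]; exact hd
    · push Not at hx
      exact ⟨(0, false, false), fun x h => absurd h (hx x)⟩
  obtain ⟨d, hd⟩ := key
  refine h.nc (Function.update ψ v d) fun a b hab => ?_
  by_cases ha : a = v
  · subst ha
    rw [Function.update_self, Function.update_of_ne hab.ne']
    exact hd b hab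
  · by_cases hb : b = v
    · subst hb
      rw [Function.update_self, Function.update_of_ne ha]
      exact h.comp_sw (hd a hab.symm)
    · rw [Function.update_of_ne ha, Function.update_of_ne hb]
      exact hψ a b ha hb hab

lemma nbrs2 {t a b} (ht : dg H t = 2) (ha : H.Adj t a) (hb : H.Adj t b) (hab : a ≠ b) {x}
    (hx : H.Adj t x) : x = a ∨ x = b := by
  classical
  by_contra hcon
  push Not at hcon
  have h1 : ({a, b, x} : Finset V) ⊆ Finset.univ.filter fun u => H.Adj t u := by
    intro y hy
    simp only [Finset.mem_insert, Finset.mem_singleton] at hy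
    rcases hy with rfl | rfl | rfl <;> simpa
  have h2 := Finset.card_le_card h1
  rw [Finset.card_eq_three.2 ⟨a, b, x, hab, hcon.1.symm, hcon.2.symm, rfl⟩] at h2
  unfold dg at ht
  have : (Finset.univ.filter fun u => H.Adj t u).card = 2 := by convert ht
  omega

lemma ex2 {t} (ht : dg H t = 2) : ∃ a b, a ≠ b ∧ H.Adj t a ∧ H.Adj t b := by
  classical
  unfold dg at ht
  obtain ⟨a, b, hab, h⟩ := Finset.card_eq_two.1 ht
  have ha : a ∈ Finset.univ.filter fun u => H.Adj t u := by
    have : a ∈ ({a, b} : Finset V) := by simp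
    rw [← h] at this; simpa using this
  have hb : b ∈ Finset.univ.filter fun u => H.Adj t u := by
    have : b ∈ ({a, b} : Finset V) := by simp
    rw [← h] at this; simpa using this
  exact ⟨a, b, hab, by simpa using ha, by simpa using hb⟩

lemma other {t x} (ht : dg H t = 2) (hx : H.Adj t x) : ∃ y, y ≠ x ∧ H.Adj t y := by
  obtain ⟨a, b, hab, ha, hb⟩ := ex2 ht
  by_cases h : a = x
  · exact ⟨b, fun h' => hab (h.trans h'.symm), hb⟩
  · exact ⟨a, h, ha⟩

lemma no22 (h : Crit H g T) {t t'} (ht : dg H t = 2) (ht' : dg H t' = 2) : ¬ H.Adj t t' := by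
  classical
  intro htt
  obtain ⟨x, hxt', hx⟩ := other ht htt
  obtain ⟨y, hyt, hy⟩ := other ht' htt.symm
  have hxy : x ≠ y := by rintro rfl; exact h.tri htt hy hx
  obtain ⟨ψ, hψ⟩ := h.cr t (h.out _ _ htt)
  obtain ⟨τ, hτ⟩ := fact1 (g x t) (g t t') (ψ x)
  obtain ⟨e', he', hp, -⟩ := fact8 (ψ y) (g y t') τ τ
  obtain ⟨e, he1, he2⟩ := hτ e' hp
  have key : ∀ a b, H.Adj a b → a = t ∨ (a = t' ∧ b ≠ t) →
      comp (g a b) (Function.update (Function.update ψ t' e') t e a)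
        (Function.update (Function.update ψ t' e') t e b) = true := by
    rintro a b hab (rfl | ⟨rfl, hb⟩)
    · rw [Function.update_self, Function.update_of_ne hab.ne']
      rcases nbrs2 ht hx htt hxt' hab with rfl | rfl
      · rw [Function.update_of_ne hxt']
        exact h.comp_sw he1
      · rw [Function.update_self]; exact he2
    · rw [Function.update_of_ne htt.ne', Function.update_of_ne hb, Function.update_self,
        Function.update_of_ne hab.ne']
      rcases nbrs2 ht' hy htt.symm hyt hab with rfl | rfl
      · exact h.comp_sw he'
      · exact absurd rfl hb
  refine h.nc (Function.update (Function.update ψ t' e') t e) fun a b hab => ?_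
  by_cases ha : a = t
  · exact key a b hab (Or.inl ha)
  by_cases hb : b = t
  · exact h.comp_sw (key b a hab.symm (Or.inl hb))
  by_cases ha' : a = t'
  · exact key a b hab (Or.inr ⟨ha', hb⟩)
  by_cases hb' : b = t'
  · exact h.comp_sw (key b a hab.symm (Or.inr ⟨hb', ha⟩))
  · rw [Function.update_of_ne ha, Function.update_of_ne ha', Function.update_of_ne hb,
      Function.update_of_ne hb']
    exact hψ a b ha hb hab

lemma three_of_adj2 (h : Crit H g T) {t a} (ht : dg H t = 2) (ha : H.Adj t a) : 3 ≤ dg H a := by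
  have h1 := h.two_le (h.out _ _ ha.symm)
  have h2 : dg H a ≠ 2 := fun h' => h.no22 ht h' ha
  omega

/-- `t` is a vertex of degree two joining `a` and `b` -/
def Via (H : SimpleGraph V) (a b t : V) : Prop := a ≠ b ∧ dg H t = 2 ∧ H.Adj a t ∧ H.Adj t b

def toNet (h : Crit H g T) : Net V where
  E a b := H.Adj a b ∧ 3 ≤ dg H a ∧ 3 ≤ dg H b
  F a b := ∃ t, Via H a b t
  Con a b c d := (H.Adj a b → 3 ≤ dg H a → 3 ≤ dg H b → comp (g a b) c d = true) ∧
    ∀ t, Via H a b t → ∃ e, comp (g a t) c e = true ∧ comp (g t b) e d = true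
  Es := fun ⟨h1, h2, h3⟩ => ⟨h1.symm, h3, h2⟩
  Fs := fun ⟨t, h1, h2, h3, h4⟩ => ⟨t, h1.symm, h2, h4.symm, h3.symm⟩
  Cs := by
    rintro a b c d ⟨h1, h2⟩
    refine ⟨fun h3 h4 h5 => h.comp_sw (h1 h3.symm h5 h4), ?_⟩
    rintro t ⟨h3, h4, h5, h6⟩
    obtain ⟨e, he1, he2⟩ := h2 t ⟨h3.symm, h4, h6.symm, h5.symm⟩
    exact ⟨e, h.comp_sw he2, h.comp_sw he1⟩
  hE := by
    rintro a b ⟨h1, h2, h3⟩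
    refine ⟨g a b, fun c d => ⟨fun h4 => h4.1 h1 h2 h3, fun h4 => ⟨fun _ _ _ => h4, ?_⟩⟩⟩
    rintro t ⟨-, -, h5, h6⟩
    exact absurd h1 (h.tri h5 h6)
  hF := by
    rintro a b ⟨t, h1, h2, h3, h4⟩ c
    obtain ⟨τ, hτ⟩ := fact1 (g a t) (g t b) c
    refine ⟨τ, fun d hd => ⟨fun h5 => absurd h5 (h.tri h3 h4), ?_⟩⟩
    rintro t' ⟨-, -, h5, h6⟩
    obtain rfl : t = t' := h.sq h3 h4 h6.symm h5.symm h1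
    exact hτ d hd
  hN := by
    intro a b h1 h2 c d
    exact ⟨fun h3 h4 h5 => absurd ⟨h3, h4, h5⟩ h1, fun t ht => absurd ⟨t, ht⟩ h2⟩
  Ei := fun a h => h.1.ne rfl
  Fi := fun a ⟨t, h⟩ => h.1 rfl
  dis := by
    rintro a b ⟨h1, -, -⟩ ⟨t, -, -, h2, h3⟩
    exact h.tri h2 h3 h1
  tri := fun h1 h2 h3 => h.tri h1.1 h2.1 h3.1
  q1 := by
    rintro a b c ⟨h1, -, h2⟩ ⟨h3, -, -⟩ ⟨t, h4, h5, h6, h7⟩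
    have := h.sq h1 h3 h7.symm h6.symm h4
    subst this
    omega
  nv := by
    classical
    intro ψ hψ
    have key : ∀ t, ∃ e, dg H t = 2 → ∀ a, H.Adj a t → comp (g a t) (ψ a) e = true := by
      intro t
      by_cases ht : dg H t = 2
      · obtain ⟨a, b, hab, ha, hb⟩ := ex2 ht
        obtain ⟨e, he1, he2⟩ := (hψ a b).2 t ⟨hab, ht, ha.symm, hb⟩
        refine ⟨e, fun _ x hx => ?_⟩
        rcases nbrs2 ht ha hb hab hx.symm with rfl | rfl
        · exact he1
        · exact h.comp_sw he2
      · exact ⟨(0, false, false), fun h => absurd h ht⟩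
    choose e he using key
    refine h.nc (fun v => if dg H v = 2 then e v else ψ v) fun a b hab => ?_
    have h1 := h.two_le (h.out _ _ hab)
    have h2 := h.two_le (h.out _ _ hab.symm)
    by_cases ha : dg H a = 2
    · have hb : dg H b ≠ 2 := fun hb => h.no22 ha hb hab
      simp only [if_pos ha, if_neg hb]
      exact h.comp_sw (he a ha b hab.symm)
    · by_cases hb : dg H b = 2
      · simp only [if_neg ha, if_pos hb]
        exact he b hb a hab
      · simp only [if_neg ha, if_neg hb]
        exact (hψ a b).1 hab (by omega) (by omega)
  base := by
    intro S u w huS hr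
    have hu : 3 ≤ dg H u := by
      rcases hr with hr | ⟨t, h1, h2, h3, h4⟩
      · exact hr.2.1
      · exact h.three_of_adj2 h2 h3.symm
    have huT : u ∈ T := by
      rcases hr with hr | ⟨t, h1, h2, h3, h4⟩
      · exact h.out _ _ hr.1
      · exact h.out _ _ h3
    obtain ⟨ψ, hψ⟩ := h.cr u huT
    refine ⟨ψ, fun a ha b hb => ?_⟩
    have hau : a ≠ u := by rintro rfl; exact ha huS
    have hbu : b ≠ u := by rintro rfl; exact hb huS
    refine ⟨fun h1 _ _ => hψ a b hau hbu h1, ?_⟩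
    rintro t ⟨-, h2, h3, h4⟩
    have htu : t ≠ u := by rintro rfl; omega
    exact ⟨ψ t, hψ a t hau htu h3, hψ t b htu hbu h4⟩
end Crit
end P6

open SimpleGraph
namespace P6
set_option linter.unusedSectionVars false
set_option linter.unusedSimpArgs false

namespace Net
variable {P : Type*} {N : Net P}

lemma tauF (φ : P → Col) (v f : P) :
    ∃ τ, ∀ d, pr d ≠ τ → N.F f v → N.Con f v (φ f) d := by
  by_cases h : N.F f v
  · obtain ⟨τ, hτ⟩ := N.hF h (φ f)
    exact ⟨τ, fun d hd _ => hτ d hd⟩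
  · exact ⟨(0, false), fun d _ h' => absurd h' h⟩

lemma red0 {v w} (hr : N.Rel v w)
    (h : ∀ φ : P → Col, ∃ d, ∀ b, N.Rel b v → N.Con b v (φ b) d) : False := by
  obtain ⟨φ, hφ⟩ := N.base {v} v w rfl hr
  obtain ⟨d, hd⟩ := h φ
  have hv : N.Valid {v}ᶜ φ := fun a ha b hb => hφ a ha b hb
  classical
  have := extend (w := v) (d := d) hv (by simp) (fun a _ hr => hd a hr)
  rw [show insert v ({v}ᶜ : Set P) = Set.univ by ext; simp [em]] at this
  exact not_valid_univ this

lemma red1 {v w x f1 f2} (hr : N.Rel v w) (hE : ∀ b, N.E v b → b = x)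
    (hF : ∀ b, N.F v b → b = f1 ∨ b = f2) : False := by
  refine red0 hr fun φ => ?_
  obtain ⟨τ1, h1⟩ := tauF (N := N) φ v f1
  obtain ⟨τ2, h2⟩ := tauF (N := N) φ v f2
  have key : ∃ d, pr d ≠ τ1 ∧ pr d ≠ τ2 ∧ (N.E x v → N.Con x v (φ x) d) := by
    by_cases hx : N.E x v
    · obtain ⟨g, hg⟩ := N.hE hx
      obtain ⟨d, hd, h3, h4⟩ := fact8 (φ x) g τ1 τ2
      exact ⟨d, h3, h4, fun _ => (hg _ _).2 hd⟩
    · obtain ⟨d, hd, h3, h4⟩ := fact8 (φ x) true τ1 τ2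
      exact ⟨d, h3, h4, fun h => absurd h hx⟩
  obtain ⟨d, h3, h4, h5⟩ := key
  refine ⟨d, ?_⟩
  rintro b (hb | hb)
  · obtain rfl := hE b (N.Es hb)
    exact h5 hb
  · rcases hF b (N.Fs hb) with rfl | rfl
    · exact h1 d h3 hb
    · exact h2 d h4 hb

lemma red2 {v w f1 f2 f3 f4} (hr : N.Rel v w) (hE : ∀ b, ¬ N.E v b)
    (hF : ∀ b, N.F v b → b = f1 ∨ b = f2 ∨ b = f3 ∨ b = f4) : False := by
  refine red0 hr fun φ => ?_
  obtain ⟨τ1, h1⟩ := tauF (N := N) φ v f1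
  obtain ⟨τ2, h2⟩ := tauF (N := N) φ v f2
  obtain ⟨τ3, h3⟩ := tauF (N := N) φ v f3
  obtain ⟨τ4, h4⟩ := tauF (N := N) φ v f4
  obtain ⟨d, d1, d2, d3, d4, -⟩ := fact9 τ1 τ2 τ3 τ4 τ4
  refine ⟨d, ?_⟩
  rintro b (hb | hb)
  · exact absurd (N.Es hb) (hE b)
  · rcases hF b (N.Fs hb) with rfl | rfl | rfl | rfl
    · exact h1 d d1 hb
    · exact h2 d d2 hb
    · exact h3 d d3 hb
    · exact h4 d d4 hb

lemma red3 {a w f1 f2 f3} (haw : N.E a w) (hw : N.T1 w) (hE : ∀ b, N.E a b → b = w)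
    (hF : ∀ b, N.F a b → b = f1 ∨ b = f2 ∨ b = f3) : False := by
  obtain ⟨φ, hφ⟩ := N.base {a, w} a w (by simp) (Or.inl haw)
  have hv : N.Valid {a, w}ᶜ φ := fun a ha b hb => hφ a ha b hb
  have hne : a ≠ w := by rintro rfl; exact N.Ei _ haw
  obtain ⟨τ1, h1⟩ := tauF (N := N) φ a f1
  obtain ⟨τ2, h2⟩ := tauF (N := N) φ a f2
  obtain ⟨τ3, h3⟩ := tauF (N := N) φ a f3
  obtain ⟨σ1, σ2, hσ⟩ := arm (φ := φ) haw hw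
  obtain ⟨d, d1, d2, d3, d4, d5⟩ := fact9 τ1 τ2 τ3 σ1 σ2
  obtain ⟨e, he1, he2⟩ := hσ d d4 d5
  classical
  have e1 := extend (w := a) (d := d) hv (by simp) (by
    rintro b hb (hr | hr)
    · obtain rfl := hE b (N.Es hr)
      exact absurd hb (by simp)
    · rcases hF b (N.Fs hr) with rfl | rfl | rfl
      · exact h1 d d1 hr
      · exact h2 d d2 hr
      · exact h3 d d3 hr)
  have e2 := extend (w := w) (d := e) e1 (by simp [hne.symm]) (by
    rintro b (rfl | hb) hr
    · rw [Function.update_self]; exact he1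
    · have hba : b ≠ a := by rintro rfl; exact absurd hb (by simp)
      rw [Function.update_of_ne hba]
      exact he2 b hba hr)
  have hu : insert w (insert a ({a, w}ᶜ : Set P)) = Set.univ := by
    ext b; simp; tauto
  rw [hu] at e2
  exact not_valid_univ e2
end Net

section cover
variable {V : Type*} [DecidableEq V]
lemma cov_succ (v : V) (s : Finset V) {n : ℕ} (h : s.card ≤ n + 1) : ∃ a, (s.erase a).card ≤ n := by
  rcases s.eq_empty_or_nonempty with rfl | ⟨a, ha⟩
  · exact ⟨v, by simp⟩
  · exact ⟨a, by rw [Finset.card_erase_of_mem ha]; omega⟩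

lemma cov1 (v : V) (s : Finset V) (h : s.card ≤ 1) : ∃ a, ∀ x ∈ s, x = a := by
  obtain ⟨a, ha⟩ := cov_succ v s (n := 0) h
  have : s.erase a = ∅ := by simpa using ha
  refine ⟨a, fun x hx => ?_⟩
  by_contra hxa
  have : x ∈ s.erase a := Finset.mem_erase.2 ⟨hxa, hx⟩
  simp_all

lemma cov2 (v : V) (s : Finset V) (h : s.card ≤ 2) : ∃ a b, ∀ x ∈ s, x = a ∨ x = b := by
  obtain ⟨a, ha⟩ := cov_succ v s (n := 1) h
  obtain ⟨b, hb⟩ := cov1 v _ ha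
  refine ⟨a, b, fun x hx => ?_⟩
  by_cases hxa : x = a
  · exact Or.inl hxa
  · exact Or.inr (hb x (Finset.mem_erase.2 ⟨hxa, hx⟩))

lemma cov3 (v : V) (s : Finset V) (h : s.card ≤ 3) : ∃ a b c, ∀ x ∈ s, x = a ∨ x = b ∨ x = c := by
  obtain ⟨a, ha⟩ := cov_succ v s (n := 2) h
  obtain ⟨b, c, hb⟩ := cov2 v _ ha
  refine ⟨a, b, c, fun x hx => ?_⟩
  by_cases hxa : x = a
  · exact Or.inl hxa
  · exact Or.inr (hb x (Finset.mem_erase.2 ⟨hxa, hx⟩))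

lemma cov4 (v : V) (s : Finset V) (h : s.card ≤ 4) :
    ∃ a b c d, ∀ x ∈ s, x = a ∨ x = b ∨ x = c ∨ x = d := by
  obtain ⟨a, ha⟩ := cov_succ v s (n := 3) h
  obtain ⟨b, c, d, hb⟩ := cov3 v _ ha
  refine ⟨a, b, c, d, fun x hx => ?_⟩
  by_cases hxa : x = a
  · exact Or.inl hxa
  · exact Or.inr (hb x (Finset.mem_erase.2 ⟨hxa, hx⟩))
end cover

variable {V : Type*} [Fintype V]
namespace Crit
variable {H : SimpleGraph V} {g : V → V → Bool} {T : Set V}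

open Classical in
noncomputable def N2 (H : SimpleGraph V) (v : V) : Finset V :=
  Finset.univ.filter fun u => H.Adj v u ∧ dg H u = 2
open Classical in
noncomputable def N3 (H : SimpleGraph V) (v : V) : Finset V :=
  Finset.univ.filter fun u => H.Adj v u ∧ 3 ≤ dg H u

def D1 (H : SimpleGraph V) (v : V) : Prop := dg H v = 3 ∧ (N2 H v).card = 1
def D0 (H : SimpleGraph V) (v : V) : Prop := dg H v = 3 ∧ (N2 H v).card = 0

lemma mem_N2 {v u} : u ∈ N2 H v ↔ H.Adj v u ∧ dg H u = 2 := by simp [N2]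
lemma mem_N3 {v u} : u ∈ N3 H v ↔ H.Adj v u ∧ 3 ≤ dg H u := by simp [N3]

lemma dg_eq (h : Crit H g T) (v : V) : dg H v = (N2 H v).card + (N3 H v).card := by
  classical
  rw [← Finset.card_union_of_disjoint]
  · unfold dg
    congr 1
    ext u
    simp only [Finset.mem_filter, Finset.mem_univ, true_and, Finset.mem_union, mem_N2, mem_N3]
    constructor
    · intro hu
      have := h.two_le (h.out _ _ hu.symm)
      by_cases h2 : dg H u = 2
      · exact Or.inl ⟨hu, h2⟩
      · exact Or.inr ⟨hu, by omega⟩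
    · rintro (h | h) <;> exact h.1
  · rw [Finset.disjoint_left]
    intro u hu hu'
    rw [mem_N2] at hu
    rw [mem_N3] at hu'
    omega

lemma mem_N3_of_E (h : Crit H g T) {v b} (hb : h.toNet.E v b) : b ∈ N3 H v :=
  mem_N3.2 ⟨hb.1, hb.2.2⟩

lemma exists_oth (h : Crit H g T) (v : V) : ∃ o : V → V, ∀ b, h.toNet.F v b →
    ∃ t ∈ N2 H v, b = o t := by
  classical
  refine ⟨fun t => if ht : ∃ b, Via H v b t then ht.choose else v, ?_⟩
  rintro b ⟨t, hv⟩
  refine ⟨t, mem_N2.2 ⟨hv.2.2.1, hv.2.1⟩, ?_⟩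
  have ht : ∃ b, Via H v b t := ⟨b, hv⟩
  show b = dite _ _ _
  rw [dif_pos ht]
  have h2 := ht.choose_spec
  exact (nbrs2 hv.2.1 hv.2.2.1.symm h2.2.2.2 h2.1 hv.2.2.2).resolve_left hv.1.symm

lemma F_of_N2 (h : Crit H g T) {v t} (ht : t ∈ N2 H v) : ∃ b, h.toNet.F v b := by
  rw [mem_N2] at ht
  obtain ⟨y, hy, hty⟩ := other ht.2 ht.1.symm
  exact ⟨y, t, hy.symm, ht.2, ht.1, hty⟩

lemma typ (h : Crit H g T) : h.toNet.Typ (D0 H) (D1 H) := by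
  classical
  refine ⟨?_, ?_, ?_⟩
  · rintro v ⟨h1, h2⟩
    have h3 := h.dg_eq v
    obtain ⟨x, y, hxy⟩ := cov2 v (N3 H v) (by omega)
    obtain ⟨t, ht⟩ := cov1 v (N2 H v) (by omega)
    obtain ⟨o, ho⟩ := h.exists_oth v
    refine ⟨⟨x, y, fun b hb => hxy b (h.mem_N3_of_E hb)⟩, o t, fun b hb => ?_⟩
    obtain ⟨t', ht', rfl⟩ := ho b hb
    rw [ht t' ht']
  · rintro v ⟨h1, h2⟩
    have h3 := h.dg_eq v
    obtain ⟨x, y, z, hxy⟩ := cov3 v (N3 H v) (by omega)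
    obtain ⟨o, ho⟩ := h.exists_oth v
    refine ⟨⟨x, y, z, fun b hb => hxy b (h.mem_N3_of_E hb)⟩, fun b hb => ?_⟩
    obtain ⟨t', ht', rfl⟩ := ho b hb
    rw [Finset.card_eq_zero.1 h2] at ht'
    simp at ht'
  · rintro v ⟨_, h1⟩ ⟨_, h2⟩
    omega

lemma p3 (h : Crit H g T) {v} (hv : dg H v = 3) : (N2 H v).card ≤ 1 := by
  classical
  by_contra hcon
  have h3 := h.dg_eq v
  obtain ⟨t, ht⟩ : (N2 H v).Nonempty := Finset.card_pos.1 (by omega)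
  obtain ⟨b, hb⟩ := h.F_of_N2 ht
  obtain ⟨o, ho⟩ := h.exists_oth v
  by_cases h2 : (N2 H v).card = 2
  · obtain ⟨x, hx⟩ := cov1 v (N3 H v) (by omega)
    obtain ⟨t1, t2, ht12⟩ := cov2 v (N2 H v) (by omega)
    refine Net.red1 (N := h.toNet) (Or.inr hb) (fun b hb => hx b (h.mem_N3_of_E hb))
      (f1 := o t1) (f2 := o t2) fun b hb => ?_
    obtain ⟨t', ht', rfl⟩ := ho b hb
    exact (ht12 t' ht').imp (congrArg o) (congrArg o)
  · obtain ⟨t1, t2, t3, ht12⟩ := cov3 v (N2 H v) (by omega)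
    refine Net.red2 (N := h.toNet) (Or.inr hb) (fun b hb => ?_)
      (f1 := o t1) (f2 := o t2) (f3 := o t3) (f4 := o t3) fun b hb => ?_
    · have := h.mem_N3_of_E hb
      have := Finset.card_pos.2 ⟨b, this⟩
      omega
    · obtain ⟨t', ht', rfl⟩ := ho b hb
      rcases ht12 t' ht' with rfl | rfl | rfl <;> simp

lemma p4 (h : Crit H g T) {v} (hv : dg H v = 4) : (N2 H v).card ≤ 3 := by
  classical
  by_contra hcon
  have h3 := h.dg_eq v
  obtain ⟨t, ht⟩ : (N2 H v).Nonempty := Finset.card_pos.1 (by omega)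
  obtain ⟨b, hb⟩ := h.F_of_N2 ht
  obtain ⟨o, ho⟩ := h.exists_oth v
  obtain ⟨t1, t2, t3, t4, ht12⟩ := cov4 v (N2 H v) (by omega)
  refine Net.red2 (N := h.toNet) (Or.inr hb) (fun b hb => ?_)
    (f1 := o t1) (f2 := o t2) (f3 := o t3) (f4 := o t4) fun b hb => ?_
  · have := h.mem_N3_of_E hb
    have := Finset.card_pos.2 ⟨b, this⟩
    omega
  · obtain ⟨t', ht', rfl⟩ := ho b hb
    rcases ht12 t' ht' with rfl | rfl | rfl | rfl <;> simp

lemma p43 (h : Crit H g T) {v w} (hv : dg H v = 4) (hp : (N2 H v).card = 3) (hw : D1 H w)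
    (hvw : H.Adj v w) : False := by
  classical
  have h3 := h.dg_eq v
  obtain ⟨o, ho⟩ := h.exists_oth v
  obtain ⟨t1, t2, t3, ht12⟩ := cov3 v (N2 H v) (by omega)
  obtain ⟨x, hx⟩ := cov1 v (N3 H v) (by omega)
  have hE : h.toNet.E v w := ⟨hvw, by omega, by have := hw.1; omega⟩
  refine Net.red3 (N := h.toNet) hE (h.typ.t1 _ hw)
    (fun b hb => (hx b (h.mem_N3_of_E hb)).trans (hx w (h.mem_N3_of_E hE)).symm)
    (f1 := o t1) (f2 := o t2) (f3 := o t3) fun b hb => ?_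
  obtain ⟨t', ht', rfl⟩ := ho b hb
  rcases ht12 t' ht' with rfl | rfl | rfl <;> simp
end Crit
end P6

open SimpleGraph
namespace P6
set_option linter.unusedSectionVars false
set_option linter.unusedSimpArgs false

open Classical in
/-- indicator -/
noncomputable def ii (p : Prop) : ℤ := if p then 1 else 0
lemma ii_t {p : Prop} (h : p) : ii p = 1 := if_pos h
lemma ii_f {p : Prop} (h : ¬ p) : ii p = 0 := if_neg h
lemma ii_nn (p : Prop) : 0 ≤ ii p := by unfold ii; split_ifs <;> simp
lemma ii_and (p q : Prop) : ii (p ∧ q) = ii p * ii q := by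
  by_cases hp : p <;> by_cases hq : q <;> simp [ii, hp, hq]
lemma ii_mono {p q : Prop} (h : p → q) : ii p ≤ ii q := by
  by_cases hp : p
  · rw [ii_t hp, ii_t (h hp)]
  · rw [ii_f hp]; exact ii_nn q

variable {V : Type*} [Fintype V]
lemma card_ii (p : V → Prop) [DecidablePred p] :
    ((Finset.univ.filter p).card : ℤ) = ∑ v, ii (p v) := by
  rw [Finset.card_filter]; push_cast
  refine Finset.sum_congr rfl fun v _ => ?_
  unfold ii; split_ifs <;> rfl

namespace Crit
variable {H : SimpleGraph V} {g : V → V → Bool} {T : Set V}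

lemma dg_ii (v : V) : (dg H v : ℤ) = ∑ u, ii (H.Adj v u) := by
  classical
  unfold dg; exact card_ii _
lemma N2_ii (v : V) : ((N2 H v).card : ℤ) = ∑ u, ii (H.Adj v u) * ii (dg H u = 2) := by
  classical
  simp only [← ii_and]
  unfold N2; exact card_ii _
lemma N3_ii (v : V) : ((N3 H v).card : ℤ) = ∑ u, ii (H.Adj v u) * ii (3 ≤ dg H u) := by
  classical
  simp only [← ii_and]
  unfold N3; exact card_ii _

lemma pointwise (h : Crit H g T) (v : V) :
    2 * (ii (3 ≤ dg H v) * (N2 H v).card) - 4 * ii (dg H v = 2)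
      + ii (4 ≤ dg H v) * (∑ u, ii (H.Adj v u) * ii (D1 H u)) + ii (D0 H v) - ii (D1 H v)
      ≤ 5 * dg H v - 14 * ii (v ∈ T) := by
  set m := ∑ u, ii (H.Adj v u) * ii (D1 H u) with hm
  have hd := h.dg_eq v
  have hmle : m ≤ (N3 H v).card := by
    rw [N3_ii]
    refine Finset.sum_le_sum fun u _ => mul_le_mul_of_nonneg_left (ii_mono fun h => ?_) (ii_nn _)
    have := h.1; omega
  by_cases hv : v ∈ T
  · have h2 := h.two_le hv
    rw [ii_t hv]
    by_cases e2 : dg H v = 2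
    · rw [ii_f (by omega : ¬ 3 ≤ dg H v), ii_f (by omega : ¬ 4 ≤ dg H v), ii_t e2,
        ii_f (fun h => by have := h.1; omega : ¬ D0 H v), ii_f (fun h => by have := h.1; omega : ¬ D1 H v), e2]
      norm_num
    rw [ii_f e2, ii_t (by omega : 3 ≤ dg H v)]
    by_cases e3 : dg H v = 3
    · rw [ii_f (by omega : ¬ 4 ≤ dg H v)]
      have := h.p3 e3
      by_cases hp : (N2 H v).card = 0
      · rw [ii_t (show D0 H v from ⟨e3, hp⟩), ii_f (fun h => by have := h.2; omega : ¬ D1 H v), e3, hp]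
        norm_num
      · have hp : (N2 H v).card = 1 := by omega
        rw [ii_t (show D1 H v from ⟨e3, hp⟩), ii_f (fun h => by have := h.2; omega : ¬ D0 H v), e3, hp]
        norm_num
    rw [ii_t (by omega : 4 ≤ dg H v), ii_f (fun h => e3 h.1 : ¬ D0 H v), ii_f (fun h => e3 h.1 : ¬ D1 H v)]
    by_cases e4 : dg H v = 4
    · have := h.p4 e4
      by_cases hp : (N2 H v).card = 3
      · have : m = 0 := by
          refine Finset.sum_eq_zero fun u _ => ?_
          rw [← ii_and, ii_f]
          rintro ⟨ha, hu⟩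
          exact h.p43 e4 hp hu ha
        rw [this, hp, e4]; norm_num
      · omega
    · omega
  · have h0 : dg H v = 0 := by
      zify
      rw [dg_ii]
      exact Finset.sum_eq_zero fun u _ => ii_f fun ha => hv (h.out _ _ ha)
    rw [ii_f hv, ii_f (by omega : ¬ 3 ≤ dg H v), ii_f (by omega : ¬ 4 ≤ dg H v), ii_f (by omega : ¬ dg H v = 2),
        ii_f (fun h => by have := h.1; omega : ¬ D0 H v), ii_f (fun h => by have := h.1; omega : ¬ D1 H v), h0]
    norm_num

lemma id1 (h : Crit H g T) : ∑ v, ii (3 ≤ dg H v) * ((N2 H v).card : ℤ) = 2 * ∑ v, ii (dg H v = 2) := by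
  simp only [N2_ii, Finset.mul_sum]
  rw [Finset.sum_comm]
  refine Finset.sum_congr rfl fun t _ => ?_
  by_cases ht : dg H t = 2
  · have : (dg H t : ℤ) = 2 := by exact_mod_cast ht
    rw [ii_t ht, mul_one, ← this, dg_ii]
    refine Finset.sum_congr rfl fun v _ => ?_
    by_cases hv : H.Adj v t
    · rw [ii_t hv, ii_t hv.symm, ii_t (h.three_of_adj2 ht hv.symm)]; norm_num
    · rw [ii_f hv, ii_f (fun h => hv h.symm : ¬ H.Adj t v)]; norm_num
  · simp [ii_f ht]

lemma id3 (h : Crit H g T) {a} (ha : D1 H a) :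
    ∑ b, ii (H.Adj a b) * ii (dg H b = 3) + ∑ b, ii (H.Adj a b) * ii (4 ≤ dg H b) = 2 := by
  have h1 := h.dg_eq a
  have h2 : ((N3 H a).card : ℤ) = 2 := by have := ha.1; have := ha.2; omega
  rw [← h2, N3_ii, ← Finset.sum_add_distrib]
  refine Finset.sum_congr rfl fun b _ => ?_
  rw [← mul_add]
  congr 1
  by_cases h3 : dg H b = 3
  · rw [ii_t h3, ii_f (by omega), ii_t (by omega)]; norm_num
  · by_cases h4 : 4 ≤ dg H b
    · rw [ii_f h3, ii_t h4, ii_t (by omega)]; norm_num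
    · rw [ii_f h3, ii_f h4, ii_f (by omega)]; norm_num

theorem count (h : Crit H g T) : ¬ 5 * ∑ v, dg H v < 14 * T.ncard := by
  classical
  intro hlt
  have hT : (T.ncard : ℤ) = ∑ v, ii (v ∈ T) := by
    rw [← card_ii, ← Set.ncard_coe_finset]; simp
  have hs := Finset.sum_le_sum fun v (_ : v ∈ Finset.univ) => h.pointwise v
  simp only [Finset.sum_add_distrib, Finset.sum_sub_distrib, ← Finset.mul_sum] at hs
  rw [h.id1, ← hT] at hs
  have hlt' : 5 * ∑ v, (dg H v : ℤ) < 14 * T.ncard := by exact_mod_cast hlt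
  have id2 : ∑ v, ii (4 ≤ dg H v) * (∑ u, ii (H.Adj v u) * ii (D1 H u))
      = ∑ a, ii (D1 H a) * ∑ b, ii (H.Adj a b) * ii (4 ≤ dg H b) := by
    simp only [Finset.mul_sum]
    rw [Finset.sum_comm]
    refine Finset.sum_congr rfl fun a _ => Finset.sum_congr rfl fun b _ => ?_
    rw [H.adj_comm]; ring
  rw [id2] at hs
  have id4 : ∑ a, ii (D1 H a) * ∑ b, ii (H.Adj a b) * ii (dg H b = 3)
      + ∑ a, ii (D1 H a) * ∑ b, ii (H.Adj a b) * ii (4 ≤ dg H b) = 2 * ∑ a, ii (D1 H a) := by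
    rw [← Finset.sum_add_distrib, Finset.mul_sum]
    refine Finset.sum_congr rfl fun a _ => ?_
    by_cases ha : D1 H a
    · rw [← mul_add, h.id3 ha]; ring
    · simp [ii_f ha]
  have d3 : ∀ v, D0 H v ∨ D1 H v ↔ dg H v = 3 := by
    intro v
    constructor
    · rintro (h | h) <;> exact h.1
    · intro h3
      have := h.p3 h3
      by_cases hp : (N2 H v).card = 0
      · exact Or.inl ⟨h3, hp⟩
      · exact Or.inr ⟨h3, by omega⟩
  let S := Finset.univ.filter fun v => dg H v = 3
  refine Net.no_dense h.typ S (fun a ha => (d3 a).2 (by simpa [S] using ha)) ?_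
  have hS : (S.card : ℤ) = ∑ v, ii (D0 H v) + ∑ v, ii (D1 H v) := by
    rw [card_ii, ← Finset.sum_add_distrib]
    refine Finset.sum_congr rfl fun v _ => ?_
    by_cases h0 : D0 H v
    · rw [ii_t h0, ii_t h0.1, ii_f (fun h1 => h.typ.dj v h0 h1)]; norm_num
    · by_cases h1 : D1 H v
      · rw [ii_f h0, ii_t h1.1, ii_t h1]; norm_num
      · rw [ii_f h0, ii_f h1, ii_f (fun h => ((d3 v).2 h).elim h0 h1)]; norm_num
  have hmm : ((∑ a ∈ S, ∑ b ∈ S, Net.mm h.toNet (D1 H) a b : ℕ) : ℤ)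
      = 2 * ∑ a, ii (D1 H a) * ∑ b, ii (H.Adj a b) * ii (dg H b = 3) := by
    have e1 : ((∑ a ∈ S, ∑ b ∈ S, Net.mm h.toNet (D1 H) a b : ℕ) : ℤ)
      = ∑ a, ∑ b, (ii (D1 H a) * (ii (H.Adj a b) * ii (dg H b = 3))
          + ii (D1 H b) * (ii (H.Adj b a) * ii (dg H a = 3))) := by
      push_cast
      simp only [S, Finset.sum_filter]
      refine Finset.sum_congr rfl fun a _ => ?_
      by_cases ha : dg H a = 3
      · rw [if_pos ha, ii_t ha]
        refine Finset.sum_congr rfl fun b _ => ?_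
        by_cases hb : dg H b = 3
        · rw [if_pos hb, ii_t hb, H.adj_comm b a]
          unfold Net.mm
          by_cases hab : H.Adj a b
          · have hE : h.toNet.E a b := ⟨hab, by omega, by omega⟩
            rw [if_pos hE, ii_t hab]
            push_cast
            unfold ii
            simp
          · have hE : ¬ h.toNet.E a b := fun h => hab h.1
            rw [if_neg hE, ii_f hab]; simp
        · rw [if_neg hb, ii_f hb, ii_f (fun h => hb h.1 : ¬ D1 H b)]; simp
      · rw [if_neg ha, ii_f ha, ii_f (fun h => ha h.1 : ¬ D1 H a)]; simp
    rw [e1]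
    simp only [Finset.sum_add_distrib]
    rw [Finset.sum_comm (f := fun a b => ii (D1 H b) * (ii (H.Adj b a) * ii (dg H a = 3)))]
    simp only [Finset.mul_sum]
    ring_nf
    simp only [← Finset.mul_sum, Finset.sum_mul]
    try ring
  zify
  push_cast at hmm
  rw [hmm, hS]
  linarith
end Crit
end P6

open SimpleGraph
namespace P6
set_option linter.unusedSectionVars false
set_option linter.unusedSimpArgs false
variable {V : Type*} [Fintype V]

lemma cyc_ge {G : SimpleGraph V} (hg : 7 ≤ G.egirth) {u} {p : G.Walk u u} (hp : p.IsCycle) :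
    7 ≤ p.length := by
  have h := le_trans hg (le_egirth.1 le_rfl u _ hp)
  exact_mod_cast h

lemma no_tri {G : SimpleGraph V} (hg : 7 ≤ G.egirth) {a b c} (h1 : G.Adj a b) (h2 : G.Adj b c) :
    ¬ G.Adj a c := by
  intro h3
  have : (Walk.cons h1 (Walk.cons h2 (Walk.cons h3.symm Walk.nil))).IsCycle := by
    rw [Walk.cons_isCycle_iff]
    simp [Walk.cons_isPath_iff, h1.ne, h2.ne, h3.ne, h1.ne', h2.ne', h3.ne']
  have := cyc_ge hg this
  simp at this

lemma no_sq {G : SimpleGraph V} (hg : 7 ≤ G.egirth) {a b c d} (h1 : G.Adj a b) (h2 : G.Adj b c)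
    (h3 : G.Adj c d) (h4 : G.Adj d a) (hac : a ≠ c) : b = d := by
  by_contra hbd
  have : (Walk.cons h1 (Walk.cons h2 (Walk.cons h3 (Walk.cons h4 Walk.nil)))).IsCycle := by
    rw [Walk.cons_isCycle_iff]
    simp [Walk.cons_isPath_iff, h1.ne, h2.ne, h3.ne, h1.ne', h2.ne', h3.ne', h4.ne, h4.ne', hac,
      hac.symm, hbd, Ne.symm hbd]
  have := cyc_ge hg this
  simp at this

lemma sum_dg (H : SimpleGraph V) : ∑ v, dg H v = 2 * H.edgeSet.ncard := by
  classical
  have := H.sum_degrees_eq_twice_card_edges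
  rw [← coe_edgeFinset, Set.ncard_coe_finset, ← this]
  refine Finset.sum_congr rfl fun v _ => ?_
  unfold dg
  rw [← card_neighborFinset_eq_degree]
  congr 1
  ext u
  simp

theorem colorable {G : SimpleGraph V} (hG : IsPlanar G) (hg : 7 ≤ G.egirth) (g : V → V → Bool)
    (gs : ∀ a b, g a b = g b a) :
    ∃ ψ : V → Col, ∀ a b, G.Adj a b → comp (g a b) (ψ a) (ψ b) = true := by
  classical
  by_contra hno
  let Bad : Set (Set V) :=
    {T | ¬ ∃ ψ : V → Col, ∀ a b, (ind G T).Adj a b → comp (g a b) (ψ a) (ψ b) = true}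
  have hne : Bad.Nonempty := by
    refine ⟨Set.univ, fun ⟨ψ, hψ⟩ => hno ⟨ψ, fun a b h => hψ a b ⟨h, trivial, trivial⟩⟩⟩
  obtain ⟨T, hT, hmin⟩ := (wellFounded_lt (α := Set V)).has_min Bad hne
  have hTne : T.Nonempty := by
    by_contra h
    rw [Set.not_nonempty_iff_eq_empty] at h
    subst h
    exact hT ⟨fun _ => (0, false, false), fun a b h => h.2.1.elim⟩
  have hle : ind G T ≤ G := ind_le _ _
  have hc : Crit (ind G T) g T :=
    { gs := gs
      out := fun a b h => h.2.1
      nc := fun ψ h => hT ⟨ψ, h⟩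
      cr := by
        intro v hv
        have h1 : T \ {v} < T :=
          ⟨Set.sdiff_subset, fun h => (h hv).2 rfl⟩
        have h2 : T \ {v} ∉ Bad := fun h => hmin _ h h1
        obtain ⟨ψ, hψ⟩ := not_not.1 h2
        exact ⟨ψ, fun a b ha hb h => hψ a b ⟨h.1, ⟨h.2.1, ha⟩, ⟨h.2.2, hb⟩⟩⟩
      tri := fun h1 h2 h3 => no_tri hg (hle h1) (hle h2) (hle h3)
      sq := fun h1 h2 h3 h4 => no_sq hg (hle h1) (hle h2) (hle h3) (hle h4) }
  have hs := sparse hG hg T hTne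
  refine hc.count ?_
  rw [sum_dg]
  omega

def sg (b : Bool) : ℤˣ := if b then -1 else 1
lemma sg_sq (b : Bool) : sg b * sg b = 1 := by cases b <;> rfl

def fo (c : Col) : Fin 6 := ⟨2 * c.1.1 + (if c.2.2 then 1 else 0), by
  have := c.1.2; split_ifs <;> omega⟩

set_option maxRecDepth 100000 in
set_option maxHeartbeats 2000000 in
lemma fo_spec : ∀ (g : Bool) (c d : Col), comp g c d = true →
    fo c ≠ fo d ∧ matchSign 6 s(fo c, fo d) = sg c.2.1 * sg g * sg d.2.1 := by
  decide

theorem main (G : SimpleGraph V) (hplanar : IsPlanar G) (hgirth : 7 ≤ G.egirth)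
    (σ : Sym2 V → ℤˣ) :
    SignedHom G σ (⊤ : SimpleGraph (Fin 6)) (matchSign 6) := by
  obtain ⟨ψ, hψ⟩ := colorable hplanar hgirth (fun u v => decide (σ s(u, v) = -1))
    (fun a b => by rw [Sym2.eq_swap])
  have hsg : ∀ e, sg (decide (σ e = -1)) = σ e := by
    intro e
    rcases Int.units_eq_one_or (σ e) with h | h <;> rw [h] <;> rfl
  let f : G →g (⊤ : SimpleGraph (Fin 6)) :=
    ⟨fun v => fo (ψ v), fun {a b} h => (fo_spec _ _ _ (hψ a b h)).1⟩
  refine ⟨f, ?_⟩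
  have key : ∀ u v (w : G.Walk u v),
      walkSign (matchSign 6) (w.map f) = sg (ψ u).2.1 * walkSign σ w * sg (ψ v).2.1 := by
    intro u v w
    induction w with
    | nil => simp [walkSign, sg_sq]
    | @cons a b c h p ih =>
      have h1 := (fo_spec _ _ _ (hψ a b h)).2
      rw [hsg] at h1
      have e1 : walkSign (matchSign 6) ((Walk.cons h p).map f)
          = matchSign 6 s(fo (ψ a), fo (ψ b)) * walkSign (matchSign 6) (p.map f) := by
        simp [walkSign, f]
      have e2 : walkSign σ (Walk.cons h p) = σ s(a, b) * walkSign σ p := by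
        simp [walkSign]
      rw [e1, e2, ih, h1]
      calc _ = sg (ψ a).2.1 * σ s(a, b) * (sg (ψ b).2.1 * sg (ψ b).2.1) * walkSign σ p * sg (ψ c).2.1 := by
            simp only [mul_assoc]
        _ = _ := by rw [sg_sq, mul_one]; simp only [mul_assoc]
  intro u w
  rw [key, mul_comm (sg _), mul_assoc, sg_sq, mul_one]
end P6

/-- If `G` is a finite simple planar graph of girth at least `7`, then for every signature `σ`
the signed graph `(G, σ)` admits a homomorphism to `(K_6, M)`. -/
theorem signedHom_K6M_of_planar_girth_ge_seven {V : Type*} [Fintype V]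
    (G : SimpleGraph V) (hplanar : IsPlanar G) (hgirth : 7 ≤ G.egirth)
    (σ : Sym2 V → ℤˣ) :
    SignedHom G σ (⊤ : SimpleGraph (Fin 6)) (matchSign 6) := by
  exact P6.main G hplanar hgirth σ
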